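/- arXiv:1401.1353 — 2 statements merged into one kernel-verified Lean document; each statement's English description precedes it below -/
import Mathlib

section
/- Let Λ ⊆ ℝ^{2d} be a countable relatively separated set and v a submultiplicative weight on ℝ^{2d} satisfying the GRS condition. Let G ∈ C_v(Λ) be self-adjoint as a bounded operator on ℓ²(Λ), and suppose its spectrum satisfies σ(G) ⊆ {0} ∪ [A, B] for some 0 < A ≤ B. Then the orthogonal projection P of ℓ²(Λ) onto ker G belongs to C_v(Λ); in particular there exists Θ ∈ W(C, ℓ¹_v) with |P_{λμ}| ≤ Θ(λ−μ) for all λ, μ ∈ Λ. -/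
open MeasureTheory Filter

noncomputable section

abbrev Ed (d : ℕ) := EuclideanSpace ℝ (Fin d)
abbrev E2 (d : ℕ) := EuclideanSpace ℝ (Fin d ⊕ Fin d)

def timePart {d : ℕ} (z : E2 d) : Ed d := WithLp.toLp 2 (fun i => z (Sum.inl i))
def freqPart {d : ℕ} (z : E2 d) : Ed d := WithLp.toLp 2 (fun i => z (Sum.inr i))

def tfShift {d : ℕ} (z : E2 d) (g : Ed d → ℂ) : Ed d → ℂ :=
  fun t => Complex.exp (2 * Real.pi * Complex.I *
      (∑ i : Fin d, (freqPart z i : ℂ) * (t i : ℂ))) * g (t - timePart z)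

def L2inner {d : ℕ} (f h : Ed d → ℂ) : ℂ :=
  ∫ t : Ed d, f t * (starRingEnd ℂ) (h t)

def L2normSq {d : ℕ} (f : Ed d → ℂ) : ℝ := ∫ t : Ed d, ‖f t‖ ^ 2

def gaussian (d : ℕ) : Ed d → ℂ := fun t => (Real.exp (-Real.pi * ‖t‖ ^ 2) : ℝ)

/-- A (positive, submultiplicative) weight function. -/
structure IsWeight {d : ℕ} (v : E2 d → ℝ) : Prop where
  pos : ∀ z, 0 < v z
  submul : ∀ z w, v (z + w) ≤ v z * v w

/-- The Gelfand–Raikov–Shilov condition `lim_n v(nz)^{1/n} = 1`. -/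
def SatisfiesGRS {d : ℕ} (v : E2 d → ℝ) : Prop :=
  ∀ z : E2 d, Tendsto (fun n : ℕ => Real.rpow (v ((n : ℝ) • z)) ((n : ℝ)⁻¹)) atTop (nhds 1)

/-- Subconvolutivity: `(v⁻¹ * v⁻¹)(z) ≤ C v(z)⁻¹`. -/
def Subconvolutive {d : ℕ} (v : E2 d → ℝ) : Prop :=
  ∃ C > 0, ∀ z : E2 d,
    (∫⁻ w : E2 d, ENNReal.ofReal ((v w)⁻¹ * (v (z - w))⁻¹)) ≤ ENNReal.ofReal (C * (v z)⁻¹)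

/-- A set is relatively separated if balls of radius 1 contain boundedly many points. -/
def RelativelySeparated {d : ℕ} (Λ : Set (E2 d)) : Prop :=
  ∃ N : ℕ, ∀ z : E2 d, ({l ∈ Λ | dist l z ≤ 1}).encard ≤ (N : ℕ∞)

/-- The Gabor frame inequalities with frame bounds `A, B`. -/
def GaborFrame {d : ℕ} (g : Ed d → ℂ) (Λ : Set (E2 d)) (A B : ℝ) : Prop :=
  0 < A ∧ 0 < B ∧ ∀ f : Ed d → ℂ, MemLp f 2 (volume : Measure (Ed d)) →
    A * L2normSq f ≤ (∑' l : Λ, ‖L2inner f (tfShift (l : E2 d) g)‖ ^ 2) ∧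
    (∑' l : Λ, ‖L2inner f (tfShift (l : E2 d) g)‖ ^ 2) ≤ B * L2normSq f

/-- The Bessel inequality with Bessel bound `B`. -/
def GaborBessel {d : ℕ} (g : Ed d → ℂ) (Λ : Set (E2 d)) (B : ℝ) : Prop :=
  ∀ f : Ed d → ℂ, MemLp f 2 (volume : Measure (Ed d)) →
    (∑' l : Λ, ‖L2inner f (tfShift (l : E2 d) g)‖ ^ 2) ≤ B * L2normSq f

/-- `c` lies in the kernel of the synthesis operator `D_{g,Λ}`:  the partial sums
`∑_{λ ∈ s} c_λ π(λ) g` tend to `0` in `L²`. -/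
def InSynthKernel {d : ℕ} (g : Ed d → ℂ) (Λ : Set (E2 d)) (c : Λ → ℂ) : Prop :=
  Tendsto (fun s : Finset Λ => ∫ t : Ed d, ‖∑ l ∈ s, c l * tfShift (l : E2 d) g t‖ ^ 2)
    atTop (nhds 0)

/-- A Gabor system is a Riesz basis if it is a frame and the synthesis operator has
trivial kernel on `ℓ²(Λ)`. -/
def GaborRieszBasis {d : ℕ} (g : Ed d → ℂ) (Λ : Set (E2 d)) : Prop :=
  (∃ A B : ℝ, GaborFrame g Λ A B) ∧
  ∀ c : Λ → ℂ, Summable (fun l : Λ => ‖c l‖ ^ 2) → InSynthKernel g Λ c → ∀ l, c l = 0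

/-- The lower Riesz bound `A_n` of the finite section `G(g, Λ ∩ B_n(0))`. -/
def lowerRiesz {d : ℕ} (g : Ed d → ℂ) (Λ : Set (E2 d)) (n : ℕ) : ℝ :=
  sInf { r : ℝ | ∃ (s : Finset Λ) (c : Λ → ℂ),
    (∀ l ∈ s, ‖(l : E2 d)‖ ≤ (n : ℝ)) ∧
    0 < (∑ l ∈ s, ‖c l‖ ^ 2) ∧
    r = (∫ t : Ed d, ‖∑ l ∈ s, c l * tfShift (l : E2 d) g t‖ ^ 2) / (∑ l ∈ s, ‖c l‖ ^ 2) }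

/-- Membership of `g` in the modulation space `M¹_v`. -/
def MemM1 {d : ℕ} (g : Ed d → ℂ) (v : E2 d → ℝ) : Prop :=
  ∫⁻ z : E2 d, ENNReal.ofReal (‖L2inner g (tfShift z (gaussian d))‖ * v z) < ⊤

/-- Membership of `g` in the modulation space `M^∞_v`. -/
def MemMInf {d : ℕ} (g : Ed d → ℂ) (v : E2 d → ℝ) : Prop :=
  ∃ C : ℝ, ∀ z : E2 d, ‖L2inner g (tfShift z (gaussian d))‖ * v z ≤ C

/-- The integer lattice point `k ∈ ℤ^{2d}` as an element of `ℝ^{2d}`. -/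
def intVec {d : ℕ} (k : (Fin d ⊕ Fin d) → ℤ) : E2 d := WithLp.toLp 2 (fun i => (k i : ℝ))

def unitCube (d : ℕ) : Set (E2 d) := {z | ∀ i, z i ∈ Set.Icc (0 : ℝ) 1}

/-- `sup_{z ∈ [0,1]^{2d}} |Θ(k+z)|`. -/
def cubeSup {d : ℕ} {F : Type*} [NormedAddCommGroup F] (Θ : E2 d → F)
    (k : (Fin d ⊕ Fin d) → ℤ) : ℝ :=
  sSup ((fun z => ‖Θ (intVec k + z)‖) '' unitCube d)

/-- Membership in the Wiener amalgam space `W(C, ℓ¹_v)`. -/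
def MemAmalgamW {d : ℕ} {F : Type*} [NormedAddCommGroup F] (Θ : E2 d → F)
    (v : E2 d → ℝ) : Prop :=
  Continuous Θ ∧ Summable (fun k : (Fin d ⊕ Fin d) → ℤ => cubeSup Θ k * v (intVec k))

/-- The norm of the Wiener amalgam space `W(C, ℓ¹_v)`. -/
def amalgamNorm {d : ℕ} {F : Type*} [NormedAddCommGroup F] (Θ : E2 d → F)
    (v : E2 d → ℝ) : ℝ :=
  ∑' k : (Fin d ⊕ Fin d) → ℤ, cubeSup Θ k * v (intVec k)

/-- Convolution-dominated matrices `C_v(Λ)`. -/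
def MemCv {d : ℕ} {Λ : Set (E2 d)} (A : Λ → Λ → ℂ) (v : E2 d → ℝ) : Prop :=
  ∃ Θ : E2 d → ℝ, MemAmalgamW Θ v ∧ ∀ l m : Λ, ‖A l m‖ ≤ Θ ((l : E2 d) - (m : E2 d))

/-- The norm on `C_v(Λ)`. -/
def CvNorm {d : ℕ} {Λ : Set (E2 d)} (A : Λ → Λ → ℂ) (v : E2 d → ℝ) : ℝ :=
  sInf { r : ℝ | ∃ Θ : E2 d → ℝ, MemAmalgamW Θ v ∧
    (∀ l m : Λ, ‖A l m‖ ≤ Θ ((l : E2 d) - (m : E2 d))) ∧ r = amalgamNorm Θ v }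

/-- Matrices with off-diagonal decay `v⁻¹` (the class `C_v^∞(Λ)`, Jaffard class). -/
def MemCvInf {d : ℕ} {Λ : Set (E2 d)} (A : Λ → Λ → ℂ) (v : E2 d → ℝ) : Prop :=
  ∃ C : ℝ, ∀ l m : Λ, ‖A l m‖ * v ((l : E2 d) - (m : E2 d)) ≤ C

/-- The norm on `C_v^∞(Λ)`. -/
def CvInfNorm {d : ℕ} {Λ : Set (E2 d)} (A : Λ → Λ → ℂ) (v : E2 d → ℝ) : ℝ :=
  sSup { r : ℝ | ∃ l m : Λ, r = ‖A l m‖ * v ((l : E2 d) - (m : E2 d)) }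

/-- The Gram matrix `(G_{g,Λ})_{λμ} = ⟨π(μ)g, π(λ)g⟩`. -/
def gramMatrix {d : ℕ} (g : Ed d → ℂ) (Λ : Set (E2 d)) : Λ → Λ → ℂ :=
  fun l m => L2inner (tfShift (m : E2 d) g) (tfShift (l : E2 d) g)

/-- A bounded operator `T` on `ℓ²(Λ)` is represented by the matrix `A`. -/
def Represents {d : ℕ} {Λ : Set (E2 d)}
    (T : lp (fun _ : Λ => ℂ) 2 →L[ℂ] lp (fun _ : Λ => ℂ) 2) (A : Λ → Λ → ℂ) : Prop :=
  ∀ c : lp (fun _ : Λ => ℂ) 2, ∀ l : Λ, (T c : ∀ _ : Λ, ℂ) l = ∑' m : Λ, A l m * (c : ∀ _ : Λ, ℂ) m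

/-- The standard basis vector `e_m` of `ℓ²(Λ)`. -/
def lpSingle {d : ℕ} {Λ : Set (E2 d)} (m : Λ) : lp (fun _ : Λ => ℂ) 2 :=
  haveI := Classical.decEq (↥Λ)
  lp.single 2 m (1 : ℂ)

open scoped ENNReal

/-- The Hilbert space `ℓ²(X)`. -/
abbrev SeqL2 (X : Type*) := lp (fun _ : X => ℂ) 2

/-- The standard basis vectors of `ℓ²(X)`. -/
def unitVec {X : Type*} (x : X) : SeqL2 X :=
  haveI := Classical.decEq X
  lp.single 2 x (1 : ℂ)

/-- The matrix entries of a bounded operator on `ℓ²(X)`. -/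
def entry {X : Type*} (T : SeqL2 X →L[ℂ] SeqL2 X) (x y : X) : ℂ := (T (unitVec y) : X → ℂ) x

section SeqL2

variable {X : Type*}

lemma enorm_unitVec (x : X) : ‖unitVec x‖ₑ = 1 := by
  classical
  have h : ‖unitVec x‖ = 1 := by
    have := lp.norm_single (E := fun _ : X => ℂ) (p := 2) (by norm_num) x (1 : ℂ)
    rw [norm_one] at this
    rw [← this, unitVec]
  rw [← ofReal_norm, h, ENNReal.ofReal_one]

lemma hasSum_smul_unitVec (g : SeqL2 X) :
    HasSum (fun y => (g : X → ℂ) y • unitVec y) g := by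
  classical
  have h := lp.hasSum_single (E := fun _ : X => ℂ) (p := 2) (by norm_num) g
  convert h using 2 with y
  rw [unitVec, ← lp.single_smul, smul_eq_mul, mul_one]

lemma hasSum_entry_mul (T : SeqL2 X →L[ℂ] SeqL2 X) (g : SeqL2 X) (x : X) :
    HasSum (fun y => entry T x y * (g : X → ℂ) y) ((T g : X → ℂ) x) := by
  have h := ((lp.evalCLM ℂ (fun _ : X => ℂ) 2 x).comp T).hasSum (hasSum_smul_unitVec g)
  refine h.congr_fun fun y => ?_
  simp only [ContinuousLinearMap.comp_apply, map_smul, smul_eq_mul]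
  exact mul_comm _ _

lemma enorm_apply_le (g : SeqL2 X) (x : X) : ‖(g : X → ℂ) x‖ₑ ≤ ‖g‖ₑ := by
  rw [← ofReal_norm, ← ofReal_norm]
  exact ENNReal.ofReal_le_ofReal (lp.norm_apply_le_norm (by norm_num) g x)

lemma enorm_sq_eq_tsum (g : SeqL2 X) : ‖g‖ₑ ^ 2 = ∑' x, ‖(g : X → ℂ) x‖ₑ ^ 2 := by
  have h := lp.hasSum_norm (p := 2) (by norm_num) g
  simp only [ENNReal.toReal_ofNat, Real.rpow_ofNat] at h
  have h2 := ENNReal.ofReal_tsum_of_nonneg (fun x => by positivity) h.summable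
  rw [h.tsum_eq, ENNReal.ofReal_pow (norm_nonneg _), ofReal_norm] at h2
  rw [h2]
  refine tsum_congr fun x => ?_
  rw [ENNReal.ofReal_pow (norm_nonneg _), ofReal_norm]

/-- Multiplication by a function bounded by one. -/
def mulOp (f : X → ℝ) (hf : ∀ x, |f x| ≤ 1) : SeqL2 X →L[ℂ] SeqL2 X :=
  LinearMap.mkContinuous
    { toFun := fun g => ⟨fun x => (f x : ℂ) * (g : X → ℂ) x, by
        have hg := (lp.memℓp g).summable (by norm_num)
        refine memℓp_gen (hg.of_nonneg_of_le (fun x => by positivity) fun x => ?_)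
        gcongr
        rw [norm_mul, Complex.norm_real]
        exact mul_le_of_le_one_left (norm_nonneg _) (hf x)⟩
      map_add' := fun g h => by
        ext x
        exact mul_add _ _ _
      map_smul' := fun c g => by
        ext x
        simp only [lp.coeFn_smul, Pi.smul_apply, smul_eq_mul, RingHom.id_apply]
        ring } 1 (fun g => by
    rw [one_mul]
    refine lp.norm_le_of_forall_sum_le (by norm_num) (norm_nonneg _) fun s => ?_
    refine le_trans (Finset.sum_le_sum fun x _ => ?_)
      (lp.sum_rpow_le_norm_rpow (by norm_num) g s)
    gcongr
    change ‖(f x : ℂ) * (g : X → ℂ) x‖ ≤ _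
    rw [norm_mul, Complex.norm_real]
    exact mul_le_of_le_one_left (norm_nonneg _) (hf x))

lemma mulOp_apply (f : X → ℝ) (hf : ∀ x, |f x| ≤ 1) (g : SeqL2 X) (x : X) :
    (mulOp f hf g : X → ℂ) x = (f x : ℂ) * (g : X → ℂ) x := rfl

lemma enorm_le_enorm_of_forall (g h : SeqL2 X)
    (hgh : ∀ x, ‖(g : X → ℂ) x‖ₑ ≤ ‖(h : X → ℂ) x‖ₑ) : ‖g‖ₑ ≤ ‖h‖ₑ := by
  have : ‖g‖ₑ ^ 2 ≤ ‖h‖ₑ ^ 2 := by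
    rw [enorm_sq_eq_tsum, enorm_sq_eq_tsum]
    exact ENNReal.tsum_le_tsum fun x => by gcongr; exact hgh x
  exact (ENNReal.pow_le_pow_left_iff two_ne_zero).1 this

lemma two_mul_mul_le_add_sq_div {a b C : ℝ≥0∞} (ha : a ≠ ⊤) (hb : b ≠ ⊤) (hC : C ≠ ⊤)
    (hC0 : C ≠ 0) : 2 * (a * b) ≤ a ^ 2 * C⁻¹ + C * b ^ 2 := by
  lift a to NNReal using ha
  lift b to NNReal using hb
  lift C to NNReal using hC
  have hC1 : C ≠ 0 := by exact_mod_cast hC0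
  rw [← ENNReal.coe_inv hC1]
  norm_cast
  rw [← NNReal.coe_le_coe]
  push_cast
  have h : (0 : ℝ) < C := by positivity
  have key : (a : ℝ) ^ 2 * (C : ℝ)⁻¹ + C * (b : ℝ) ^ 2 - 2 * (a * b)
      = ((a : ℝ) - C * b) ^ 2 * (C : ℝ)⁻¹ := by
    field_simp
    ring
  have : (0 : ℝ) ≤ ((a : ℝ) - C * b) ^ 2 * (C : ℝ)⁻¹ := by positivity
  linarith

lemma enorm_apply_le_tsum (D : SeqL2 X →L[ℂ] SeqL2 X) (g : SeqL2 X) (x : X) :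
    ‖(D g : X → ℂ) x‖ₑ ≤ ∑' y, ‖entry D x y‖ₑ * ‖(g : X → ℂ) y‖ₑ := by
  rw [← (hasSum_entry_mul D g x).tsum_eq]
  exact enorm_tsum_le_tsum_enorm.trans (ENNReal.tsum_le_tsum fun y => by rw [enorm_mul])

/-- Schur's test. -/
lemma enorm_apply_le_of_schur (D : SeqL2 X →L[ℂ] SeqL2 X) (K : X → X → ℝ≥0∞) (C : ℝ≥0∞)
    (hD : ∀ x y, ‖entry D x y‖ₑ ≤ K x y) (hr : ∀ x, ∑' y, K x y ≤ C)
    (hc : ∀ y, ∑' x, K x y ≤ C) (g : SeqL2 X) : ‖D g‖ₑ ≤ C * ‖g‖ₑ := by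
  have hle : ∀ x, ‖(D g : X → ℂ) x‖ₑ ≤ ∑' y, K x y * ‖(g : X → ℂ) y‖ₑ := fun x =>
    (enorm_apply_le_tsum D g x).trans (ENNReal.tsum_le_tsum fun y => by gcongr; exact hD x y)
  rcases eq_or_ne C 0 with rfl | hC0
  · have hK : ∀ x y, K x y = 0 := fun x y =>
      le_antisymm ((ENNReal.le_tsum y).trans (hr x)) zero_le
    have : ‖D g‖ₑ ^ 2 = 0 := by
      rw [enorm_sq_eq_tsum, ENNReal.tsum_eq_zero]
      intro x
      have := hle x
      simp only [hK, zero_mul, tsum_zero, nonpos_iff_eq_zero] at this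
      simp [this]
    rw [pow_eq_zero_iff two_ne_zero] at this
    simp [this]
  rcases eq_or_ne C ⊤ with rfl | hC
  · rcases eq_or_ne g 0 with rfl | hg
    · simp
    · rw [ENNReal.top_mul (by simpa using hg)]
      exact le_top
  set S := ‖D g‖ₑ ^ 2 with hS
  have hS_ne_top : S ≠ ⊤ := by simp [hS]
  have h1 : S + S ≤ S + C ^ 2 * ‖g‖ₑ ^ 2 := by
    calc S + S = 2 * S := (two_mul S).symm
      _ = ∑' x, 2 * ‖(D g : X → ℂ) x‖ₑ ^ 2 := by rw [hS, enorm_sq_eq_tsum, ENNReal.tsum_mul_left]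
      _ ≤ ∑' x, ∑' y, (K x y * (‖(D g : X → ℂ) x‖ₑ ^ 2 * C⁻¹)
            + K x y * (C * ‖(g : X → ℂ) y‖ₑ ^ 2)) := by
        refine ENNReal.tsum_le_tsum fun x => ?_
        calc 2 * ‖(D g : X → ℂ) x‖ₑ ^ 2
            ≤ 2 * (‖(D g : X → ℂ) x‖ₑ * ∑' y, K x y * ‖(g : X → ℂ) y‖ₑ) := by
              rw [sq]; gcongr; exact hle x
          _ = ∑' y, K x y * (2 * (‖(D g : X → ℂ) x‖ₑ * ‖(g : X → ℂ) y‖ₑ)) := by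
              rw [← ENNReal.tsum_mul_left, ← ENNReal.tsum_mul_left]
              exact tsum_congr fun y => by ring
          _ ≤ _ := by
              refine ENNReal.tsum_le_tsum fun y => ?_
              rw [← mul_add]
              gcongr
              exact two_mul_mul_le_add_sq_div enorm_ne_top enorm_ne_top hC hC0
      _ = (∑' x, (∑' y, K x y) * (‖(D g : X → ℂ) x‖ₑ ^ 2 * C⁻¹))
            + ∑' y, (∑' x, K x y) * (C * ‖(g : X → ℂ) y‖ₑ ^ 2) := by
        simp_rw [ENNReal.tsum_add, ENNReal.tsum_mul_right]
        congr 1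
        rw [ENNReal.tsum_comm]
        simp_rw [ENNReal.tsum_mul_right]
      _ ≤ (∑' x, C * (‖(D g : X → ℂ) x‖ₑ ^ 2 * C⁻¹))
            + ∑' y, C * (C * ‖(g : X → ℂ) y‖ₑ ^ 2) := by
        gcongr with x y
        · exact hr x
        · exact hc y
      _ = S + C ^ 2 * ‖g‖ₑ ^ 2 := by
        rw [hS, enorm_sq_eq_tsum, enorm_sq_eq_tsum g, ENNReal.tsum_mul_left,
          ENNReal.tsum_mul_right, ENNReal.tsum_mul_left, ENNReal.tsum_mul_left]
        congr 1
        · rw [mul_comm, mul_assoc, ENNReal.inv_mul_cancel hC0 hC, mul_one]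
        · ring
  have h2 : S ≤ (C * ‖g‖ₑ) ^ 2 := by
    rw [mul_pow]
    exact (ENNReal.add_le_add_iff_left hS_ne_top).1 h1
  exact (ENNReal.pow_le_pow_left_iff two_ne_zero).1 h2

end SeqL2

lemma ENNReal.tsum_liminf_le {α : Type*} (f : ℕ → α → ℝ≥0∞) :
    ∑' a, liminf (fun n => f n a) atTop ≤ liminf (fun n => ∑' a, f n a) atTop := by
  let : MeasurableSpace α := ⊤
  have h := lintegral_liminf_le (μ := Measure.count) (f := f) (u := atTop) fun n => measurable_from_top
  simpa only [lintegral_count] using h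

section Entry

variable {X : Type*}

lemma entry_mul (S T : SeqL2 X →L[ℂ] SeqL2 X) (l m : X) :
    HasSum (fun j => entry S l j * entry T j m) (entry (S * T) l m) :=
  hasSum_entry_mul S (T (unitVec m)) l

lemma entry_add (S T : SeqL2 X →L[ℂ] SeqL2 X) (l m : X) :
    entry (S + T) l m = entry S l m + entry T l m := rfl

lemma entry_smul (c : ℂ) (T : SeqL2 X →L[ℂ] SeqL2 X) (l m : X) :
    entry (c • T) l m = c * entry T l m := rfl

lemma enorm_entry_one_le (l m : X) :
    ‖entry (1 : SeqL2 X →L[ℂ] SeqL2 X) l m‖ₑ ≤ 1 := by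
  refine (enorm_apply_le _ l).trans ?_
  rw [one_apply_eq_self, enorm_unitVec]

lemma unitVec_apply_of_ne {l m : X} (h : l ≠ m) : (unitVec m : X → ℂ) l = 0 := by
  classical
  rw [unitVec, lp.single_apply_ne _ _ _ h]

lemma unitVec_apply_self (m : X) : (unitVec m : X → ℂ) m = 1 := by
  classical
  rw [unitVec, lp.single_apply_self]

lemma tendsto_entry {T : ℕ → SeqL2 X →L[ℂ] SeqL2 X} {S : SeqL2 X →L[ℂ] SeqL2 X}
    (h : Tendsto T atTop (nhds S)) (l m : X) :
    Tendsto (fun n => entry (T n) l m) atTop (nhds (entry S l m)) := by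
  have h1 : Tendsto (fun n => T n (unitVec m)) atTop (nhds (S (unitVec m))) :=
    ((ContinuousLinearMap.apply ℂ (SeqL2 X) (unitVec m)).continuous.tendsto S).comp h
  exact ((lp.evalCLM ℂ (fun _ : X => ℂ) 2 l).continuous.tendsto _).comp h1

end Entry

section DecayNorm

variable {X ι : Type*} (κ : X → ι → ℤ) (W : (ι → ℤ) → ℝ≥0∞)

/-- The supremum of the entries of an operator along the `k`-th block diagonal. -/
def diagSup (T : SeqL2 X →L[ℂ] SeqL2 X) (k : ι → ℤ) : ℝ≥0∞ :=
  ⨆ (l : X) (m : X) (_ : κ l - κ m = k), ‖entry T l m‖ₑ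

/-- The weighted norm of convolution-dominated matrices. -/
def decayNorm (T : SeqL2 X →L[ℂ] SeqL2 X) : ℝ≥0∞ :=
  ∑' k, diagSup κ T k * W k

variable {κ W}

lemma enorm_entry_le_diagSup (T : SeqL2 X →L[ℂ] SeqL2 X) (l m : X) :
    ‖entry T l m‖ₑ ≤ diagSup κ T (κ l - κ m) :=
  le_iSup_of_le l (le_iSup_of_le m (le_iSup_of_le rfl le_rfl))

lemma diagSup_le {T : SeqL2 X →L[ℂ] SeqL2 X} {α : (ι → ℤ) → ℝ≥0∞}
    (h : ∀ l m, ‖entry T l m‖ₑ ≤ α (κ l - κ m)) (k : ι → ℤ) : diagSup κ T k ≤ α k :=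
  iSup_le fun l => iSup_le fun m => iSup_le fun hk => hk ▸ h l m

lemma tsum_comp_le {M : ℕ} (hM : ∀ k, (κ ⁻¹' {k}).encard ≤ M) (f : (ι → ℤ) → ℝ≥0∞) :
    ∑' x, f (κ x) ≤ M * ∑' k, f k := by
  rw [← ENNReal.tsum_fiberwise _ κ, ← ENNReal.tsum_mul_left]
  refine ENNReal.tsum_le_tsum fun k => ?_
  have : ∀ b : κ ⁻¹' {k}, f (κ b) = f k := fun b => by rw [b.2]
  simp_rw [this]
  rw [ENNReal.tsum_set_const]
  gcongr
  exact_mod_cast hM k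

lemma tsum_sub_comp_le {M : ℕ} (hM : ∀ k, (κ ⁻¹' {k}).encard ≤ M) (f : (ι → ℤ) → ℝ≥0∞)
    (c : ι → ℤ) : ∑' x, f (c - κ x) ≤ M * ∑' k, f k :=
  (tsum_comp_le hM fun k => f (c - k)).trans_eq
    (congrArg _ ((Equiv.subLeft c).tsum_eq f))

lemma tsum_comp_sub_le {M : ℕ} (hM : ∀ k, (κ ⁻¹' {k}).encard ≤ M) (f : (ι → ℤ) → ℝ≥0∞)
    (c : ι → ℤ) : ∑' x, f (κ x - c) ≤ M * ∑' k, f k :=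
  (tsum_comp_le hM fun k => f (k - c)).trans_eq
    (congrArg _ ((Equiv.subRight c).tsum_eq f))

lemma enorm_apply_le_of_diag {M : ℕ} (hM : ∀ k, (κ ⁻¹' {k}).encard ≤ M)
    (D : SeqL2 X →L[ℂ] SeqL2 X) (β : (ι → ℤ) → ℝ≥0∞)
    (hD : ∀ x y, ‖entry D x y‖ₑ ≤ β (κ x - κ y)) (g : SeqL2 X) :
    ‖D g‖ₑ ≤ (M * ∑' k, β k) * ‖g‖ₑ :=
  enorm_apply_le_of_schur D (fun x y => β (κ x - κ y)) _ hD
    (fun x => tsum_sub_comp_le hM β (κ x)) (fun y => tsum_comp_sub_le hM β (κ y)) g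

lemma decayNorm_add_le (S T : SeqL2 X →L[ℂ] SeqL2 X) :
    decayNorm κ W (S + T) ≤ decayNorm κ W S + decayNorm κ W T := by
  simp only [decayNorm, ← ENNReal.tsum_add, ← add_mul]
  refine ENNReal.tsum_le_tsum fun k => ?_
  gcongr
  refine diagSup_le (α := fun k => diagSup κ S k + diagSup κ T k) (fun l m => ?_) k
  rw [entry_add]
  exact (enorm_add_le _ _).trans
    (add_le_add (enorm_entry_le_diagSup _ _ _) (enorm_entry_le_diagSup _ _ _))

lemma decayNorm_smul_le (c : ℂ) (T : SeqL2 X →L[ℂ] SeqL2 X) :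
    decayNorm κ W (c • T) ≤ ‖c‖ₑ * decayNorm κ W T := by
  simp only [decayNorm, ← ENNReal.tsum_mul_left, ← mul_assoc]
  refine ENNReal.tsum_le_tsum fun k => ?_
  gcongr
  refine diagSup_le (α := fun k => ‖c‖ₑ * diagSup κ T k) (fun l m => ?_) k
  rw [entry_smul, enorm_mul]
  gcongr
  exact enorm_entry_le_diagSup _ _ _

lemma decayNorm_one_le [DecidableEq (ι → ℤ)] :
    decayNorm κ W (1 : SeqL2 X →L[ℂ] SeqL2 X) ≤ W 0 := by
  have h : ∀ k, diagSup κ (1 : SeqL2 X →L[ℂ] SeqL2 X) k * W k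
      ≤ if k = 0 then W 0 else 0 := by
    intro k
    refine (mul_le_mul_left (diagSup_le (κ := κ) (α := fun k => if k = 0 then 1 else 0)
      (fun l m => ?_) k) _).trans ?_
    · rcases eq_or_ne l m with rfl | h
      · simpa using enorm_entry_one_le l l
      · have : entry (1 : SeqL2 X →L[ℂ] SeqL2 X) l m = 0 := unitVec_apply_of_ne h
        simp [this]
    · split_ifs with hk <;> simp [hk]
  refine (ENNReal.tsum_le_tsum h).trans ?_
  rw [tsum_ite_eq]

lemma decayNorm_mul_le {M : ℕ} (hM : ∀ k, (κ ⁻¹' {k}).encard ≤ M)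
    (hW : ∀ i j, W (i + j) ≤ W i * W j) (S T : SeqL2 X →L[ℂ] SeqL2 X) :
    decayNorm κ W (S * T) ≤ M * (decayNorm κ W S * decayNorm κ W T) := by
  have h : ∀ k, diagSup κ (S * T) k ≤ M * ∑' i, diagSup κ S (k - i) * diagSup κ T i := by
    refine diagSup_le fun l m => ?_
    rw [← (entry_mul S T l m).tsum_eq]
    refine enorm_tsum_le_tsum_enorm.trans ?_
    calc ∑' j, ‖entry S l j * entry T j m‖ₑ
        ≤ ∑' j, (fun i => diagSup κ S (κ l - κ m - i) * diagSup κ T i) (κ j - κ m) := by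
          refine ENNReal.tsum_le_tsum fun j => ?_
          rw [enorm_mul]
          simp only [sub_sub_sub_cancel_right]
          exact mul_le_mul' (enorm_entry_le_diagSup _ _ _) (enorm_entry_le_diagSup _ _ _)
      _ ≤ _ := tsum_comp_sub_le hM _ _
  calc decayNorm κ W (S * T)
      ≤ ∑' k, M * ∑' i, (diagSup κ S (k - i) * W (k - i)) * (diagSup κ T i * W i) := by
        refine ENNReal.tsum_le_tsum fun k => (mul_le_mul_left (h k) _).trans ?_
        rw [mul_assoc, ← ENNReal.tsum_mul_right]
        refine mul_le_mul_right (ENNReal.tsum_le_tsum fun i => ?_) _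
        calc diagSup κ S (k - i) * diagSup κ T i * W k
            = diagSup κ S (k - i) * diagSup κ T i * W (k - i + i) := by rw [sub_add_cancel]
          _ ≤ diagSup κ S (k - i) * diagSup κ T i * (W (k - i) * W i) := by
            gcongr; exact hW _ _
          _ = _ := by ring
    _ = M * ∑' i, ∑' k, (diagSup κ S (k - i) * W (k - i)) * (diagSup κ T i * W i) := by
        rw [ENNReal.tsum_mul_left, ENNReal.tsum_comm]
    _ = _ := by
        congr 1
        simp_rw [ENNReal.tsum_mul_right]
        have : ∀ i, ∑' k, diagSup κ S (k - i) * W (k - i) = decayNorm κ W S := fun i =>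
          (Equiv.subRight i).tsum_eq fun k => diagSup κ S k * W k
        simp_rw [this]
        rw [ENNReal.tsum_mul_left]
        rfl

lemma decayNorm_le_of_tendsto (hW : ∀ k, W k ≠ ⊤) {T : ℕ → SeqL2 X →L[ℂ] SeqL2 X}
    {S : SeqL2 X →L[ℂ] SeqL2 X} (h : Tendsto T atTop (nhds S)) {C : ℝ≥0∞}
    (hC : ∀ n, decayNorm κ W (T n) ≤ C) : decayNorm κ W S ≤ C := by
  calc decayNorm κ W S
      ≤ ∑' k, liminf (fun n => diagSup κ (T n) k * W k) atTop := by
        refine ENNReal.tsum_le_tsum fun k => ?_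
        simp only [diagSup, ENNReal.iSup_mul]
        refine iSup_le fun l => iSup_le fun m => iSup_le fun hk => ?_
        have h1 : Tendsto (fun n => ‖entry (T n) l m‖ₑ * W k) atTop
            (nhds (‖entry S l m‖ₑ * W k)) :=
          ENNReal.Tendsto.mul_const ((tendsto_entry h l m).enorm) (Or.inr (hW k))
        rw [← h1.liminf_eq]
        refine liminf_le_liminf (Eventually.of_forall fun n => ?_)
        exact le_iSup_of_le l (le_iSup_of_le m (le_iSup_of_le hk le_rfl))
    _ ≤ liminf (fun n => decayNorm κ W (T n)) atTop := ENNReal.tsum_liminf_le _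
    _ ≤ C := by
        refine (liminf_le_liminf (Eventually.of_forall hC)).trans ?_
        simp

end DecayNorm

lemma exists_regular_weight {E : Type*} [SeminormedAddCommGroup E] {W : E → ℝ≥0∞}
    (hW : ∀ i j, W (i + j) ≤ W i * W j) {a : ℝ} (ha : 0 ≤ a) {C : ℝ≥0∞} (hC : C ≠ ⊤)
    (hWC : ∀ k, W k ≤ C * ENNReal.ofReal (Real.exp (a * ‖k‖))) :
    ∃ V : E → ℝ≥0∞, (∀ j, W j ≤ V j) ∧ V 0 ≠ ⊤ ∧ (∀ j k, V (j + k) ≤ V j * W k) ∧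
      ∀ j k, V (j + k) ≤ V j * ENNReal.ofReal (Real.exp (a * ‖k‖)) := by
  refine ⟨fun j => ⨆ i, W i * ENNReal.ofReal (Real.exp (-(a * ‖i - j‖))), fun j => ?_, ?_,
    fun j k => ?_, fun j k => ?_⟩
  · refine le_iSup_of_le j ?_
    simp
  · refine ne_top_of_le_ne_top hC (iSup_le fun i => ?_)
    refine (mul_le_mul_left (hWC i) _).trans ?_
    rw [mul_assoc, ← ENNReal.ofReal_mul (Real.exp_nonneg _), ← Real.exp_add]
    simp
  · rw [ENNReal.iSup_mul]
    refine iSup_le fun i => le_iSup_of_le (i - k) ?_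
    calc W i * ENNReal.ofReal (Real.exp (-(a * ‖i - (j + k)‖)))
        ≤ W (i - k) * W k * ENNReal.ofReal (Real.exp (-(a * ‖i - (j + k)‖))) := by
          gcongr
          simpa using hW (i - k) k
      _ = _ := by
          rw [show i - (j + k) = i - k - j by abel]
          ring
  · rw [ENNReal.iSup_mul]
    refine iSup_le fun i => le_iSup_of_le i ?_
    rw [mul_assoc, ← ENNReal.ofReal_mul (Real.exp_nonneg _), ← Real.exp_add]
    gcongr
    have h : ‖i - j‖ ≤ ‖i - (j + k)‖ + ‖k‖ := by
      have := norm_add_le (i - (j + k)) k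
      rwa [show i - (j + k) + k = i - j by abel] at this
    nlinarith

lemma ENNReal.tendsto_tsum_mul_zero {α : Type*} {f : α → ℝ≥0∞} (hf : ∑' a, f a ≠ ⊤)
    {g : ℕ → α → ℝ≥0∞} (hg : ∀ n a, g n a ≤ 1)
    (hlim : ∀ a, Tendsto (fun n => g n a) atTop (nhds 0)) :
    Tendsto (fun n => ∑' a, f a * g n a) atTop (nhds 0) := by
  let : MeasurableSpace α := ⊤
  have h := tendsto_lintegral_of_dominated_convergence (μ := Measure.count)
    (F := fun n a => f a * g n a) (f := fun _ => 0) f (fun n => measurable_from_top)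
    (fun n => Eventually.of_forall fun a => mul_le_of_le_one_right' (hg n a))
    (by simpa only [lintegral_count] using hf)
    (Eventually.of_forall fun a => by
      simpa using ENNReal.Tendsto.const_mul (hlim a)
        (Or.inr (ENNReal.ne_top_of_tsum_ne_top hf a)))
  simpa only [lintegral_count, tsum_zero] using h

section Lattice

variable {ι : Type*} [Fintype ι]

/-- A Lipschitz cutoff function at scale `R`. -/
def cutoff (R : ℕ) (z : ι → ℤ) : ℝ := max 0 (min 1 (2 - ‖z‖ / R))

lemma abs_cutoff_le (R : ℕ) (z : ι → ℤ) : |cutoff R z| ≤ 1 := by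
  rw [cutoff, abs_of_nonneg (le_max_left _ _)]
  exact max_le zero_le_one (min_le_left _ _)

lemma cutoff_eq_one {R : ℕ} (hR : 0 < R) {z : ι → ℤ} (hz : ‖z‖ ≤ R) : cutoff R z = 1 := by
  have hR' : (0 : ℝ) < R := by exact_mod_cast hR
  have : ‖z‖ / R ≤ 1 := (div_le_one hR').2 hz
  rw [cutoff, min_eq_left (by linarith), max_eq_right zero_le_one]

lemma cutoff_eq_zero {R : ℕ} (hR : 0 < R) {z : ι → ℤ} (hz : 2 * R ≤ ‖z‖) : cutoff R z = 0 := by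
  have hR' : (0 : ℝ) < R := by exact_mod_cast hR
  have : 2 ≤ ‖z‖ / R := (le_div_iff₀ hR').2 hz
  rw [cutoff, max_eq_left]
  exact (min_le_right _ _).trans (by linarith)

lemma abs_cutoff_sub_le (R : ℕ) (z w : ι → ℤ) :
    |cutoff R z - cutoff R w| ≤ min 1 (‖z - w‖ / R) := by
  refine le_min ?_ ?_
  · have h1 := abs_cutoff_le R z
    have h2 := abs_cutoff_le R w
    have h3 : 0 ≤ cutoff R z := le_max_left _ _
    have h4 : 0 ≤ cutoff R w := le_max_left _ _
    rw [abs_le] at *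
    constructor <;> linarith
  · calc |cutoff R z - cutoff R w|
        ≤ |min 1 (2 - ‖z‖ / R) - min 1 (2 - ‖w‖ / R)| := by
          refine (abs_max_sub_max_le_max 0 (min 1 (2 - ‖z‖ / R)) 0 (min 1 (2 - ‖w‖ / R))).trans
            (max_le ?_ le_rfl)
          rw [sub_self, abs_zero]
          exact abs_nonneg _
      _ ≤ |(2 - ‖z‖ / R) - (2 - ‖w‖ / R)| := by
          refine (abs_min_sub_min_le_max 1 (2 - ‖z‖ / R) 1 (2 - ‖w‖ / R)).trans
            (max_le ?_ le_rfl)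
          rw [sub_self, abs_zero]
          exact abs_nonneg _
      _ = |‖w‖ - ‖z‖| / R := by
          rw [show (2 - ‖z‖ / R) - (2 - ‖w‖ / R) = (‖w‖ - ‖z‖) / R by ring, abs_div,
            Nat.abs_cast]
      _ ≤ ‖z - w‖ / R := by
          gcongr
          rw [abs_sub_comm]
          exact abs_norm_sub_norm_le z w

/-- The index of the cube of side length `R` containing a lattice point. -/
def coarse (R : ℕ) (k : ι → ℤ) : ι → ℤ := fun i => k i / R

lemma norm_sub_coarse_le {R : ℕ} (hR : 0 < R) (k : ι → ℤ) :
    ‖k - (R : ℤ) • coarse R k‖ ≤ R := by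
  have hR' : (0 : ℤ) < R := by exact_mod_cast hR
  refine (pi_norm_le_iff_of_nonneg (Nat.cast_nonneg R)).2 fun i => ?_
  have h : (k - (R : ℤ) • coarse R k) i = k i % R := by
    simp only [Pi.sub_apply, Pi.smul_apply, coarse, smul_eq_mul, Int.emod_def]
  rw [h, Int.norm_eq_abs, abs_of_nonneg (by exact_mod_cast Int.emod_nonneg _ hR'.ne')]
  exact_mod_cast (Int.emod_lt_of_pos (k i) hR').le

lemma mem_Icc_of_norm_le {n : ℕ} {k : ι → ℤ} (hk : ‖k‖ ≤ n) :
    k ∈ Set.Icc (fun _ => -(n : ℤ)) (fun _ : ι => (n : ℤ)) := by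
  have h : ∀ i, |k i| ≤ n := fun i => by
    have := (norm_le_pi_norm k i).trans hk
    rw [Int.norm_eq_abs] at this
    exact_mod_cast this
  exact ⟨fun i => (abs_le.1 (h i)).1, fun i => (abs_le.1 (h i)).2⟩

lemma norm_natCast_smul (R : ℕ) (J : ι → ℤ) : ‖(R : ℤ) • J‖ = R * ‖J‖ := by
  rw [norm_smul, Int.norm_natCast]

open Classical in
lemma exists_tsum_norm_le (n : ℕ) :
    ∃ B : ℝ≥0∞, B ≠ ⊤ ∧
      ∀ c : ι → ℤ, ∑' k : ι → ℤ, (if ‖k - c‖ ≤ n then (1 : ℝ≥0∞) else 0) ≤ B := by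
  refine ⟨((Set.Icc (fun _ => -(n : ℤ)) (fun _ : ι => (n : ℤ))).encard : ℝ≥0∞), ?_, fun c => ?_⟩
  · have := (Set.finite_Icc (fun _ => -(n : ℤ)) (fun _ : ι => (n : ℤ)))
    rw [this.encard_eq_coe_toFinset_card]
    simp
  · refine (le_of_eq ((Equiv.subRight c).tsum_eq
      fun k : ι → ℤ => if ‖k‖ ≤ n then (1 : ℝ≥0∞) else 0)).trans ?_
    calc ∑' k : ι → ℤ, (if ‖k‖ ≤ n then (1 : ℝ≥0∞) else 0)
        ≤ ∑' k, (Set.Icc (fun _ => -(n : ℤ)) (fun _ : ι => (n : ℤ))).indicator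
            (fun _ => (1 : ℝ≥0∞)) k := by
          refine ENNReal.tsum_le_tsum fun k => ?_
          split_ifs with hk
          · rw [Set.indicator_of_mem (mem_Icc_of_norm_le hk)]
          · exact zero_le
      _ = _ := by
          rw [← tsum_subtype, ENNReal.tsum_set_const, mul_one]

open Classical in
lemma exists_tsum_smul_norm_le :
    ∃ B : ℝ≥0∞, B ≠ ⊤ ∧ ∀ (R : ℕ) (_ : 0 < R) (c : ι → ℤ),
      ∑' J : ι → ℤ, (if ‖(R : ℤ) • J - c‖ ≤ 3 * R then (1 : ℝ≥0∞) else 0) ≤ B := by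
  obtain ⟨B, hB, h⟩ := exists_tsum_norm_le (ι := ι) 6
  refine ⟨B, hB, fun R hR c => ?_⟩
  have hR' : (0 : ℝ) < R := by exact_mod_cast hR
  by_cases hJ : ∃ J₀ : ι → ℤ, ‖(R : ℤ) • J₀ - c‖ ≤ 3 * R
  · obtain ⟨J₀, hJ₀⟩ := hJ
    refine (ENNReal.tsum_le_tsum fun J => ?_).trans (h J₀)
    by_cases hJ : ‖(R : ℤ) • J - c‖ ≤ 3 * R
    · have h1 : R * ‖J - J₀‖ ≤ R * 6 := by
        rw [← norm_natCast_smul, smul_sub]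
        have := norm_sub_le ((R : ℤ) • J - c) ((R : ℤ) • J₀ - c)
        rw [sub_sub_sub_cancel_right] at this
        linarith
      have h2 : ‖J - J₀‖ ≤ (6 : ℕ) := by exact_mod_cast le_of_mul_le_mul_left h1 hR'
      rw [if_pos hJ, if_pos h2]
    · rw [if_neg hJ]
      exact zero_le
  · push Not at hJ
    rw [tsum_congr fun J => if_neg (not_le.2 (hJ J)), tsum_zero]
    exact zero_le

end Lattice

section Growth

variable {X ι : Type*}

lemma mulOp_unitVec (f : X → ℝ) (hf : ∀ x, |f x| ≤ 1) (m : X) :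
    mulOp f hf (unitVec m) = (f m : ℂ) • unitVec m := by
  ext x
  rw [mulOp_apply, lp.coeFn_smul, Pi.smul_apply, smul_eq_mul]
  rcases eq_or_ne x m with rfl | h
  · rfl
  · rw [unitVec_apply_of_ne h, mul_zero, mul_zero]

lemma enorm_mulOp_le (f : X → ℝ) (hf : ∀ x, |f x| ≤ 1) (g : SeqL2 X) :
    ‖mulOp f hf g‖ₑ ≤ ‖g‖ₑ := by
  refine enorm_le_enorm_of_forall _ _ fun x => ?_
  rw [mulOp_apply, enorm_mul]
  refine mul_le_of_le_one_left' ?_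
  rw [← ofReal_norm, Complex.norm_real]
  exact ENNReal.ofReal_le_one.2 (hf x)

open Classical in
/-- The restriction of a sequence to a fiber of a map. -/
def fiberOp {Y : Type*} (c : X → Y) (L : Y) : SeqL2 X →L[ℂ] SeqL2 X :=
  mulOp (fun x => if c x = L then 1 else 0) fun x => by split_ifs <;> simp

lemma fiberOp_apply_of_eq {Y : Type*} {c : X → Y} {L : Y} {x : X} (h : c x = L) (g : SeqL2 X) :
    (fiberOp c L g : X → ℂ) x = (g : X → ℂ) x := by
  rw [fiberOp, mulOp_apply, if_pos h, Complex.ofReal_one, one_mul]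

lemma fiberOp_apply_of_ne {Y : Type*} {c : X → Y} {L : Y} {x : X} (h : c x ≠ L) (g : SeqL2 X) :
    (fiberOp c L g : X → ℂ) x = 0 := by
  rw [fiberOp, mulOp_apply, if_neg h, Complex.ofReal_zero, zero_mul]

lemma fiberOp_fiberOp {Y : Type*} (c : X → Y) (L : Y) (g : SeqL2 X) :
    fiberOp c L (fiberOp c L g) = fiberOp c L g := by
  ext x
  by_cases h : c x = L
  · rw [fiberOp_apply_of_eq h]
  · rw [fiberOp_apply_of_ne h, fiberOp_apply_of_ne h]

lemma hasSum_fiberOp {Y : Type*} (c : X → Y) (g : SeqL2 X) :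
    HasSum (fun L => fiberOp c L g) g := by
  have h := (Equiv.sigmaFiberEquiv c).hasSum_iff.2 (hasSum_smul_unitVec g)
  refine h.sigma fun L => ?_
  have h2 := hasSum_smul_unitVec (fiberOp c L g)
  have h3 : (fun y => (fiberOp c L g : X → ℂ) y • unitVec y)
      = Set.indicator {y | c y = L} (fun y => (g : X → ℂ) y • unitVec y) := by
    funext y
    by_cases hy : c y = L
    · rw [fiberOp_apply_of_eq hy, Set.indicator_of_mem (by exact hy)]
    · rw [fiberOp_apply_of_ne hy, zero_smul, Set.indicator_of_notMem (by exact hy)]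
  rw [h3, ← hasSum_subtype_iff_indicator] at h2
  exact h2

variable [Fintype ι]

/-- Multiplication by a cutoff function centered at `R • I`. -/
def cutoffOp (κ : X → ι → ℤ) (R : ℕ) (I : ι → ℤ) : SeqL2 X →L[ℂ] SeqL2 X :=
  mulOp (fun x => cutoff R (κ x - (R : ℤ) • I)) fun _ => abs_cutoff_le _ _

lemma enorm_fiberOp_le (κ : X → ι → ℤ) {R : ℕ} (hR : 0 < R) (L : ι → ℤ) (g : SeqL2 X) :
    ‖fiberOp (fun x => coarse R (κ x)) L g‖ₑ ≤ ‖cutoffOp κ R L g‖ₑ := by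
  refine enorm_le_enorm_of_forall _ _ fun x => ?_
  by_cases h : coarse R (κ x) = L
  · rw [fiberOp_apply_of_eq (c := fun x => coarse R (κ x)) h, cutoffOp, mulOp_apply, cutoff_eq_one hR,
      Complex.ofReal_one, one_mul]
    rw [← h]
    exact norm_sub_coarse_le hR _
  · rw [fiberOp_apply_of_ne (c := fun x => coarse R (κ x)) h]
    simp

open Classical in
/-- A bound for the diagonals of the commutator of an operator with a cutoff function,
localized at distance `R • J`. -/
def commBound (κ : X → ι → ℤ) (R : ℕ) (T : SeqL2 X →L[ℂ] SeqL2 X) (J k : ι → ℤ) : ℝ≥0∞ :=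
  if ‖(R : ℤ) • J‖ ≤ 3 * R ∨ ‖(R : ℤ) • J - k‖ ≤ 3 * R then
    diagSup κ T k * ENNReal.ofReal (min 1 (‖k‖ / R)) else 0

lemma entry_comm (f : X → ℝ) (hf : ∀ x, |f x| ≤ 1) (T S : SeqL2 X →L[ℂ] SeqL2 X) (y : X) (s : ℂ)
    (hS : S (unitVec y) = s • unitVec y) (x : X) :
    entry ((mulOp f hf * T - T * mulOp f hf) * S) x y = s * ((f x - f y : ℝ) * entry T x y) := by
  have : ((mulOp f hf * T - T * mulOp f hf) * S) (unitVec y)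
      = s • (mulOp f hf (T (unitVec y)) - (f y : ℂ) • T (unitVec y)) := by
    change mulOp f hf (T (S (unitVec y))) - T (mulOp f hf (S (unitVec y))) = _
    rw [hS]
    simp only [map_smul, mulOp_unitVec, smul_sub]
  rw [entry, this]
  simp only [lp.coeFn_smul, lp.coeFn_sub, Pi.smul_apply, Pi.sub_apply, mulOp_apply, smul_eq_mul,
    entry]
  push_cast
  ring

lemma enorm_entry_comm_le (κ : X → ι → ℤ) {R : ℕ} (hR : 0 < R) (T : SeqL2 X →L[ℂ] SeqL2 X)
    (I L : ι → ℤ) (x y : X) :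
    ‖entry ((cutoffOp κ R I * T - T * cutoffOp κ R I) *
      fiberOp (fun x => coarse R (κ x)) L) x y‖ₑ ≤ commBound κ R T (I - L) (κ x - κ y) := by
  rw [cutoffOp, fiberOp, entry_comm _ _ _ _ _ _ (mulOp_unitVec _ _ y)]
  by_cases hy : coarse R (κ y) = L
  swap
  · rw [if_neg hy]
    simp
  rw [if_pos hy, Complex.ofReal_one, one_mul]
  have hyL : ‖κ y - (R : ℤ) • L‖ ≤ R := by
    rw [← hy]
    exact norm_sub_coarse_le hR _
  by_cases hc : ‖(R : ℤ) • (I - L)‖ ≤ 3 * R ∨ ‖(R : ℤ) • (I - L) - (κ x - κ y)‖ ≤ 3 * R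
  · rw [commBound, if_pos hc, enorm_mul, mul_comm]
    refine mul_le_mul' (enorm_entry_le_diagSup _ _ _) ?_
    rw [← ofReal_norm, Complex.norm_real]
    refine ENNReal.ofReal_le_ofReal ((abs_cutoff_sub_le _ _ _).trans_eq ?_)
    rw [sub_sub_sub_cancel_right]
  · push Not at hc
    have h1 : cutoff R (κ y - (R : ℤ) • I) = 0 := by
      refine cutoff_eq_zero hR ?_
      by_contra! h
      have := norm_sub_le (κ y - (R : ℤ) • L) (κ y - (R : ℤ) • I)
      rw [show κ y - (R : ℤ) • L - (κ y - (R : ℤ) • I) = (R : ℤ) • (I - L) by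
        rw [smul_sub]; abel] at this
      linarith [hc.1]
    have h2 : cutoff R (κ x - (R : ℤ) • I) = 0 := by
      refine cutoff_eq_zero hR ?_
      by_contra! h
      have := norm_sub_le (κ y - (R : ℤ) • L) (κ x - (R : ℤ) • I)
      rw [show κ y - (R : ℤ) • L - (κ x - (R : ℤ) • I) = (R : ℤ) • (I - L) - (κ x - κ y) by
        rw [smul_sub]; abel] at this
      linarith [hc.2]
    rw [h1, h2]
    simp

lemma enorm_cutoffOp_apply_le {κ : X → ι → ℤ} {M : ℕ} (hM : ∀ k, (κ ⁻¹' {k}).encard ≤ M)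
    {R : ℕ} (hR : 0 < R) (T : SeqL2 X →L[ℂ] SeqL2 X) (I : ι → ℤ) (g : SeqL2 X) :
    ‖cutoffOp κ R I (T g)‖ₑ ≤ ‖T‖ₑ * ‖cutoffOp κ R I g‖ₑ
      + ∑' L, (M * ∑' k, commBound κ R T (I - L) k) * ‖cutoffOp κ R L g‖ₑ := by
  set Q := cutoffOp κ R I * T - T * cutoffOp κ R I with hQ
  have h1 : cutoffOp κ R I (T g) = T (cutoffOp κ R I g) + Q g := by
    change _ = _ + (cutoffOp κ R I (T g) - T (cutoffOp κ R I g))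
    abel
  rw [h1]
  refine (enorm_add_le _ _).trans (add_le_add (T.le_opENorm _) ?_)
  rw [← (Q.hasSum (hasSum_fiberOp (fun x => coarse R (κ x)) g)).tsum_eq]
  refine enorm_tsum_le_tsum_enorm.trans (ENNReal.tsum_le_tsum fun L => ?_)
  rw [← fiberOp_fiberOp]
  refine (enorm_apply_le_of_diag hM (Q * fiberOp (fun x => coarse R (κ x)) L) _
    (enorm_entry_comm_le κ hR T I L) _).trans ?_
  gcongr
  exact enorm_fiberOp_le κ hR L g

lemma tsum_commBound_mul_le {κ : X → ι → ℤ} {W V : (ι → ℤ) → ℝ≥0∞} (hW1 : ∀ k, 1 ≤ W k) {R : ℕ}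
    {a : ℝ} (ha : 0 ≤ a) (haR : a * (3 * R) ≤ 1)
    (hVW : ∀ j k, V (j + k) ≤ V j * W k)
    (hVe : ∀ j k, V (j + k) ≤ V j * ENNReal.ofReal (Real.exp (a * ‖k‖)))
    {B : ℝ≥0∞} (hB : ∀ c : ι → ℤ, open Classical in
      ∑' J : ι → ℤ, (if ‖(R : ℤ) • J - c‖ ≤ 3 * R then (1 : ℝ≥0∞) else 0) ≤ B)
    (T : SeqL2 X →L[ℂ] SeqL2 X) (p : ι → ℤ) :
    ∑' J, (∑' k, commBound κ R T J k) * V (p + (R : ℤ) • J) ≤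
      V p * (2 * B * ENNReal.ofReal (Real.exp 1) *
        ∑' k, diagSup κ T k * W k * ENNReal.ofReal (min 1 (‖k‖ / R))) := by
  classical
  have hexp : ∀ {k : ι → ℤ}, ‖k‖ ≤ 3 * R →
      ENNReal.ofReal (Real.exp (a * ‖k‖)) ≤ ENNReal.ofReal (Real.exp 1) := fun hk => by
    gcongr
    exact (mul_le_mul_of_nonneg_left hk ha).trans haR
  have h : ∀ J k, commBound κ R T J k * V (p + (R : ℤ) • J) ≤
      ((if ‖(R : ℤ) • J - 0‖ ≤ 3 * R then (1 : ℝ≥0∞) else 0) +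
        (if ‖(R : ℤ) • J - k‖ ≤ 3 * R then (1 : ℝ≥0∞) else 0)) *
      (V p * ENNReal.ofReal (Real.exp 1) *
        (diagSup κ T k * W k * ENNReal.ofReal (min 1 (‖k‖ / R)))) := by
    intro J k
    have key : ‖(R : ℤ) • J‖ ≤ 3 * R ∨ ‖(R : ℤ) • J - k‖ ≤ 3 * R →
        V (p + (R : ℤ) • J) ≤ V p * W k * ENNReal.ofReal (Real.exp 1) := by
      rintro (hJ | hJ)
      · refine (hVe _ _).trans (mul_le_mul' ?_ (hexp hJ))
        exact le_mul_of_one_le_right' (hW1 k)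
      · have := hVe (p + k) ((R : ℤ) • J - k)
        rw [add_add_sub_cancel] at this
        exact this.trans (mul_le_mul' (hVW _ _) (hexp hJ))
    by_cases hc : ‖(R : ℤ) • J‖ ≤ 3 * R ∨ ‖(R : ℤ) • J - k‖ ≤ 3 * R
    · have hone : (1 : ℝ≥0∞) ≤ (if ‖(R : ℤ) • J - 0‖ ≤ 3 * R then (1 : ℝ≥0∞) else 0) +
          (if ‖(R : ℤ) • J - k‖ ≤ 3 * R then (1 : ℝ≥0∞) else 0) := by
        rw [sub_zero]
        rcases hc with hc | hc
        · rw [if_pos hc]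
          exact le_self_add
        · rw [if_pos hc]
          exact le_add_self
      rw [commBound, if_pos hc]
      refine (mul_le_mul_right (key hc) _).trans (le_trans (le_of_eq ?_) (le_mul_of_one_le_left' hone))
      ring
    · rw [commBound, if_neg hc, zero_mul]
      exact zero_le
  calc ∑' J, (∑' k, commBound κ R T J k) * V (p + (R : ℤ) • J)
      = ∑' k, ∑' J, commBound κ R T J k * V (p + (R : ℤ) • J) := by
        simp_rw [← ENNReal.tsum_mul_right]
        exact ENNReal.tsum_comm
    _ ≤ ∑' k, (B + B) * (V p * ENNReal.ofReal (Real.exp 1) *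
        (diagSup κ T k * W k * ENNReal.ofReal (min 1 (‖k‖ / R)))) := by
        refine ENNReal.tsum_le_tsum fun k => (ENNReal.tsum_le_tsum fun J => h J k).trans ?_
        rw [ENNReal.tsum_mul_right, ENNReal.tsum_add]
        gcongr
        · exact hB 0
        · exact hB k
    _ = _ := by
        rw [ENNReal.tsum_mul_left, ENNReal.tsum_mul_left]
        ring

end Growth

section Growth

variable {X ι : Type*} [Fintype ι]

/-- The size of the columns of the powers of an operator on a cube at relative position `R • K`. -/
def columnSup (κ : X → ι → ℤ) (R : ℕ) (T : SeqL2 X →L[ℂ] SeqL2 X) (n : ℕ) (K : ι → ℤ) : ℝ≥0∞ :=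
  ⨆ m, ‖cutoffOp κ R (coarse R (κ m) + K) ((T ^ n) (unitVec m))‖ₑ

lemma columnSup_succ_le {κ : X → ι → ℤ} {M : ℕ} (hM : ∀ k, (κ ⁻¹' {k}).encard ≤ M)
    {R : ℕ} (hR : 0 < R) (T : SeqL2 X →L[ℂ] SeqL2 X) (n : ℕ) (K : ι → ℤ) :
    columnSup κ R T (n + 1) K ≤ ‖T‖ₑ * columnSup κ R T n K
      + ∑' L, (M * ∑' k, commBound κ R T (K - L) k) * columnSup κ R T n L := by
  refine iSup_le fun m => ?_
  rw [pow_succ']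
  refine (enorm_cutoffOp_apply_le hM hR T _ _).trans (add_le_add ?_ ?_)
  · gcongr
    exact le_iSup (fun m => ‖cutoffOp κ R (coarse R (κ m) + K) ((T ^ n) (unitVec m))‖ₑ) m
  · refine (le_of_eq ((Equiv.addLeft (coarse R (κ m))).tsum_eq fun L =>
      (M * ∑' k, commBound κ R T (coarse R (κ m) + K - L) k) *
        ‖cutoffOp κ R L ((T ^ n) (unitVec m))‖ₑ).symm).trans ?_
    refine ENNReal.tsum_le_tsum fun L => ?_
    simp only [Equiv.coe_addLeft, add_sub_add_left_eq_sub]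
    gcongr
    exact le_iSup (fun m => ‖cutoffOp κ R (coarse R (κ m) + L) ((T ^ n) (unitVec m))‖ₑ) m

open Classical in
lemma columnSup_zero_le (κ : X → ι → ℤ) {R : ℕ} (hR : 0 < R) (T : SeqL2 X →L[ℂ] SeqL2 X)
    (K : ι → ℤ) :
    columnSup κ R T 0 K ≤ if ‖(R : ℤ) • K‖ ≤ 3 * R then 1 else 0 := by
  refine iSup_le fun m => ?_
  rw [pow_zero, one_apply_eq_self]
  split_ifs with h
  · exact (enorm_mulOp_le _ _ _).trans_eq (enorm_unitVec m)
  · rw [cutoffOp, mulOp_unitVec, cutoff_eq_zero hR, Complex.ofReal_zero, zero_smul, enorm_zero]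
    by_contra! h2
    refine h ?_
    have h1 := norm_sub_coarse_le hR (κ m)
    have h3 := norm_sub_le (κ m - (R : ℤ) • coarse R (κ m))
      (κ m - (R : ℤ) • (coarse R (κ m) + K))
    rw [smul_add, sub_sub_sub_cancel_left, add_sub_cancel_left, ← smul_add] at h3
    linarith

open Classical in
lemma enorm_entry_pow_le (κ : X → ι → ℤ) {R : ℕ} (hR : 0 < R) (T : SeqL2 X →L[ℂ] SeqL2 X)
    (n : ℕ) (l m : X) :
    ‖entry (T ^ n) l m‖ₑ ≤ ∑' K : ι → ℤ,
      (if ‖κ l - κ m - (R : ℤ) • K‖ ≤ (2 * R : ℕ) then 1 else 0) * columnSup κ R T n K := by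
  refine le_trans ?_ (ENNReal.le_tsum (coarse R (κ l) - coarse R (κ m)))
  have h1 := norm_sub_coarse_le hR (κ l)
  have h2 := norm_sub_coarse_le hR (κ m)
  rw [if_pos, one_mul]
  · refine le_trans ?_ (le_iSup _ m)
    refine le_trans ?_ (enorm_apply_le _ l)
    rw [add_sub_cancel, cutoffOp, mulOp_apply, cutoff_eq_one hR h1, Complex.ofReal_one, one_mul]
    rfl
  · have h3 := norm_sub_le (κ l - (R : ℤ) • coarse R (κ l)) (κ m - (R : ℤ) • coarse R (κ m))
    rw [show κ l - (R : ℤ) • coarse R (κ l) - (κ m - (R : ℤ) • coarse R (κ m))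
      = κ l - κ m - (R : ℤ) • (coarse R (κ l) - coarse R (κ m)) by rw [smul_sub]; abel] at h3
    push_cast
    linarith

theorem exists_decayNorm_pow_le {κ : X → ι → ℤ} {M : ℕ} (hM : ∀ k, (κ ⁻¹' {k}).encard ≤ M)
    {W : (ι → ℤ) → ℝ≥0∞} (hW1 : ∀ k, 1 ≤ W k) (hW : ∀ i j, W (i + j) ≤ W i * W j)
    (hWexp : ∀ a : ℝ, 0 < a → ∃ C : ℝ≥0∞, C ≠ ⊤ ∧
      ∀ k, W k ≤ C * ENNReal.ofReal (Real.exp (a * ‖k‖)))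
    {T : SeqL2 X →L[ℂ] SeqL2 X} (hT : decayNorm κ W T ≠ ⊤) {r : ℝ} (hr : ‖T‖ < r) :
    ∃ C : ℝ≥0∞, C ≠ ⊤ ∧ ∀ n : ℕ, decayNorm κ W (T ^ n) ≤ C * ENNReal.ofReal r ^ n := by
  classical
  obtain ⟨B, hB, hBR⟩ := exists_tsum_smul_norm_le (ι := ι)
  set e := ENNReal.ofReal (Real.exp 1) with he
  have he' : e ≠ ⊤ := ENNReal.ofReal_ne_top
  set gap := ENNReal.ofReal (r - ‖T‖) with hgap
  have hgap0 : 0 < gap := ENNReal.ofReal_pos.2 (sub_pos.2 hr)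
  have hsum : ‖T‖ₑ + gap = ENNReal.ofReal r := by
    rw [← ofReal_norm, hgap, ← ENNReal.ofReal_add (norm_nonneg _) (sub_pos.2 hr).le]
    congr 1
    ring
  obtain ⟨R, hR, hRgap⟩ : ∃ R : ℕ, 0 < R ∧ M * (2 * B * e) *
      ∑' k, diagSup κ T k * W k * ENNReal.ofReal (min 1 (‖k‖ / R)) ≤ gap := by
    have h1 : Tendsto (fun R : ℕ => ∑' k : ι → ℤ, diagSup κ T k * W k *
        ENNReal.ofReal (min 1 (‖k‖ / R))) atTop (nhds 0) := by
      refine ENNReal.tendsto_tsum_mul_zero hT (fun n k => ?_) fun k => ?_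
      · exact ENNReal.ofReal_le_one.2 (min_le_left _ _)
      · have : Tendsto (fun R : ℕ => min 1 (‖k‖ / R)) atTop (nhds (min 1 0)) :=
          tendsto_const_nhds.min (tendsto_const_div_atTop_nhds_zero_nat _)
        simpa using ENNReal.tendsto_ofReal this
    have h2 := ENNReal.Tendsto.const_mul (a := M * (2 * B * e)) h1 (Or.inr (by finiteness))
    rw [mul_zero] at h2
    obtain ⟨R, h3, h4⟩ := ((h2.eventually_lt_const hgap0).and (eventually_gt_atTop 0)).exists
    exact ⟨R, h4, h3.le⟩
  have hR' : (0 : ℝ) < R := by exact_mod_cast hR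
  set a : ℝ := 1 / (3 * R) with ha
  have ha0 : 0 < a := by positivity
  have haR : a * (3 * R) ≤ 1 := by
    rw [ha]
    field_simp
    exact le_rfl
  obtain ⟨C, hC, hWC⟩ := hWexp a ha0
  obtain ⟨V, hWV, hV0, hVW, hVe⟩ := exists_regular_weight hW ha0.le hC hWC
  have hVe1 : ∀ {j k : ι → ℤ}, ‖k‖ ≤ 3 * R → V (j + k) ≤ V j * e := fun {j k} hk => by
    refine (hVe j k).trans ?_
    rw [he]
    gcongr
    exact (mul_le_mul_of_nonneg_left hk ha0.le).trans haR
  set N : ℕ → ℝ≥0∞ := fun n => ∑' K, columnSup κ R T n K * V ((R : ℤ) • K) with hN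
  have hN0 : N 0 ≤ B * (V 0 * e) := by
    calc N 0 ≤ ∑' K : ι → ℤ, (if ‖(R : ℤ) • K - 0‖ ≤ 3 * R then (1 : ℝ≥0∞) else 0) * (V 0 * e) := by
          refine ENNReal.tsum_le_tsum fun K => ?_
          refine (mul_le_mul_left (columnSup_zero_le κ hR T K) _).trans ?_
          rw [sub_zero]
          split_ifs with h
          · rw [one_mul, one_mul]
            simpa using hVe1 (j := 0) h
          · simp
      _ ≤ _ := by
          rw [ENNReal.tsum_mul_right]
          gcongr
          exact hBR R hR 0
  have hstep : ∀ n, N (n + 1) ≤ ENNReal.ofReal r * N n := by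
    intro n
    calc N (n + 1) ≤ ∑' K, (‖T‖ₑ * columnSup κ R T n K + ∑' L,
          (M * ∑' k, commBound κ R T (K - L) k) * columnSup κ R T n L) * V ((R : ℤ) • K) :=
          ENNReal.tsum_le_tsum fun K => mul_le_mul_left (columnSup_succ_le hM hR T n K) _
      _ = ‖T‖ₑ * N n + ∑' L, columnSup κ R T n L *
          (M * ∑' K, (∑' k, commBound κ R T (K - L) k) * V ((R : ℤ) • K)) := by
          obtain ⟨E, hE⟩ : ∃ E : (ι → ℤ) → ℝ≥0∞, ∀ J, ∑' k, commBound κ R T J k = E J :=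
            ⟨_, fun _ => rfl⟩
          simp_rw [hE, add_mul, ENNReal.tsum_add, hN, ← ENNReal.tsum_mul_left,
            ← ENNReal.tsum_mul_right, mul_assoc]
          congr 1
          rw [ENNReal.tsum_comm]
          exact tsum_congr fun L => tsum_congr fun K => by ring
      _ ≤ ‖T‖ₑ * N n + ∑' L, columnSup κ R T n L * (V ((R : ℤ) • L) * gap) := by
          refine add_le_add le_rfl (ENNReal.tsum_le_tsum fun L => mul_le_mul_right ?_ _)
          have h1 := tsum_commBound_mul_le (V := V) (κ := κ) hW1 ha0.le haR hVW hVe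
            (hBR R hR) T ((R : ℤ) • L)
          have h2 := (Equiv.subRight L).tsum_eq fun J : ι → ℤ =>
            (∑' k, commBound κ R T J k) * V ((R : ℤ) • L + (R : ℤ) • J)
          simp only [Equiv.subRight_apply, ← smul_add, add_sub_cancel] at h2
          simp only [← smul_add] at h1
          rw [← h2] at h1
          refine (mul_le_mul_right h1 _).trans ?_
          refine le_trans (le_of_eq ?_) (mul_le_mul_right hRgap _)
          ring
      _ = _ := by
          rw [← hsum, add_mul]
          congr 1
          simp_rw [← mul_assoc]
          rw [ENNReal.tsum_mul_right, mul_comm]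
  have hNn : ∀ n, N n ≤ N 0 * ENNReal.ofReal r ^ n := by
    intro n
    induction n with
    | zero => simp
    | succ n ih =>
      refine (hstep n).trans ((mul_le_mul_right ih _).trans_eq ?_)
      ring
  obtain ⟨B', hB', hBn⟩ := exists_tsum_norm_le (ι := ι) (2 * R)
  refine ⟨e * B' * N 0, ?_, fun n => ?_⟩
  · have := ne_top_of_le_ne_top (by finiteness) hN0
    finiteness
  calc decayNorm κ W (T ^ n)
      ≤ ∑' k : ι → ℤ, ∑' K : ι → ℤ, (if ‖k - (R : ℤ) • K‖ ≤ (2 * R : ℕ) then 1 else 0) *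
          (columnSup κ R T n K * V ((R : ℤ) • K) * e) := by
        refine ENNReal.tsum_le_tsum fun k => ?_
        refine (mul_le_mul' (diagSup_le (α := fun k => ∑' K : ι → ℤ,
          (if ‖k - (R : ℤ) • K‖ ≤ (2 * R : ℕ) then 1 else 0) * columnSup κ R T n K)
          (enorm_entry_pow_le κ hR T n) k) (hWV k)).trans ?_
        rw [← ENNReal.tsum_mul_right]
        refine ENNReal.tsum_le_tsum fun K => ?_
        split_ifs with h
        · rw [one_mul, one_mul, mul_assoc]
          gcongr
          have := hVe1 (j := (R : ℤ) • K) (k := k - (R : ℤ) • K) (h.trans (by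
            push_cast
            linarith))
          rwa [add_sub_cancel] at this
        · simp
    _ ≤ ∑' K, B' * (columnSup κ R T n K * V ((R : ℤ) • K) * e) := by
        rw [ENNReal.tsum_comm]
        refine ENNReal.tsum_le_tsum fun K => ?_
        rw [ENNReal.tsum_mul_right]
        gcongr
        exact hBn _
    _ = e * B' * N n := by
        rw [ENNReal.tsum_mul_left, ENNReal.tsum_mul_right]
        ring
    _ ≤ _ := by
        rw [mul_assoc _ (N 0)]
        gcongr
        exact hNn n

end Growth

lemma exists_coeff_hasSum_rpow : ∃ b : ℕ → ℝ, Summable (fun j => |b j| * (1 / 2) ^ j) ∧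
    ∀ u : ℝ, |u| < 1 → HasSum (fun j => b j * u ^ j) ((1 + u) ^ (-(1 / 2) : ℝ)) := by
  have hp := Real.one_add_rpow_hasFPowerSeriesOnBall_zero (a := -(1 / 2))
  refine ⟨fun j => Ring.choose (-(1 / 2) : ℝ) j, ?_, fun u hu => ?_⟩
  · have h := (binomialSeries ℝ (-(1 / 2) : ℝ)).summable_norm_mul_pow (r := 1 / 2)
      (lt_of_lt_of_le (by
        rw [← ENNReal.coe_one, ENNReal.coe_lt_coe]
        exact NNReal.half_lt_self one_ne_zero) binomialSeries_radius_ge_one)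
    refine h.of_nonneg_of_le (fun j => by positivity) fun j => ?_
    push_cast
    gcongr
    have := (binomialSeries ℝ (-(1 / 2) : ℝ) j).le_opNorm (fun _ => 1)
    rw [binomialSeries_apply] at this
    simpa using this
  · have h := hp.hasSum (y := u) (by
      rw [← ENNReal.ofReal_one, Metric.eball_ofReal]
      simpa using hu)
    rw [zero_add] at h
    refine h.congr_fun fun j => ?_
    rw [binomialSeries_apply]
    simp

/-- The kernel projection of a self-adjoint element with a spectral gap, as a limit of polynomials
built from a small element. -/
lemma exists_kernel_proj {𝒜 : Type*} [CStarAlgebra 𝒜] {a : 𝒜} (ha : IsSelfAdjoint a) {A B : ℝ}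
    (hA : 0 < A) (hAB : A ≤ B) (hspec : spectrum ℝ a ⊆ {0} ∪ Set.Icc A B) {b : ℕ → ℝ}
    (hbs : Summable (fun j => |b j| * (1 / 2) ^ j))
    (hb : ∀ u : ℝ, |u| < 1 → HasSum (fun j => b j * u ^ j) ((1 + u) ^ (-(1 / 2) : ℝ))) :
    ∃ q c s u : 𝒜, ∃ n : ℕ, IsSelfAdjoint q ∧ a * q = 0 ∧ 1 - q = c * a ∧
      s = (1 - B⁻¹ • a) ^ n ∧ u = (-4 : ℝ) • (s - s ^ 2) ∧ ‖u‖ ≤ 1 / 4 ∧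
      Tendsto (fun N => (1 - (2 : ℝ) • s) * ∑ j ∈ Finset.range N, b j • u ^ j) atTop
        (nhds (1 - (2 : ℝ) • q)) := by
  have hB : 0 < B := hA.trans_le hAB
  obtain ⟨n, hn⟩ := exists_pow_lt_of_lt_one (show (0 : ℝ) < 1 / 16 by norm_num)
    (show 1 - A / B < 1 by have := div_pos hA hB; linarith)
  obtain ⟨sf, hsf⟩ : ∃ f : ℝ → ℝ, f = fun x => (1 - B⁻¹ * x) ^ n := ⟨_, rfl⟩
  obtain ⟨uf, huf⟩ : ∃ f : ℝ → ℝ, f = fun x => -4 * (sf x - sf x ^ 2) := ⟨_, rfl⟩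
  obtain ⟨qf, hqf⟩ : ∃ f : ℝ → ℝ, f = fun x => max 0 (1 - A⁻¹ * x) := ⟨_, rfl⟩
  have hsc : Continuous sf := by rw [hsf]; fun_prop
  have huc : Continuous uf := by rw [huf]; fun_prop
  have hqc : Continuous qf := by rw [hqf]; fun_prop
  have hs0 : sf 0 = 1 := by simp [hsf]
  have hu0 : uf 0 = 0 := by simp [huf, hs0]
  have hq0 : qf 0 = 1 := by simp [hqf]
  have hs1 : ∀ x ∈ Set.Icc A B, 0 ≤ sf x ∧ sf x ≤ 1 / 16 := by
    rintro x ⟨hx1, hx2⟩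
    have h0 : 0 ≤ 1 - B⁻¹ * x := by
      rw [sub_nonneg, inv_mul_le_iff₀ hB]
      linarith
    rw [hsf]
    refine ⟨pow_nonneg h0 n, le_trans (pow_le_pow_left₀ h0 ?_ n) hn.le⟩
    rw [div_eq_inv_mul]
    gcongr
  have hq1 : ∀ x ∈ Set.Icc A B, qf x = 0 := by
    rintro x ⟨hx1, hx2⟩
    rw [hqf]
    refine max_eq_left ?_
    rw [sub_nonpos, le_inv_mul_iff₀ hA]
    linarith
  have hu : ∀ x ∈ spectrum ℝ a, |uf x| ≤ 1 / 4 := by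
    intro x hx
    rcases hspec hx with h | h
    · rw [Set.mem_singleton_iff.1 h, hu0]
      norm_num
    · obtain ⟨h1, h2⟩ := hs1 x h
      rw [huf, abs_le]
      constructor <;> nlinarith
  have hs : cfc sf a = (1 - B⁻¹ • a) ^ n := by
    rw [hsf, cfc_pow (fun x => 1 - B⁻¹ * x) n a,
      cfc_sub (fun _ => 1) (fun x => B⁻¹ * x) a, cfc_const_one ℝ a, cfc_const_mul_id B⁻¹ a]
  have hu' : cfc uf a = (-4 : ℝ) • (cfc sf a - cfc sf a ^ 2) := by
    rw [huf, cfc_const_mul (-4) (fun x => sf x - sf x ^ 2) a (by fun_prop),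
      cfc_sub sf (fun x => sf x ^ 2) a (by fun_prop) (by fun_prop), cfc_pow sf 2 a (by fun_prop)]
  refine ⟨cfc qf a, cfc (fun x => (max x A)⁻¹) a, cfc sf a, cfc uf a, n, ?_, ?_, ?_, hs, hu', ?_, ?_⟩
  · exact cfc_predicate qf a
  · nth_rewrite 1 [← cfc_id' ℝ a]
    rw [← cfc_mul (fun x => x) qf a (by fun_prop) (by fun_prop), ← cfc_zero ℝ a]
    refine cfc_congr fun x hx => ?_
    rcases hspec hx with h | h
    · simp [Set.mem_singleton_iff.1 h]
    · simp [hq1 x h]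
  · have hc : Continuous fun x : ℝ => (max x A)⁻¹ :=
      Continuous.inv₀ (by fun_prop) fun x => (lt_max_of_lt_right hA).ne'
    nth_rewrite 3 [← cfc_id' ℝ a]
    rw [← cfc_mul (fun x => (max x A)⁻¹) (fun x => x) a hc.continuousOn (by fun_prop),
      ← cfc_const_one ℝ a, ← cfc_sub (fun _ => 1) qf a (by fun_prop) (by fun_prop)]
    refine cfc_congr fun x hx => ?_
    rcases hspec hx with h | h
    · simp [Set.mem_singleton_iff.1 h, hq0]
    · simp only [hq1 x h, max_eq_left h.1]
      rw [inv_mul_cancel₀ (hA.trans_le h.1).ne', sub_zero]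
  · exact norm_cfc_le (by norm_num) fun x hx => hu x hx
  · have hlim : (1 : 𝒜) - (2 : ℝ) • cfc qf a = cfc (fun x => 1 - 2 * qf x) a := by
      rw [cfc_sub (fun _ => 1) (fun x => 2 * qf x) a (by fun_prop) (by fun_prop),
        cfc_const_one ℝ a, cfc_const_mul 2 qf a (by fun_prop)]
    have hpart : ∀ N, (1 - (2 : ℝ) • cfc sf a) * ∑ j ∈ Finset.range N, b j • cfc uf a ^ j
        = cfc (fun x => ∑ j ∈ Finset.range N, (1 - 2 * sf x) * (b j * uf x ^ j)) a := by
      intro N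
      have h1 : ∀ j, b j • cfc uf a ^ j = cfc (fun x => b j * uf x ^ j) a := fun j => by
        rw [cfc_const_mul (b j) (fun x => uf x ^ j) a (by fun_prop), cfc_pow uf j a (by fun_prop)]
      have h2 : 1 - (2 : ℝ) • cfc sf a = cfc (fun x => 1 - 2 * sf x) a := by
        rw [cfc_sub (fun _ => 1) (fun x => 2 * sf x) a (by fun_prop) (by fun_prop),
          cfc_const_one ℝ a, cfc_const_mul 2 sf a (by fun_prop)]
      have h3 := cfc_sum (fun j x => (1 - 2 * sf x) * (b j * uf x ^ j)) a (Finset.range N)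
        (fun j _ => by fun_prop)
      rw [show (fun x => ∑ j ∈ Finset.range N, (1 - 2 * sf x) * (b j * uf x ^ j))
        = ∑ j ∈ Finset.range N, fun x => (1 - 2 * sf x) * (b j * uf x ^ j) by ext; simp, h3,
        Finset.mul_sum, h2]
      refine Finset.sum_congr rfl fun j _ => ?_
      rw [h1, ← cfc_mul (fun x => 1 - 2 * sf x) (fun x => b j * uf x ^ j) a (by fun_prop)
        (by fun_prop)]
    rw [hlim]
    simp_rw [hpart]
    refine tendsto_cfc_fun ?_ (Eventually.of_forall fun N => by fun_prop)
    have h1 : ∀ x ∈ spectrum ℝ a, |1 - 2 * sf x| ≤ 1 := by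
      intro x hx
      rcases hspec hx with h | h
      · rw [Set.mem_singleton_iff.1 h, hs0]
        norm_num
      · obtain ⟨h1, h2⟩ := hs1 x h
        rw [abs_le]
        constructor <;> linarith
    refine (tendstoUniformlyOn_tsum_nat hbs fun j x hx => ?_).congr_right fun x hx => ?_
    · rw [Real.norm_eq_abs, abs_mul, abs_mul, abs_pow]
      refine (mul_le_of_le_one_left (by positivity) (h1 x hx)).trans ?_
      gcongr
      exact (hu x hx).trans (by norm_num)
    · have h2 := (hb (uf x) ((hu x hx).trans_lt (by norm_num))).mul_left (1 - 2 * sf x)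
      simp only
      rw [h2.tsum_eq]
      rcases hspec hx with h | h
      · rw [Set.mem_singleton_iff.1 h, hs0, hu0, hq0]
        norm_num
      · obtain ⟨h3, h4⟩ := hs1 x h
        have h5 : 0 < 1 - 2 * sf x := by linarith
        rw [hq1 x h, show 1 + uf x = (1 - 2 * sf x) ^ 2 by rw [huf]; ring, ← Real.rpow_natCast_mul h5.le]
        norm_num
        rw [Real.rpow_neg_one, mul_inv_cancel₀ h5.ne']

section KernelProjection

variable {X ι : Type*} {κ : X → ι → ℤ} {W : (ι → ℤ) → ℝ≥0∞}

lemma decayNorm_real_smul_le (r : ℝ) (T : SeqL2 X →L[ℂ] SeqL2 X) :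
    decayNorm κ W (r • T) ≤ ‖r‖ₑ * decayNorm κ W T := by
  have h : r • T = (r : ℂ) • T := rfl
  rw [h]
  refine (decayNorm_smul_le _ _).trans_eq ?_
  rw [← ofReal_norm, Complex.norm_real, ofReal_norm]

lemma decayNorm_sub_ne_top {S T : SeqL2 X →L[ℂ] SeqL2 X} (hS : decayNorm κ W S ≠ ⊤)
    (hT : decayNorm κ W T ≠ ⊤) : decayNorm κ W (S - T) ≠ ⊤ := by
  rw [sub_eq_add_neg, ← neg_one_smul ℝ T]
  refine ne_top_of_le_ne_top ?_ (decayNorm_add_le _ _)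
  exact ENNReal.add_ne_top.2 ⟨hS, ne_top_of_le_ne_top (ENNReal.mul_ne_top enorm_ne_top hT)
    (decayNorm_real_smul_le _ _)⟩

lemma decayNorm_real_smul_ne_top (r : ℝ) {T : SeqL2 X →L[ℂ] SeqL2 X}
    (hT : decayNorm κ W T ≠ ⊤) : decayNorm κ W (r • T) ≠ ⊤ :=
  ne_top_of_le_ne_top (ENNReal.mul_ne_top enorm_ne_top hT) (decayNorm_real_smul_le _ _)

lemma decayNorm_one_ne_top (hWtop : ∀ k, W k ≠ ⊤) :
    decayNorm κ W (1 : SeqL2 X →L[ℂ] SeqL2 X) ≠ ⊤ := by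
  classical
  exact ne_top_of_le_ne_top (hWtop 0) decayNorm_one_le

lemma decayNorm_pow_ne_top {M : ℕ} (hM : ∀ k, (κ ⁻¹' {k}).encard ≤ M)
    (hWtop : ∀ k, W k ≠ ⊤) (hW : ∀ i j, W (i + j) ≤ W i * W j) {T : SeqL2 X →L[ℂ] SeqL2 X}
    (hT : decayNorm κ W T ≠ ⊤) (n : ℕ) : decayNorm κ W (T ^ n) ≠ ⊤ := by
  induction n with
  | zero => exact decayNorm_one_ne_top hWtop
  | succ n ih =>
    rw [pow_succ]
    exact ne_top_of_le_ne_top (by finiteness) (decayNorm_mul_le hM hW _ _)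

lemma decayNorm_sum_le (T : ℕ → SeqL2 X →L[ℂ] SeqL2 X) (N : ℕ) :
    decayNorm κ W (∑ j ∈ Finset.range N, T j) ≤ ∑ j ∈ Finset.range N, decayNorm κ W (T j) := by
  induction N with
  | zero =>
    rw [Finset.sum_range_zero, Finset.sum_range_zero, ← zero_smul ℝ (0 : SeqL2 X →L[ℂ] SeqL2 X)]
    refine (decayNorm_real_smul_le _ _).trans ?_
    simp
  | succ N ih =>
    rw [Finset.sum_range_succ, Finset.sum_range_succ]
    exact (decayNorm_add_le _ _).trans (add_le_add ih le_rfl)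

variable [Fintype ι]

theorem decayNorm_kernel_proj_ne_top {M : ℕ} (hM : ∀ k, (κ ⁻¹' {k}).encard ≤ M)
    (hW1 : ∀ k, 1 ≤ W k) (hWtop : ∀ k, W k ≠ ⊤) (hW : ∀ i j, W (i + j) ≤ W i * W j)
    (hWexp : ∀ a : ℝ, 0 < a → ∃ C : ℝ≥0∞, C ≠ ⊤ ∧
      ∀ k, W k ≤ C * ENNReal.ofReal (Real.exp (a * ‖k‖)))
    {T P : SeqL2 X →L[ℂ] SeqL2 X} (hT : decayNorm κ W T ≠ ⊤) (hsa : IsSelfAdjoint T)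
    {A B : ℝ} (hA : 0 < A) (hAB : A ≤ B)
    (hspec : spectrum ℂ T ⊆ (fun x : ℝ => (x : ℂ)) '' ({0} ∪ Set.Icc A B))
    (hPsa : IsSelfAdjoint P) (hPker : ∀ x, T (P x) = 0) (hPfix : ∀ x, T x = 0 → P x = x) :
    decayNorm κ W P ≠ ⊤ := by
  have hspecR : spectrum ℝ T ⊆ {0} ∪ Set.Icc A B := by
    intro x hx
    rw [← spectrum.preimage_algebraMap ℂ] at hx
    obtain ⟨y, hy, hxy⟩ := hspec hx
    have : y = x := Complex.ofReal_injective hxy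
    exact this ▸ hy
  obtain ⟨b, hbs, hb⟩ := exists_coeff_hasSum_rpow
  obtain ⟨q, c, s, u, n, hq, hTq, hqc, hs, hu, hnu, hlim⟩ :=
    exists_kernel_proj hsa hA hAB hspecR hbs hb
  have hPq : P = q := by
    have h1 : P * q = q := by
      ext1 x
      exact hPfix (q x) (congrArg (fun S : SeqL2 X →L[ℂ] SeqL2 X => S x) hTq)
    have h2 : T * P = 0 := by
      ext1 x
      exact hPker x
    have h3 : q * P = P := by
      have : (1 - q) * P = 0 := by rw [hqc, mul_assoc, h2, mul_zero]
      rw [sub_mul, one_mul, sub_eq_zero] at this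
      exact this.symm
    have h4 := congrArg star h3
    rw [star_mul, hPsa.star_eq, hq.star_eq] at h4
    rw [← h4, h1]
  have hsfin : decayNorm κ W s ≠ ⊤ := hs ▸ decayNorm_pow_ne_top hM hWtop hW
    (decayNorm_sub_ne_top (decayNorm_one_ne_top hWtop) (decayNorm_real_smul_ne_top _ hT)) n
  have hufin : decayNorm κ W u ≠ ⊤ := hu ▸ decayNorm_real_smul_ne_top _
    (decayNorm_sub_ne_top hsfin (decayNorm_pow_ne_top hM hWtop hW hsfin 2))
  have hwfin := decayNorm_sub_ne_top (decayNorm_one_ne_top (κ := κ) hWtop)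
    (decayNorm_real_smul_ne_top 2 hsfin)
  obtain ⟨C, hC, hCn⟩ := exists_decayNorm_pow_le hM hW1 hW hWexp hufin
    (r := 1 / 2) (hnu.trans_lt (by norm_num))
  have hbC : ∑' j, ‖b j‖ₑ * (C * ENNReal.ofReal (1 / 2) ^ j) ≠ ⊤ := by
    have h1 : ∀ j, ‖b j‖ₑ * (C * ENNReal.ofReal (1 / 2) ^ j)
        = C * ENNReal.ofReal (|b j| * (1 / 2) ^ j) := fun j => by
      rw [ENNReal.ofReal_mul (abs_nonneg _), ENNReal.ofReal_pow (by norm_num),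
        ← Real.norm_eq_abs, ofReal_norm]
      ring
    simp_rw [h1]
    rw [ENNReal.tsum_mul_left]
    exact ENNReal.mul_ne_top hC hbs.tsum_ofReal_ne_top
  have hw := decayNorm_le_of_tendsto (κ := κ) (W := W) hWtop hlim (fun N => by
    refine (decayNorm_mul_le hM hW _ _).trans (mul_le_mul_right (mul_le_mul_right
      ((decayNorm_sum_le _ _).trans ((Finset.sum_le_sum fun j _ =>
        (decayNorm_real_smul_le _ _).trans (mul_le_mul_right (hCn j) _)).trans
        (ENNReal.sum_le_tsum (f := fun j => ‖b j‖ₑ * (C * ENNReal.ofReal (1 / 2) ^ j)) _))) _) _))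
  have hqfin := decayNorm_real_smul_ne_top (1 / 2) (decayNorm_sub_ne_top
    (decayNorm_one_ne_top (κ := κ) hWtop) (ne_top_of_le_ne_top (by finiteness) hw))
  rw [sub_sub_cancel] at hqfin
  have hhalf : (1 / 2 : ℝ) • (2 : ℝ) • q = q := by
    rw [smul_smul]
    norm_num
  rw [hPq]
  exact fun h => hqfin ((congrArg (decayNorm κ W) hhalf).trans h)

end KernelProjection

section Weight

variable {d : ℕ} {v : E2 d → ℝ}

lemma intVec_add (j k : (Fin d ⊕ Fin d) → ℤ) :
    intVec (j + k) = intVec j + (intVec k : E2 d) := by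
  ext i
  simp [intVec]

lemma IsWeight.natCast_smul_le (hv : IsWeight v) (z : E2 d) (n : ℕ) :
    v (((n + 1 : ℕ) : ℝ) • z) ≤ v z ^ (n + 1) := by
  induction n with
  | zero => simp
  | succ n ih =>
    rw [pow_succ, Nat.cast_succ, add_smul, one_smul]
    exact (hv.submul _ _).trans (mul_le_mul_of_nonneg_right ih (hv.pos z).le)

lemma IsWeight.one_le (hv : IsWeight v) (hGRS : SatisfiesGRS v) (z : E2 d) : 1 ≤ v z := by
  refine le_of_tendsto (hGRS z) ?_
  filter_upwards [eventually_gt_atTop 0] with n hn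
  obtain ⟨n, rfl⟩ := Nat.exists_eq_succ_of_ne_zero hn.ne'
  refine (Real.rpow_le_rpow (hv.pos _).le (hv.natCast_smul_le z n) (by positivity)).trans ?_
  rw [Real.pow_rpow_inv_natCast (hv.pos z).le n.succ_ne_zero]

lemma SatisfiesGRS.exists_natCast_smul_le (hv : IsWeight v) (hGRS : SatisfiesGRS v) (z : E2 d)
    {a : ℝ} (ha : 0 < a) : ∃ C : ℝ, 0 < C ∧ ∀ n : ℕ, v ((n : ℝ) • z) ≤ C * Real.exp (a * n) := by
  have h := (hGRS z).eventually_lt_const (Real.one_lt_exp_iff.2 ha)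
  obtain ⟨N, hN⟩ := eventually_atTop.1 (h.and (eventually_gt_atTop 0))
  have hpos : ∀ n ∈ Finset.range N, 0 ≤ v ((n : ℝ) • z) := fun n _ => (hv.pos _).le
  refine ⟨1 + ∑ n ∈ Finset.range N, v ((n : ℝ) • z),
    add_pos_of_pos_of_nonneg one_pos (Finset.sum_nonneg hpos), fun n => ?_⟩
  rcases lt_or_ge n N with hn | hn
  · have h1 := Finset.single_le_sum hpos (Finset.mem_range.2 hn)
    refine le_trans ?_ (le_mul_of_one_le_right (by linarith [Finset.sum_nonneg hpos])
      (Real.one_le_exp (by positivity)))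
    linarith
  · obtain ⟨h1, h2⟩ := hN n hn
    have h3 : v ((n : ℝ) • z) ≤ Real.exp (a * n) := by
      have h4 := Real.rpow_le_rpow (Real.rpow_nonneg (hv.pos _).le _) h1.le (Nat.cast_nonneg n)
      change (v ((n : ℝ) • z) ^ ((n : ℝ)⁻¹)) ^ (n : ℝ) ≤ _ at h4
      rwa [Real.rpow_inv_rpow (hv.pos _).le (by exact_mod_cast h2.ne'), ← Real.exp_mul] at h4
    refine h3.trans (le_mul_of_one_le_left (Real.exp_nonneg _) ?_)
    linarith [Finset.sum_nonneg hpos]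

lemma SatisfiesGRS.exists_intCast_smul_le (hv : IsWeight v) (hGRS : SatisfiesGRS v) (z : E2 d)
    {a : ℝ} (ha : 0 < a) : ∃ C : ℝ, 0 < C ∧ ∀ n : ℤ, v ((n : ℝ) • z) ≤ C * Real.exp (a * ‖n‖) := by
  obtain ⟨C, hC, h⟩ := hGRS.exists_natCast_smul_le hv z ha
  obtain ⟨C', hC', h'⟩ := hGRS.exists_natCast_smul_le hv (-z) ha
  refine ⟨C + C', add_pos hC hC', fun n => ?_⟩
  rw [add_mul]
  obtain ⟨m, rfl | rfl⟩ := n.eq_nat_or_neg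
  · have := h m
    have h2 : 0 ≤ C' * Real.exp (a * m) := by positivity
    simp only [Int.cast_natCast, Int.norm_natCast]
    linarith
  · have := h' m
    have h2 : 0 ≤ C * Real.exp (a * m) := by positivity
    rw [norm_neg, Int.norm_natCast, Int.cast_neg, neg_smul, ← smul_neg, Int.cast_natCast]
    linarith

lemma IsWeight.sum_le (hv : IsWeight v) {I : Type*} (s : Finset I) (f : I → E2 d) :
    v (∑ i ∈ s, f i) ≤ v 0 * ∏ i ∈ s, v (f i) := by
  classical
  induction s using Finset.induction_on with
  | empty => simp
  | insert i s hi ih =>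
    rw [Finset.sum_insert hi, Finset.prod_insert hi]
    refine (hv.submul _ _).trans ((mul_le_mul_of_nonneg_left ih (hv.pos _).le).trans_eq ?_)
    ring

lemma intVec_eq_sum (k : (Fin d ⊕ Fin d) → ℤ) :
    intVec k = ∑ i, (k i : ℝ) • EuclideanSpace.single i (1 : ℝ) := by
  ext i
  rw [WithLp.ofLp_sum, Finset.sum_apply, Finset.sum_eq_single i]
  · simp [intVec]
  · intro j _ hj
    simp [hj.symm]
  · simp

lemma SatisfiesGRS.exists_intVec_le (hv : IsWeight v) (hGRS : SatisfiesGRS v)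
    {a : ℝ} (ha : 0 < a) : ∃ C : ℝ, 0 < C ∧ ∀ k, v (intVec k) ≤ C * Real.exp (a * ‖k‖) := by
  set N : ℕ := Fintype.card (Fin d ⊕ Fin d) with hN
  have hN1 : (0 : ℝ) < N + 1 := by positivity
  have ha' : 0 < a / (N + 1) := div_pos ha hN1
  choose C hC h using fun i : Fin d ⊕ Fin d =>
    hGRS.exists_intCast_smul_le hv (EuclideanSpace.single i (1 : ℝ)) ha'
  refine ⟨v 0 * ∏ i, C i, mul_pos (hv.pos _) (Finset.prod_pos fun i _ => hC i), fun k => ?_⟩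
  rw [intVec_eq_sum]
  refine (hv.sum_le _ _).trans ?_
  rw [mul_assoc]
  refine mul_le_mul_of_nonneg_left ?_ (hv.pos _).le
  calc ∏ i, v ((k i : ℝ) • EuclideanSpace.single i (1 : ℝ))
      ≤ ∏ i, (C i * Real.exp (a / (N + 1) * ‖k‖)) := by
        refine Finset.prod_le_prod (fun i _ => (hv.pos _).le) fun i _ => (h i (k i)).trans ?_
        have := hC i
        gcongr
        exact norm_le_pi_norm k i
    _ = (∏ i, C i) * Real.exp (N * (a / (N + 1) * ‖k‖)) := by
        rw [Finset.prod_mul_distrib, Finset.prod_const, Finset.card_univ, ← Real.exp_nat_mul]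
    _ ≤ _ := by
        refine mul_le_mul_of_nonneg_left (Real.exp_le_exp.2 ?_)
          (Finset.prod_nonneg fun i _ => (hC i).le)
        rw [← mul_assoc]
        refine mul_le_mul_of_nonneg_right ?_ (norm_nonneg k)
        rw [mul_div_assoc', div_le_iff₀ hN1]
        nlinarith

/-- The integer part of a point. -/
def floorVec (z : E2 d) : (Fin d ⊕ Fin d) → ℤ := fun i => ⌊z i⌋

lemma sub_intVec_mem_unitCube (z : E2 d) : z - intVec (floorVec z) ∈ unitCube d := fun i =>
  ⟨Int.fract_nonneg (z i), (Int.fract_lt_one (z i)).le⟩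

lemma isCompact_unitCube : IsCompact (unitCube d) := by
  have : unitCube d = (EuclideanSpace.equiv (Fin d ⊕ Fin d) ℝ) ⁻¹'
      (Set.univ.pi fun _ => Set.Icc (0 : ℝ) 1) := by
    ext z
    simp only [unitCube, Set.mem_ofPred_eq, Set.mem_preimage, Set.mem_pi, Set.mem_univ,
      true_imp_iff]
    rfl
  rw [this]
  exact (EuclideanSpace.equiv (Fin d ⊕ Fin d) ℝ).toHomeomorph.isCompact_preimage.2
    (isCompact_univ_pi fun _ => isCompact_Icc)

lemma RelativelySeparated.exists_encard_le {Λ : Set (E2 d)} (h : RelativelySeparated Λ) :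
    ∃ M : ℕ, ∀ k, ((fun l : Λ => floorVec (l : E2 d)) ⁻¹' {k}).encard ≤ M := by
  obtain ⟨N, hN⟩ := h
  obtain ⟨t, -, ht, hcov⟩ := (isCompact_unitCube (d := d)).finite_cover_balls one_pos
  lift t to Finset (E2 d) using ht
  refine ⟨t.card * N, fun k => ?_⟩
  rw [← Subtype.val_injective.encard_image]
  calc _ ≤ (⋃ c ∈ t, {l ∈ Λ | dist l (intVec k + c) ≤ 1}).encard := by
        refine Set.encard_le_encard ?_
        rintro _ ⟨l, rfl, rfl⟩
        obtain ⟨c, hc, hcl⟩ := Set.mem_iUnion₂.1 (hcov (sub_intVec_mem_unitCube (l : E2 d)))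
        refine Set.mem_iUnion₂.2 ⟨c, hc, l.2, ?_⟩
        rw [Metric.mem_ball, dist_eq_norm] at hcl
        rw [dist_eq_norm, ← sub_sub]
        exact hcl.le
    _ ≤ ∑ c ∈ t, ({l ∈ Λ | dist l (intVec k + c) ≤ 1}).encard :=
        Finset.set_encard_biUnion_le t _
    _ ≤ ∑ c ∈ t, (N : ℕ∞) := Finset.sum_le_sum fun c _ => hN _
    _ = _ := by simp

end Weight

section Amalgam

variable {d : ℕ} {v : E2 d → ℝ}

/-- A continuous cutoff function, equal to one where all coordinates are at most one in modulus
and vanishing where some coordinate is at least two in modulus. -/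
def cubeBump (z : E2 d) : ℝ := max 0 (min 1 (2 - ‖WithLp.ofLp z‖))

lemma continuous_cubeBump : Continuous (cubeBump (d := d)) := by
  unfold cubeBump
  fun_prop

lemma cubeBump_nonneg (z : E2 d) : 0 ≤ cubeBump z := le_max_left _ _

lemma cubeBump_le_one (z : E2 d) : cubeBump z ≤ 1 := max_le zero_le_one (min_le_left _ _)

lemma cubeBump_eq_one {z : E2 d} (hz : ‖WithLp.ofLp z‖ ≤ 1) : cubeBump z = 1 := by
  rw [cubeBump, min_eq_left (by linarith), max_eq_right zero_le_one]

lemma cubeBump_eq_zero {z : E2 d} (hz : 2 ≤ ‖WithLp.ofLp z‖) : cubeBump z = 0 := by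
  rw [cubeBump, max_eq_left]
  exact (min_le_right _ _).trans (by linarith)

lemma norm_ofLp_le_one_of_mem_unitCube {z : E2 d} (hz : z ∈ unitCube d) :
    ‖WithLp.ofLp z‖ ≤ 1 := by
  refine (pi_norm_le_iff_of_nonneg zero_le_one).2 fun i => ?_
  rw [Real.norm_eq_abs, abs_le]
  have := hz i
  exact ⟨by linarith [this.1], this.2⟩

lemma norm_ofLp_intVec (k : (Fin d ⊕ Fin d) → ℤ) : ‖WithLp.ofLp (intVec k : E2 d)‖ = ‖k‖ := by
  simp only [Pi.norm_def, intVec]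
  congr 2

lemma bddAbove_cube {F : Type*} [NormedAddCommGroup F] {Θ : E2 d → F} (hΘ : Continuous Θ)
    (k : (Fin d ⊕ Fin d) → ℤ) :
    BddAbove ((fun z => ‖Θ (intVec k + z)‖) '' unitCube d) :=
  (isCompact_unitCube.image (by fun_prop)).bddAbove

lemma norm_le_cubeSup {F : Type*} [NormedAddCommGroup F] {Θ : E2 d → F} (hΘ : Continuous Θ)
    (z : E2 d) : ‖Θ z‖ ≤ cubeSup Θ (floorVec z) := by
  refine le_csSup (bddAbove_cube hΘ _) ⟨_, sub_intVec_mem_unitCube z, ?_⟩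
  simp

lemma cubeSup_nonneg {F : Type*} [NormedAddCommGroup F] (Θ : E2 d → F)
    (k : (Fin d ⊕ Fin d) → ℤ) : 0 ≤ cubeSup Θ k :=
  Real.sSup_nonneg (by rintro _ ⟨z, -, rfl⟩; exact norm_nonneg _)

lemma IsWeight.ofReal_intVec_add_le (hv : IsWeight v) (j k : (Fin d ⊕ Fin d) → ℤ) :
    ENNReal.ofReal (v (intVec (j + k))) ≤
      ENNReal.ofReal (v (intVec j)) * ENNReal.ofReal (v (intVec k)) := by
  rw [← ENNReal.ofReal_mul (hv.pos _).le, intVec_add]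
  exact ENNReal.ofReal_le_ofReal (hv.submul _ _)

lemma SatisfiesGRS.exists_ofReal_intVec_le (hv : IsWeight v) (hGRS : SatisfiesGRS v)
    (a : ℝ) (ha : 0 < a) : ∃ C : ℝ≥0∞, C ≠ ⊤ ∧
      ∀ k, ENNReal.ofReal (v (intVec k)) ≤ C * ENNReal.ofReal (Real.exp (a * ‖k‖)) := by
  obtain ⟨C, hC, h⟩ := hGRS.exists_intVec_le hv ha
  refine ⟨ENNReal.ofReal C, ENNReal.ofReal_ne_top, fun k => ?_⟩
  rw [← ENNReal.ofReal_mul hC.le]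
  exact ENNReal.ofReal_le_ofReal (h k)

/-- A weighted summable sequence on the integer lattice is dominated by an envelope in the
amalgam space. -/
lemma exists_memAmalgamW (hv : IsWeight v) (hGRS : SatisfiesGRS v)
    (α : ((Fin d ⊕ Fin d) → ℤ) → ℝ≥0∞)
    (hα : ∑' k, α k * ENNReal.ofReal (v (intVec k)) ≠ ⊤) :
    ∃ Θ : E2 d → ℝ, MemAmalgamW Θ v ∧ ∀ k, α k ≠ ⊤ ∧
      ∀ z : E2 d, ‖WithLp.ofLp (z - intVec k)‖ ≤ 1 → (α k).toReal ≤ Θ z := by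
  have hαsum : ∑' k, α k ≠ ⊤ := by
    refine ne_top_of_le_ne_top hα (ENNReal.tsum_le_tsum fun k => le_mul_of_one_le_right' ?_)
    rw [ENNReal.one_le_ofReal]
    exact hv.one_le hGRS _
  have hαtop := ENNReal.ne_top_of_tsum_ne_top hαsum
  have ha : Summable fun k => (α k).toReal := ENNReal.summable_toReal hαsum
  have hterm0 : ∀ z k, 0 ≤ (α k).toReal * cubeBump (z - intVec k) := fun z k =>
    mul_nonneg ENNReal.toReal_nonneg (cubeBump_nonneg _)
  have hterm1 : ∀ z k, (α k).toReal * cubeBump (z - intVec k) ≤ (α k).toReal := fun z k =>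
    mul_le_of_le_one_right ENNReal.toReal_nonneg (cubeBump_le_one _)
  have hsum : ∀ z, Summable fun k => (α k).toReal * cubeBump (z - intVec k) := fun z =>
    ha.of_nonneg_of_le (hterm0 z) (hterm1 z)
  set β : ((Fin d ⊕ Fin d) → ℤ) → ℝ≥0∞ := fun k =>
    ∑' j, α j * (if ‖k - j‖ ≤ (3 : ℕ) then 1 else 0) with hβ
  have hcont : Continuous fun z : E2 d => ∑' k, (α k).toReal * cubeBump (z - intVec k) := by
    refine continuous_tsum (fun k => ?_) ha fun k z => ?_
    · exact continuous_const.mul (continuous_cubeBump.comp (by fun_prop))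
    · rw [Real.norm_of_nonneg (hterm0 z k)]
      exact hterm1 z k
  have hβtop : ∀ k, β k ≠ ⊤ := fun k => by
    refine ne_top_of_le_ne_top hαsum (ENNReal.tsum_le_tsum fun j => mul_le_of_le_one_right' ?_)
    split_ifs <;> simp
  have hβsum : ∑' k, β k * ENNReal.ofReal (v (intVec k)) ≠ ⊤ := by
    obtain ⟨C, hC, hCle⟩ := hGRS.exists_ofReal_intVec_le hv 1 one_pos
    obtain ⟨B, hB, hBle⟩ := exists_tsum_norm_le (ι := Fin d ⊕ Fin d) 3
    set C' : ℝ≥0∞ := C * ENNReal.ofReal (Real.exp 3)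
    have hC' : C' ≠ ⊤ := ENNReal.mul_ne_top hC ENNReal.ofReal_ne_top
    refine ne_top_of_le_ne_top (ENNReal.mul_ne_top hα (ENNReal.mul_ne_top hC' hB)) ?_
    calc ∑' k, β k * ENNReal.ofReal (v (intVec k))
        = ∑' k, ∑' j, α j * (if ‖k - j‖ ≤ (3 : ℕ) then 1 else 0) *
            ENNReal.ofReal (v (intVec k)) := by
          simp_rw [hβ, ENNReal.tsum_mul_right]
      _ ≤ ∑' k, ∑' j, α j * ENNReal.ofReal (v (intVec j)) *
            (C' * (if ‖k - j‖ ≤ (3 : ℕ) then 1 else 0)) := by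
          refine ENNReal.tsum_le_tsum fun k => ENNReal.tsum_le_tsum fun j => ?_
          split_ifs with hkj
          · rw [mul_one, mul_one, mul_assoc]
            gcongr
            calc ENNReal.ofReal (v (intVec k)) = ENNReal.ofReal (v (intVec (j + (k - j)))) := by
                  rw [add_sub_cancel]
              _ ≤ _ := hv.ofReal_intVec_add_le _ _
              _ ≤ _ := by
                  gcongr
                  refine (hCle _).trans ?_
                  refine mul_le_mul_right (ENNReal.ofReal_le_ofReal (Real.exp_le_exp.2 ?_)) _
                  rw [one_mul]
                  exact_mod_cast hkj
          · simp
      _ = ∑' j, α j * ENNReal.ofReal (v (intVec j)) *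
            (C' * ∑' k, (if ‖k - j‖ ≤ (3 : ℕ) then 1 else 0)) := by
          rw [ENNReal.tsum_comm]
          simp_rw [ENNReal.tsum_mul_left]
      _ ≤ ∑' j, α j * ENNReal.ofReal (v (intVec j)) * (C' * B) := by
          gcongr with j
          exact hBle j
      _ = _ := ENNReal.tsum_mul_right
  have hcube : ∀ k, cubeSup (fun z : E2 d => ∑' k, (α k).toReal * cubeBump (z - intVec k)) k ≤
      (β k).toReal := by
    intro k
    refine Real.sSup_le ?_ ENNReal.toReal_nonneg
    rintro _ ⟨z, hz, rfl⟩
    dsimp only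
    rw [Real.norm_of_nonneg (tsum_nonneg (hterm0 _)), ← ENNReal.ofReal_le_iff_le_toReal (hβtop k),
      ENNReal.ofReal_tsum_of_nonneg (hterm0 _) (hsum _)]
    refine ENNReal.tsum_le_tsum fun j => ?_
    split_ifs with hkj
    · rw [mul_one]
      exact ENNReal.ofReal_le_of_le_toReal (hterm1 _ _)
    · rw [cubeBump_eq_zero, mul_zero, ENNReal.ofReal_zero]
      · exact zero_le
      · have h1 := norm_ofLp_le_one_of_mem_unitCube hz
        have h2 := norm_ofLp_intVec (k - j)
        have h3 : intVec k + z - intVec j = intVec (k - j) + z := by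
          have := intVec_add (k - j) j
          rw [sub_add_cancel] at this
          rw [this]
          abel
        rw [h3, WithLp.ofLp_add]
        have h4 := norm_sub_le (WithLp.ofLp (intVec (k - j)) + WithLp.ofLp z) (WithLp.ofLp z)
        rw [add_sub_cancel_right, h2] at h4
        push_cast at hkj
        linarith
  refine ⟨fun z => ∑' k, (α k).toReal * cubeBump (z - intVec k), ⟨hcont, ?_⟩,
    fun k => ⟨hαtop k, fun z hz => ?_⟩⟩
  · refine (ENNReal.summable_toReal hβsum).of_nonneg_of_le
      (fun k => mul_nonneg (cubeSup_nonneg _ _) (hv.pos _).le) fun k => ?_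
    rw [ENNReal.toReal_mul, ENNReal.toReal_ofReal (hv.pos _).le]
    exact mul_le_mul_of_nonneg_right (hcube k) (hv.pos _).le
  · have h1 := (hsum z).le_tsum k fun j _ => hterm0 z j
    rwa [cubeBump_eq_one hz, mul_one] at h1

lemma floorVec_sub_mem (x y : E2 d) :
    floorVec (x - y) - (floorVec x - floorVec y) ∈
      Finset.Icc (-1 : (Fin d ⊕ Fin d) → ℤ) 0 := by
  rw [Finset.mem_Icc]
  constructor
  · intro i
    have h := Int.le_floor_add_floor (x i - y i) (y i)
    rw [sub_add_cancel] at h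
    change -1 ≤ ⌊x i - y i⌋ - (⌊x i⌋ - ⌊y i⌋)
    linarith
  · intro i
    have h := Int.le_floor_add (x i - y i) (y i)
    rw [sub_add_cancel] at h
    change ⌊x i - y i⌋ - (⌊x i⌋ - ⌊y i⌋) ≤ 0
    linarith

lemma norm_ofLp_sub_intVec_floorVec_le (x y : E2 d) :
    ‖WithLp.ofLp (x - y - intVec (floorVec x - floorVec y))‖ ≤ 1 := by
  refine (pi_norm_le_iff_of_nonneg zero_le_one).2 fun i => ?_
  change ‖x i - y i - ((⌊x i⌋ - ⌊y i⌋ : ℤ) : ℝ)‖ ≤ 1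
  rw [Real.norm_eq_abs, abs_le]
  push_cast
  constructor <;> linarith [Int.floor_le (x i), Int.lt_floor_add_one (x i), Int.floor_le (y i),
    Int.lt_floor_add_one (y i)]

/-- An operator whose entries are dominated by an amalgam space envelope has finite decay norm. -/
lemma decayNorm_ne_top_of_memAmalgamW (hv : IsWeight v) {Λ : Set (E2 d)} {T : SeqL2 Λ →L[ℂ] SeqL2 Λ}
    {Θ : E2 d → ℝ} (hΘ : MemAmalgamW Θ v)
    (hT : ∀ l m : Λ, ‖entry T l m‖ ≤ Θ ((l : E2 d) - (m : E2 d))) :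
    decayNorm (fun l : Λ => floorVec (l : E2 d)) (fun k => ENNReal.ofReal (v (intVec k))) T ≠ ⊤ := by
  have hdiag : ∀ k, diagSup (fun l : Λ => floorVec (l : E2 d)) T k ≤
      ∑ δ ∈ Finset.Icc (-1 : (Fin d ⊕ Fin d) → ℤ) 0, ENNReal.ofReal (cubeSup Θ (k + δ)) := by
    refine diagSup_le (α := fun k => ∑ δ ∈ Finset.Icc (-1 : (Fin d ⊕ Fin d) → ℤ) 0,
      ENNReal.ofReal (cubeSup Θ (k + δ))) fun l m => ?_
    refine le_trans ?_ (Finset.single_le_sum (fun _ _ => zero_le) (floorVec_sub_mem l m))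
    rw [add_sub_cancel, ← ofReal_norm]
    exact ENNReal.ofReal_le_ofReal
      ((hT l m).trans ((Real.le_norm_self _).trans (norm_le_cubeSup hΘ.1 _)))
  refine ne_top_of_le_ne_top (b := ∑ δ ∈ Finset.Icc (-1 : (Fin d ⊕ Fin d) → ℤ) 0,
    (∑' k, ENNReal.ofReal (cubeSup Θ k * v (intVec k))) * ENNReal.ofReal (v (intVec (-δ)))) ?_ ?_
  · exact (ENNReal.sum_lt_top.2 fun δ _ => (ENNReal.mul_ne_top hΘ.2.tsum_ofReal_ne_top
      ENNReal.ofReal_ne_top).lt_top).ne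
  · calc _ ≤ ∑' k, ∑ δ ∈ Finset.Icc (-1 : (Fin d ⊕ Fin d) → ℤ) 0,
          ENNReal.ofReal (cubeSup Θ (k + δ)) * ENNReal.ofReal (v (intVec k)) := by
          refine ENNReal.tsum_le_tsum fun k => ?_
          rw [← Finset.sum_mul]
          gcongr
          exact hdiag k
      _ = ∑ δ ∈ Finset.Icc (-1 : (Fin d ⊕ Fin d) → ℤ) 0,
          ∑' k, ENNReal.ofReal (cubeSup Θ (k + δ)) * ENNReal.ofReal (v (intVec k)) :=
        Summable.tsum_finsetSum fun _ _ => ENNReal.summable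
      _ ≤ _ := by
          refine Finset.sum_le_sum fun δ _ => ?_
          rw [← ENNReal.tsum_mul_right, ← (Equiv.addRight δ).tsum_eq
            fun k => ENNReal.ofReal (cubeSup Θ k * v (intVec k)) * _]
          refine ENNReal.tsum_le_tsum fun k => ?_
          rw [Equiv.coe_addRight, ENNReal.ofReal_mul (cubeSup_nonneg _ _), mul_assoc]
          gcongr
          have := hv.ofReal_intVec_add_le (k + δ) (-δ)
          rwa [add_neg_cancel_right] at this

lemma Represents.entry_eq {Λ : Set (E2 d)} {T : SeqL2 Λ →L[ℂ] SeqL2 Λ} {G : Λ → Λ → ℂ}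
    (hT : Represents T G) (l m : Λ) : entry T l m = G l m := by
  rw [entry, hT, tsum_eq_single m, unitVec_apply_self, mul_one]
  intro j hj
  rw [unitVec_apply_of_ne hj, mul_zero]

end Amalgam

/-- **Kernel projection has off-diagonal decay.** If `G ∈ C_v(Λ)` is self-adjoint with
spectrum contained in `{0} ∪ [A,B]`, `0 < A ≤ B`, then the orthogonal projection onto
`ker G` belongs to `C_v(Λ)`. -/
theorem kernel_projection_in_Cv {d : ℕ} (Λ : Set (E2 d)) (hΛc : Λ.Countable)
    (hΛs : RelativelySeparated Λ) (v : E2 d → ℝ) (hv : IsWeight v) (hGRS : SatisfiesGRS v)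
    (G : Λ → Λ → ℂ) (hG : MemCv G v)
    (T : lp (fun _ : Λ => ℂ) 2 →L[ℂ] lp (fun _ : Λ => ℂ) 2)
    (hT : Represents T G) (hsa : IsSelfAdjoint T)
    (A B : ℝ) (hA : 0 < A) (hAB : A ≤ B)
    (hspec : spectrum ℂ T ⊆ (fun x : ℝ => (x : ℂ)) '' ({0} ∪ Set.Icc A B))
    (P : lp (fun _ : Λ => ℂ) 2 →L[ℂ] lp (fun _ : Λ => ℂ) 2)
    (hPsa : IsSelfAdjoint P)
    (hPker : ∀ x, T (P x) = 0)
    (hPfix : ∀ x, T x = 0 → P x = x) :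
    ∃ Θ : E2 d → ℝ, MemAmalgamW Θ v ∧
      ∀ l m : Λ, ‖(P (lpSingle m) : ∀ _ : Λ, ℂ) l‖ ≤ Θ ((l : E2 d) - (m : E2 d)) := by
  obtain ⟨M, hM⟩ := hΛs.exists_encard_le
  obtain ⟨Θ, hΘ, hGΘ⟩ := hG
  have hdT := decayNorm_ne_top_of_memAmalgamW hv (T := T) hΘ fun l m => by
    rw [hT.entry_eq]
    exact hGΘ l m
  have hdP := decayNorm_kernel_proj_ne_top hM
    (fun k => ENNReal.one_le_ofReal.2 (hv.one_le hGRS _)) (fun k => ENNReal.ofReal_ne_top)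
    hv.ofReal_intVec_add_le (hGRS.exists_ofReal_intVec_le hv) hdT hsa hA hAB hspec
    hPsa hPker hPfix
  obtain ⟨Ψ, hΨ, hle⟩ := exists_memAmalgamW hv hGRS
    (diagSup (fun l : Λ => floorVec (l : E2 d)) P) hdP
  refine ⟨Ψ, hΨ, fun l m => ?_⟩
  obtain ⟨htop, h⟩ := hle (floorVec (l : E2 d) - floorVec (m : E2 d))
  have hentry : ‖entry P l m‖ ≤
      (diagSup (fun l : Λ => floorVec (l : E2 d)) P (floorVec (l : E2 d) - floorVec (m : E2 d))).toReal := by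
    rw [← toReal_enorm]
    exact ENNReal.toReal_mono htop
      (enorm_entry_le_diagSup (κ := fun l : Λ => floorVec (l : E2 d)) P l m)
  exact hentry.trans (h _ (norm_ofLp_sub_intVec_floorVec_le (l : E2 d) (m : E2 d)))
end
end

section
/- Fix s > 0 and let v(z) = (1+|z|)^s on ℝ^{2d}. Let g ∈ L²(ℝ^d) satisfy ∫_{ℝ^{2d}} |⟨g, π(z)g⟩| (1+|z|)^s dz < ∞, and let Λ ⊆ ℝ^{2d} be a countable relatively separated set. If G(g,Λ) is a frame for L²(ℝ^d) but not a Riesz basis, then the lower Riesz bound of the finite sections decays polynomially: A_n = O(n^{-2s}), i.e., there exists C > 0 with A_n ≤ C n^{-2s} for all n ≥ 1. -/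
open MeasureTheory Filter

noncomputable section

section RieszProjection

variable {H : Type*} [NormedAddCommGroup H] [InnerProductSpace ℂ H] [CompleteSpace H]

lemma isUnit_of_bounded_below {T : H →L[ℂ] H} {c : ℝ} (hc : 0 < c)
    (h₁ : ∀ x, c * ‖x‖ ≤ ‖T x‖) (h₂ : ∀ x, c * ‖x‖ ≤ ‖T.adjoint x‖) : IsUnit T := by
  have hanti : AntilipschitzWith (Real.toNNReal c⁻¹) T := by
    refine AddMonoidHomClass.antilipschitz_of_bound T fun x => ?_
    rw [Real.coe_toNNReal _ (by positivity), inv_mul_eq_div, le_div_iff₀ hc, mul_comm]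
    exact h₁ x
  rw [ContinuousLinearMap.isUnit_iff_bijective,
    ContinuousLinearMap.bijective_iff_dense_range_and_antilipschitz]
  refine ⟨?_, _, hanti⟩
  rw [Submodule.topologicalClosure_eq_top_iff, ContinuousLinearMap.orthogonal_range,
    Submodule.eq_bot_iff]
  intro x hx
  have hx' : T.adjoint x = 0 := hx
  have := h₂ x
  rw [hx', norm_zero] at this
  exact norm_le_zero_iff.1 (by nlinarith [norm_nonneg x])

/-- If `G` is self-adjoint with spectral gap `(0, A)`, then `z - G` is bounded below by `A / 2`
on the circle of radius `A / 2`. -/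
lemma norm_sub_apply_ge {G : H →L[ℂ] H} (hG : IsSelfAdjoint G) {A : ℝ}
    (hgap : ∀ x, A * ‖G x‖ ≤ ‖G (G x)‖) {z : ℂ} (hz : ‖z‖ = A / 2) (x : H) :
    A / 2 * ‖x‖ ≤ ‖z • x - G x‖ := by
  have hA : 0 ≤ A / 2 := hz ▸ norm_nonneg z
  have hker : (G.ker)ᗮ = G.range.topologicalClosure := by
    rw [ContinuousLinearMap.orthogonal_ker, hG.adjoint_eq]
  have : CompleteSpace G.ker := (ContinuousLinearMap.isClosed_ker G).completeSpace_coe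
  obtain ⟨p, hp, q, hq, rfl⟩ := G.ker.exists_add_mem_mem_orthogonal x
  have hp0 : G p = 0 := hp
  have hGq : A * ‖q‖ ≤ ‖G q‖ := by
    have hcl : IsClosed {y : H | A * ‖y‖ ≤ ‖G y‖} :=
      isClosed_le (by fun_prop) (by fun_prop)
    have hsub : (G.range : Set H) ⊆ {y : H | A * ‖y‖ ≤ ‖G y‖} := by
      rintro _ ⟨y, rfl⟩
      exact hgap y
    rw [hker] at hq
    exact closure_minimal hsub hcl hq
  have hGq' : G q ∈ (G.ker)ᗮ := by
    rw [hker]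
    exact subset_closure ⟨q, rfl⟩
  have hq' : z • q - G q ∈ (G.ker)ᗮ := Submodule.sub_mem _ (Submodule.smul_mem _ _ hq) hGq'
  have hlow : A / 2 * ‖q‖ ≤ ‖z • q - G q‖ := by
    have h1 := norm_sub_norm_le (G q) (z • q)
    rw [norm_smul, hz, norm_sub_rev] at h1
    linarith
  have e : z • (p + q) - G (p + q) = z • p + (z • q - G q) := by
    rw [map_add, hp0, smul_add]; abel
  have h1 : ‖p + q‖ * ‖p + q‖ = ‖p‖ * ‖p‖ + ‖q‖ * ‖q‖ :=
    norm_add_sq_eq_norm_sq_add_norm_sq_of_inner_eq_zero p q (hq p hp)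
  have h2 : ‖z • p + (z • q - G q)‖ * ‖z • p + (z • q - G q)‖
      = ‖z • p‖ * ‖z • p‖ + ‖z • q - G q‖ * ‖z • q - G q‖ :=
    norm_add_sq_eq_norm_sq_add_norm_sq_of_inner_eq_zero _ _
      (hq' _ (Submodule.smul_mem _ _ hp))
  rw [e]
  refine abs_le_of_sq_le_sq' ?_ (norm_nonneg _) |>.2
  rw [norm_smul, hz] at h2
  have h3 : (A / 2 * ‖q‖) * (A / 2 * ‖q‖) ≤ ‖z • q - G q‖ * ‖z • q - G q‖ :=
    mul_self_le_mul_self (by positivity) hlow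
  have h4 : (A / 2 * ‖p + q‖) ^ 2 = (A / 2) ^ 2 * (‖p + q‖ * ‖p + q‖) := by ring
  rw [h4, h1, sq, sq, h2]
  linarith

lemma clm_circleIntegral_comm (L : H →L[ℂ] H) {f : ℂ → H} {c : ℂ} {R : ℝ}
    (hf : CircleIntegrable f c R) : L (∮ z in C(c, R), f z) = ∮ z in C(c, R), L (f z) := by
  have := L.intervalIntegral_comp_comm hf.out
  simp only [circleIntegral, ← this, map_smul]

/-- Bounded perturbations of an operator with isolated eigenvalue `0` that are intertwined with the
operator itself preserve the existence of kernel vectors. -/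
theorem exists_ne_zero_of_intertwine {G E V : H →L[ℂ] H} (hG : IsSelfAdjoint G) {A : ℝ}
    (hA : 0 < A) (hgap : ∀ x, A * ‖G x‖ ≤ ‖G (G x)‖) (hE : ‖E‖ ≤ A / 8)
    (hV : ∀ x, G (V x) = V (G x + E x)) {c : H} (hc : c ≠ 0) (hGc : G c = 0) :
    ∃ u : H, u ≠ 0 ∧ G (V u) = 0 := by
  set M : H →L[ℂ] H := G + E with hM
  set r : ℝ := A / 2 with hr
  have hr0 : 0 < r := by positivity
  set b : ℝ := 3 * A / 8 with hb
  have hb0 : 0 < b := by positivity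
  have hsph : ∀ z ∈ Metric.sphere (0 : ℂ) r, ‖z‖ = A / 2 := by
    intro z hz; simpa using hz
  have hEx : ∀ x, ‖E x‖ ≤ A / 8 * ‖x‖ := fun x => E.le_of_opNorm_le hE x
  have hEx' : ∀ x, ‖E.adjoint x‖ ≤ A / 8 * ‖x‖ := fun x =>
    E.adjoint.le_of_opNorm_le (by simpa using hE) x
  have hlow : ∀ z ∈ Metric.sphere (0 : ℂ) r, ∀ x,
      b * ‖x‖ ≤ ‖(algebraMap ℂ (H →L[ℂ] H) z - M) x‖ := by
    intro z hz x
    have e : (algebraMap ℂ (H →L[ℂ] H) z - M) x = (z • x - G x) - E x := by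
      simp [hM, Algebra.algebraMap_eq_smul_one]; abel
    rw [e]
    have := norm_sub_norm_le (z • x - G x) (E x)
    have := norm_sub_apply_ge hG hgap (hsph z hz) x
    have := hEx x
    rw [hb]; linarith
  have hlow' : ∀ z ∈ Metric.sphere (0 : ℂ) r, ∀ x,
      b * ‖x‖ ≤ ‖(algebraMap ℂ (H →L[ℂ] H) z - M).adjoint x‖ := by
    intro z hz x
    have e : (algebraMap ℂ (H →L[ℂ] H) z - M).adjoint x
        = ((starRingEnd ℂ) z • x - G x) - E.adjoint x := by
      have h1 : ContinuousLinearMap.adjoint (1 : H →L[ℂ] H) = 1 := star_one _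
      simp [hM, Algebra.algebraMap_eq_smul_one, hG.adjoint_eq, map_smulₛₗ, h1]; abel
    rw [e]
    have := norm_sub_norm_le ((starRingEnd ℂ) z • x - G x) (E.adjoint x)
    have := norm_sub_apply_ge hG hgap (z := (starRingEnd ℂ) z)
      (by rw [RCLike.norm_conj]; exact hsph z hz) x
    have := hEx' x
    rw [hb]; linarith
  have hres : ∀ z ∈ Metric.sphere (0 : ℂ) r, z ∈ resolventSet ℂ M := fun z hz =>
    isUnit_of_bounded_below hb0 (hlow z hz) (hlow' z hz)
  have hcont : ContinuousOn (fun z => resolvent M z c) (Metric.sphere (0 : ℂ) r) := by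
    intro z hz
    have h1 := (spectrum.hasDerivAt_resolvent_const_left (hres z hz)).continuousAt
    exact (h1.clm_apply continuousAt_const).continuousWithinAt
  have hright : ∀ z ∈ Metric.sphere (0 : ℂ) r, z • resolvent M z c - M (resolvent M z c) = c := by
    intro z hz
    have h1 : (algebraMap ℂ (H →L[ℂ] H) z - M) * resolvent M z = 1 :=
      Ring.mul_inverse_cancel _ (hres z hz)
    have h2 := congrArg (fun T : H →L[ℂ] H => T c) h1
    simpa [Algebra.algebraMap_eq_smul_one] using h2
  have hbd : ∀ z ∈ Metric.sphere (0 : ℂ) r, ‖resolvent M z c‖ ≤ b⁻¹ * ‖c‖ := by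
    intro z hz
    have h1 := hlow z hz (resolvent M z c)
    have h2 : (algebraMap ℂ (H →L[ℂ] H) z - M) (resolvent M z c) = c := by
      simpa [Algebra.algebraMap_eq_smul_one] using hright z hz
    rw [h2] at h1
    rw [inv_mul_eq_div, le_div_iff₀ hb0, mul_comm]; exact h1
  set u : H := ∮ z in C((0 : ℂ), r), resolvent M z c with hu
  have hci : ∀ j : ℕ, CircleIntegrable (fun z => z ^ j • resolvent M z c) 0 r := fun j =>
    ContinuousOn.circleIntegrable hr0.le (by fun_prop)
  have hpow : ∀ j : ℕ, (M ^ j) u = ∮ z in C((0 : ℂ), r), z ^ j • resolvent M z c := by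
    intro j
    induction j with
    | zero => simp [hu]
    | succ j ih =>
      rw [pow_succ', mul_apply_eq_comp, ih, clm_circleIntegral_comm M (hci j)]
      have e1 : (∮ z in C((0 : ℂ), r), M (z ^ j • resolvent M z c))
          = ∮ z in C((0 : ℂ), r), (z ^ (j + 1) • resolvent M z c - z ^ j • c) := by
        refine circleIntegral.integral_congr hr0.le fun z hz => ?_
        have := hright z hz
        have h3 : M (resolvent M z c) = z • resolvent M z c - c := by
          exact (sub_eq_iff_eq_add.2 (by rw [add_comm]; exact (sub_eq_iff_eq_add.1 this))).symm
        simp only [map_smul, h3, smul_sub, smul_smul, pow_succ]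
      have e2 : (∮ z in C((0 : ℂ), r), z ^ j • c) = 0 := by
        rw [circleIntegral.integral_smul_const]
        have := circleIntegral.integral_sub_zpow_of_ne (n := (j : ℤ)) (by omega) 0 0 r
        simp only [sub_zero, zpow_natCast] at this
        rw [this, zero_smul]
      rw [e1, circleIntegral.integral_sub (hci (j + 1)), e2, sub_zero]
      exact ContinuousOn.circleIntegrable hr0.le (by fun_prop)
  have hpownorm : ∀ j : ℕ, ‖(M ^ j) u‖ ≤ 2 * Real.pi * r * (r ^ j * (b⁻¹ * ‖c‖)) := by
    intro j
    rw [hpow]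
    refine circleIntegral.norm_integral_le_of_norm_le_const hr0.le fun z hz => ?_
    rw [norm_smul, norm_pow, hsph z hz]
    gcongr
    exact hbd z hz
  have hMc : M c = E c := by simp [hM, hGc]
  have hune : u ≠ 0 := by
    intro hu0
    have e1 : (∮ z in C((0 : ℂ), r), z⁻¹ • c) = (2 * Real.pi * Complex.I) • c := by
      rw [circleIntegral.integral_smul_const]
      have := circleIntegral.integral_sub_center_inv 0 hr0.ne'
      simp only [sub_zero] at this
      rw [this]
    have hcontinv : ContinuousOn (fun z : ℂ => z⁻¹ • c) (Metric.sphere (0 : ℂ) r) := by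
      refine ContinuousOn.smul (ContinuousOn.inv₀ continuousOn_id ?_) continuousOn_const
      intro z hz h0
      have h4 := hsph z hz
      rw [h0] at h4
      simp at h4
      linarith
    have e2 : (∮ z in C((0 : ℂ), r), (resolvent M z c - z⁻¹ • c))
        = u - (2 * Real.pi * Complex.I) • c := by
      rw [circleIntegral.integral_sub (ContinuousOn.circleIntegrable hr0.le hcont)
        (ContinuousOn.circleIntegrable hr0.le hcontinv), e1]
    have e3 : ‖∮ z in C((0 : ℂ), r), (resolvent M z c - z⁻¹ • c)‖
        ≤ 2 * Real.pi * r * (r⁻¹ * (b⁻¹ * (A / 8 * ‖c‖))) := by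
      refine circleIntegral.norm_integral_le_of_norm_le_const hr0.le fun z hz => ?_
      have hz0 : z ≠ 0 := by
        intro h0
        have h4 := hsph z hz
        rw [h0] at h4
        simp at h4
        linarith
      have h5 : (algebraMap ℂ (H →L[ℂ] H) z - M) (resolvent M z c - z⁻¹ • c) = z⁻¹ • E c := by
        have h6 := hright z hz
        have h7 : (algebraMap ℂ (H →L[ℂ] H) z - M) (resolvent M z c - z⁻¹ • c)
            = (z • resolvent M z c - M (resolvent M z c)) - (z • z⁻¹ • c - z⁻¹ • M c) := by
          simp only [Algebra.algebraMap_eq_smul_one, sub_apply,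
            smul_apply, one_apply_eq_self, map_sub, map_smul, smul_sub]
          rw [smul_comm z z⁻¹ c]
        rw [h7, h6, hMc, smul_smul, mul_inv_cancel₀ hz0, one_smul]
        abel
      have h8 := hlow z hz (resolvent M z c - z⁻¹ • c)
      rw [h5, norm_smul, norm_inv, hsph z hz] at h8
      have h9 := hEx c
      have : ‖resolvent M z c - z⁻¹ • c‖ ≤ b⁻¹ * (r⁻¹ * ‖E c‖) := by
        rw [inv_mul_eq_div, le_div_iff₀ hb0, mul_comm]; exact h8
      calc _ ≤ b⁻¹ * (r⁻¹ * ‖E c‖) := this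
        _ ≤ b⁻¹ * (r⁻¹ * (A / 8 * ‖c‖)) := by gcongr
        _ = _ := by ring
    rw [e2, hu0, zero_sub, norm_neg, norm_smul] at e3
    have h10 : ‖(2 * Real.pi * Complex.I : ℂ)‖ = 2 * Real.pi := by
      simp [abs_of_pos Real.pi_pos]
    have h11 : 2 * Real.pi * r * (r⁻¹ * (b⁻¹ * (A / 8 * ‖c‖))) = 2 * Real.pi * (‖c‖ / 3) := by
      rw [hb]; field_simp
    rw [h10, h11] at e3
    have h12 : 0 < ‖c‖ := norm_pos_iff.2 hc
    have h13 := le_of_mul_le_mul_left e3 (by positivity)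
    linarith
  refine ⟨u, hune, ?_⟩
  have hGM : ∀ j : ℕ, (G ^ j) (V u) = V ((M ^ j) u) := by
    intro j
    induction j with
    | zero => simp
    | succ j ih =>
      rw [pow_succ', mul_apply_eq_comp, ih, hV, pow_succ',
        mul_apply_eq_comp]
      simp [hM]
  have hgrow : ∀ j : ℕ, A ^ j * ‖G (V u)‖ ≤ ‖(G ^ (j + 1)) (V u)‖ := by
    intro j
    induction j with
    | zero => simp
    | succ j ih =>
      have h1 := hgap ((G ^ j) (V u))
      have h2 : G ((G ^ j) (V u)) = (G ^ (j + 1)) (V u) := by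
        rw [pow_succ' G j, mul_apply_eq_comp]
      have h3 : G ((G ^ (j + 1)) (V u)) = (G ^ (j + 1 + 1)) (V u) := by
        rw [pow_succ' G (j + 1), mul_apply_eq_comp]
      rw [h2, h3] at h1
      calc A ^ (j + 1) * ‖G (V u)‖ = A * (A ^ j * ‖G (V u)‖) := by ring
        _ ≤ A * ‖(G ^ (j + 1)) (V u)‖ := by gcongr
        _ ≤ _ := h1
  set K : ℝ := ‖V‖ * (2 * Real.pi * r * (r * (b⁻¹ * ‖c‖))) with hK
  have hbound : ∀ j : ℕ, ‖G (V u)‖ ≤ K * (1 / 2) ^ j := by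
    intro j
    have h1 := hgrow j
    rw [hGM] at h1
    have h2 := (V.le_opNorm ((M ^ (j + 1)) u)).trans
      (mul_le_mul_of_nonneg_left (hpownorm (j + 1)) (norm_nonneg V))
    have h3 := h1.trans h2
    have h4 : ‖V‖ * (2 * Real.pi * r * (r ^ (j + 1) * (b⁻¹ * ‖c‖))) = A ^ j * (K * (1 / 2) ^ j) := by
      rw [hK, pow_succ, hr, div_pow, one_div, inv_pow]; ring
    rw [h4] at h3
    exact le_of_mul_le_mul_left h3 (by positivity)
  have hlim : Tendsto (fun j : ℕ => K * (1 / 2 : ℝ) ^ j) atTop (nhds (K * 0)) :=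
    (tendsto_pow_atTop_nhds_zero_of_lt_one (by norm_num) (by norm_num)).const_mul K
  rw [mul_zero] at hlim
  exact norm_le_zero_iff.1 (ge_of_tendsto' hlim hbound)

end RieszProjection

section SchurTest

open scoped ENNReal

variable {ι : Type*}

lemma tsum_mul_sq_le_of_tsum_le (a b : ι → ℝ≥0∞) :
    (∑' i, a i * b i) ^ 2 ≤ (∑' i, a i) * ∑' i, a i * b i ^ 2 := by
  have h : ∑' i, a i * b i ≤ ((∑' i, a i) * ∑' i, a i * b i ^ 2) ^ (2⁻¹ : ℝ) := by
    rw [ENNReal.tsum_eq_iSup_sum]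
    refine iSup_le fun s => ?_
    refine (ENNReal.inner_le_weight_mul_Lp_of_nonneg s (p := 2) (by norm_num) a b).trans ?_
    rw [ENNReal.mul_rpow_of_nonneg _ _ (by norm_num)]
    have e : (1 : ℝ) - 2⁻¹ = 2⁻¹ := by norm_num
    rw [e]
    simp only [ENNReal.rpow_two]
    gcongr <;> exact ENNReal.sum_le_tsum _
  calc (∑' i, a i * b i) ^ 2 ≤ (((∑' i, a i) * ∑' i, a i * b i ^ 2) ^ (2⁻¹ : ℝ)) ^ 2 := by gcongr
    _ = _ := by
      rw [← ENNReal.rpow_two, ← ENNReal.rpow_mul]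
      norm_num

lemma lp_hasSum_sq (c : lp (fun _ : ι => ℂ) 2) : HasSum (fun i => ‖c i‖ ^ 2) (‖c‖ ^ 2) := by
  simpa using lp.hasSum_norm (by norm_num) c

lemma lp_tsum_enorm_sq (c : lp (fun _ : ι => ℂ) 2) : ∑' i, ‖c i‖ₑ ^ 2 = ‖c‖ₑ ^ 2 := by
  have h := lp_hasSum_sq c
  have e : ∀ x : ℂ, ‖x‖ₑ ^ 2 = ENNReal.ofReal (‖x‖ ^ 2) := fun x => by
    rw [ENNReal.ofReal_pow (norm_nonneg _), ofReal_norm]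
  simp_rw [e]
  rw [← ENNReal.ofReal_tsum_of_nonneg (fun i => by positivity) h.summable, h.tsum_eq,
    ENNReal.ofReal_pow (norm_nonneg _), ofReal_norm]

lemma lp_memℓp_two_of_summable {f : ι → ℂ} (h : Summable fun i => ‖f i‖ ^ 2) :
    Memℓp f 2 := memℓp_gen (by simpa using h)

lemma summable_norm_sq_of_tsum_enorm_sq_lt_top {f : ι → ℂ} (h : ∑' i, ‖f i‖ₑ ^ 2 ≠ ∞) :
    Summable fun i => ‖f i‖ ^ 2 := by
  have := ENNReal.summable_toReal h
  simpa using this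

/-- Schur's test: a matrix whose absolute row and column sums are at most `κ` defines an operator
of norm at most `κ` on `ℓ²`. -/
theorem exists_clm_of_schur (M : ι → ι → ℂ) {κ : ℝ} (hκ : 0 ≤ κ)
    (hrow : ∀ l, ∑' m, ‖M l m‖ₑ ≤ ENNReal.ofReal κ)
    (hcol : ∀ m, ∑' l, ‖M l m‖ₑ ≤ ENNReal.ofReal κ) :
    ∃ T : lp (fun _ : ι => ℂ) 2 →L[ℂ] lp (fun _ : ι => ℂ) 2, ‖T‖ ≤ κ ∧
      ∀ c l, HasSum (fun m => M l m * c m) (T c l) := by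
  have hmain : ∀ c : lp (fun _ : ι => ℂ) 2,
      ∑' l, (∑' m, ‖M l m‖ₑ * ‖c m‖ₑ) ^ 2 ≤ ENNReal.ofReal κ ^ 2 * ‖c‖ₑ ^ 2 := by
    intro c
    calc ∑' l, (∑' m, ‖M l m‖ₑ * ‖c m‖ₑ) ^ 2
        ≤ ∑' l, ENNReal.ofReal κ * ∑' m, ‖M l m‖ₑ * ‖c m‖ₑ ^ 2 := by
          refine ENNReal.tsum_le_tsum fun l => (tsum_mul_sq_le_of_tsum_le _ _).trans ?_
          gcongr
          exact hrow l
      _ = ENNReal.ofReal κ * ∑' m, (∑' l, ‖M l m‖ₑ) * ‖c m‖ₑ ^ 2 := by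
          rw [ENNReal.tsum_mul_left, ENNReal.tsum_comm]
          simp_rw [ENNReal.tsum_mul_right]
      _ ≤ ENNReal.ofReal κ * ∑' m, ENNReal.ofReal κ * ‖c m‖ₑ ^ 2 := by
          gcongr with m
          exact hcol m
      _ = _ := by rw [ENNReal.tsum_mul_left, lp_tsum_enorm_sq, ← mul_assoc, ← sq]
  have hfin : ∀ c : lp (fun _ : ι => ℂ) 2, ENNReal.ofReal κ ^ 2 * ‖c‖ₑ ^ 2 ≠ ∞ := fun c => by
    finiteness
  have hsum : ∀ (c : lp (fun _ : ι => ℂ) 2) (l : ι), Summable fun m => M l m * c m := by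
    intro c l
    have h1 : (∑' m, ‖M l m‖ₑ * ‖c m‖ₑ) ^ 2 ≠ ∞ :=
      ne_top_of_le_ne_top (hfin c) ((ENNReal.le_tsum l).trans (hmain c))
    have h2 : ∑' m, ‖M l m‖ₑ * ‖c m‖ₑ ≠ ∞ := by
      intro h; rw [h] at h1; simp at h1
    have h3 := ENNReal.summable_toReal h2
    refine Summable.of_norm ?_
    simpa using h3
  have hle : ∀ c : lp (fun _ : ι => ℂ) 2,
      ∑' l, ‖∑' m, M l m * c m‖ₑ ^ 2 ≤ ENNReal.ofReal κ ^ 2 * ‖c‖ₑ ^ 2 := by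
    intro c
    refine le_trans (ENNReal.tsum_le_tsum fun l => ?_) (hmain c)
    gcongr
    refine enorm_tsum_le_tsum_enorm.trans ?_
    simp [enorm_mul]
  have hmem : ∀ c : lp (fun _ : ι => ℂ) 2, Memℓp (fun l => ∑' m, M l m * c m) 2 := fun c =>
    lp_memℓp_two_of_summable
      (summable_norm_sq_of_tsum_enorm_sq_lt_top (ne_top_of_le_ne_top (hfin c) (hle c)))
  let T₀ : lp (fun _ : ι => ℂ) 2 →ₗ[ℂ] lp (fun _ : ι => ℂ) 2 :=
    { toFun := fun c => ⟨fun l => ∑' m, M l m * c m, hmem c⟩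
      map_add' := by
        intro c c'
        ext l
        change ∑' m, M l m * (c m + c' m) = _
        simp_rw [mul_add]
        exact (hsum c l).tsum_add (hsum c' l)
      map_smul' := by
        intro a c
        ext l
        change ∑' m, M l m * (a * c m) = a * _
        rw [← tsum_mul_left]
        exact tsum_congr fun m => by ring }
  have hT : ∀ c, ‖T₀ c‖ ≤ κ * ‖c‖ := by
    intro c
    have h1 := hle c
    have h2 : ‖T₀ c‖ₑ ^ 2 ≤ ENNReal.ofReal κ ^ 2 * ‖c‖ₑ ^ 2 := by
      rw [← lp_tsum_enorm_sq]; exact h1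
    rw [← mul_pow] at h2
    have h3 : ‖T₀ c‖ₑ ≤ ENNReal.ofReal κ * ‖c‖ₑ :=
      (ENNReal.pow_le_pow_left_iff two_ne_zero).1 h2
    rw [← ofReal_norm, ← ofReal_norm, ← ENNReal.ofReal_mul hκ] at h3
    exact (ENNReal.ofReal_le_ofReal_iff (by positivity)).1 h3
  exact ⟨T₀.mkContinuous κ hT, LinearMap.mkContinuous_norm_le _ hκ _,
    fun c l => (hsum c l).hasSum⟩

end SchurTest

section FrameKernel

open scoped ENNReal InnerProductSpace

variable {ι : Type*} {H : Type*} [NormedAddCommGroup H] [InnerProductSpace ℂ H]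

/-- The analysis operator of a Bessel family. -/
lemma exists_analysis_clm {φ : ι → H} {B : ℝ} (hB : 0 ≤ B)
    (hsum : ∀ f, Summable fun i => ‖⟪φ i, f⟫_ℂ‖ ^ 2)
    (hle : ∀ f, ∑' i, ‖⟪φ i, f⟫_ℂ‖ ^ 2 ≤ B * ‖f‖ ^ 2) :
    ∃ C : H →L[ℂ] lp (fun _ : ι => ℂ) 2, ‖C‖ ≤ √B ∧ ∀ f i, C f i = ⟪φ i, f⟫_ℂ := by
  let C₀ : H →ₗ[ℂ] lp (fun _ : ι => ℂ) 2 :=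
    { toFun := fun f => ⟨fun i => ⟪φ i, f⟫_ℂ, lp_memℓp_two_of_summable (hsum f)⟩
      map_add' := fun f h => by
        ext i
        exact inner_add_right _ _ _
      map_smul' := fun a f => by
        ext i
        exact inner_smul_right _ _ _ }
  have hC : ∀ f, ‖C₀ f‖ ≤ √B * ‖f‖ := by
    intro f
    have h1 : ‖C₀ f‖ ^ 2 = ∑' i, ‖⟪φ i, f⟫_ℂ‖ ^ 2 := (lp_hasSum_sq (C₀ f)).tsum_eq.symm
    refine abs_le_of_sq_le_sq' ?_ (by positivity) |>.2
    rw [h1, mul_pow, Real.sq_sqrt hB]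
    exact hle f
  exact ⟨C₀.mkContinuous _ hC, LinearMap.mkContinuous_norm_le _ (by positivity) _, fun f i => rfl⟩

/-- Bounded diagonal operators on `ℓ²`. -/
lemma exists_diagonal_clm {a : ι → ℝ} (ha0 : ∀ i, 0 ≤ a i) (ha1 : ∀ i, a i ≤ 1) :
    ∃ T : lp (fun _ : ι => ℂ) 2 →L[ℂ] lp (fun _ : ι => ℂ) 2, ∀ c i, T c i = a i * c i := by
  classical
  have hnorm : ∀ i, ‖(a i : ℂ)‖ₑ ≤ ENNReal.ofReal 1 := fun i => by
    rw [← ofReal_norm, Complex.norm_real, Real.norm_of_nonneg (ha0 i)]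
    exact ENNReal.ofReal_le_ofReal (ha1 i)
  obtain ⟨T, -, hT⟩ := exists_clm_of_schur (fun l m : ι => if m = l then (a l : ℂ) else 0)
    zero_le_one
    (fun l => by
      rw [tsum_eq_single l (by intro m hm; simp [hm])]
      simpa using hnorm l)
    (fun m => by
      rw [tsum_eq_single m (by intro l hl; simp [hl.symm])]
      simpa using hnorm m)
  refine ⟨T, fun c i => (hT c i).unique ?_⟩
  convert hasSum_single i ?_ using 1
  · simp
  · intro m hm
    simp [hm]

variable [CompleteSpace H]

/-- If the synthesis operator of a frame has a nontrivial kernel, and the commutator of its Gram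
matrix with the weight `w` is small, then its kernel contains a nonzero vector of the form
`u / w` with `u ∈ ℓ²`. The conclusion records the resulting bound on truncations. -/
theorem exists_truncation_bound_of_frame {φ : ι → H} {A B : ℝ} (hA : 0 < A) (hB : 0 ≤ B)
    (hsum : ∀ f, Summable fun i => ‖⟪φ i, f⟫_ℂ‖ ^ 2)
    (hlow : ∀ f, A * ‖f‖ ^ 2 ≤ ∑' i, ‖⟪φ i, f⟫_ℂ‖ ^ 2)
    (hle : ∀ f, ∑' i, ‖⟪φ i, f⟫_ℂ‖ ^ 2 ≤ B * ‖f‖ ^ 2)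
    {w : ι → ℝ} (hw : ∀ i, 1 ≤ w i)
    (hrow : ∀ l, ∑' m, ‖⟪φ l, φ m⟫_ℂ * ((w l / w m - 1 : ℝ) : ℂ)‖ₑ ≤ ENNReal.ofReal (A / 8))
    (hcol : ∀ m, ∑' l, ‖⟪φ l, φ m⟫_ℂ * ((w l / w m - 1 : ℝ) : ℂ)‖ₑ ≤ ENNReal.ofReal (A / 8))
    {c : ι → ℂ} (hc : Summable fun i => ‖c i‖ ^ 2) (hc0 : ∃ i, c i ≠ 0)
    (hDc : Tendsto (fun s : Finset ι => ∑ i ∈ s, c i • φ i) atTop (nhds 0)) :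
    ∃ u : ι → ℂ, (∃ i, u i ≠ 0) ∧ ∃ K : ℝ, 0 ≤ K ∧ ∀ (s : Finset ι) (r : ℝ),
      (∀ i ∉ s, (w i)⁻¹ ≤ r) → ‖∑ i ∈ s, u i • φ i‖ ^ 2 ≤ K * r ^ 2 := by
  classical
  obtain ⟨C, hCB, hC⟩ := exists_analysis_clm hB hsum hle
  have hwpos : ∀ i, 0 < w i := fun i => one_pos.trans_le (hw i)
  obtain ⟨V, hV⟩ := exists_diagonal_clm (a := fun i => (w i)⁻¹)
    (fun i => (inv_pos.2 (hwpos i)).le) (fun i => inv_le_one_of_one_le₀ (hw i))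
  obtain ⟨E, hEA, hE⟩ := exists_clm_of_schur
    (fun l m => ⟪φ l, φ m⟫_ℂ * ((w l / w m - 1 : ℝ) : ℂ)) (by positivity) hrow hcol
  set D := C.adjoint with hD
  have hDsingle : ∀ (i : ι) (a : ℂ), D (lp.single 2 i a) = a • φ i := by
    intro i a
    refine ext_inner_right ℂ fun f => ?_
    rw [hD, ContinuousLinearMap.adjoint_inner_left, lp.inner_single_left, hC, inner_smul_left]
    simp [mul_comm]
  have hDsum : ∀ x : lp (fun _ : ι => ℂ) 2, HasSum (fun i => x i • φ i) (D x) := by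
    intro x
    have h := (lp.hasSum_single (by norm_num) x).mapL D
    simpa only [hDsingle] using h
  set G := C ∘L D with hGdef
  have hGsum : ∀ (x : lp (fun _ : ι => ℂ) 2) l, HasSum (fun m => ⟪φ l, φ m⟫_ℂ * x m) (G x l) := by
    intro x l
    have h := (hDsum x).mapL (innerSL ℂ (φ l))
    simp only [innerSL_apply_apply, inner_smul_right] at h
    have e : G x l = ⟪φ l, D x⟫_ℂ := hC _ _
    rw [e]
    simpa only [mul_comm] using h
  have hGsa : IsSelfAdjoint G := by
    rw [ContinuousLinearMap.isSelfAdjoint_iff', hGdef, ContinuousLinearMap.adjoint_comp, hD,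
      ContinuousLinearMap.adjoint_adjoint]
  have hClow : ∀ f, A * ‖f‖ ^ 2 ≤ ‖C f‖ ^ 2 := by
    intro f
    rw [← (lp_hasSum_sq (C f)).tsum_eq]
    simpa only [hC] using hlow f
  have hgap : ∀ x, A * ‖G x‖ ≤ ‖G (G x)‖ := by
    intro x
    set f := D x
    have h1 : ‖C f‖ ^ 2 ≤ ‖f‖ * ‖D (C f)‖ := by
      have h2 : ⟪f, D (C f)⟫_ℂ = ((‖C f‖ ^ 2 : ℝ) : ℂ) := by
        rw [hD, ContinuousLinearMap.adjoint_inner_right, inner_self_eq_norm_sq_to_K]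
        simp
      have h3 := norm_inner_le_norm (𝕜 := ℂ) f (D (C f))
      rw [h2, Complex.norm_real, Real.norm_of_nonneg (by positivity)] at h3
      exact h3
    have h2 := hClow f
    have h3 := hClow (D (C f))
    have e1 : G x = C f := rfl
    have e2 : G (G x) = C (D (C f)) := rfl
    rw [e2, e1]
    have h4 : A * ‖f‖ ≤ ‖D (C f)‖ := by
      rcases (norm_nonneg f).eq_or_lt with h0 | h0
      · rw [← h0]; simp
      · have : (A * ‖f‖) * ‖f‖ ≤ ‖D (C f)‖ * ‖f‖ := by nlinarith
        exact le_of_mul_le_mul_right this h0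
    have h5 : A * ‖C f‖ ^ 2 ≤ ‖D (C f)‖ ^ 2 := by nlinarith [norm_nonneg (D (C f)), norm_nonneg f]
    refine abs_le_of_sq_le_sq' ?_ (norm_nonneg _) |>.2
    nlinarith
  have hVG : ∀ x, G (V x) = V (G x + E x) := by
    intro x
    ext l
    refine (hGsum (V x) l).unique ?_
    rw [hV, lp.coeFn_add, Pi.add_apply]
    have h := ((hGsum x l).add (hE x l)).mul_left (((w l)⁻¹ : ℝ) : ℂ)
    refine h.congr_fun fun m => ?_
    have h1 : (w l : ℂ) ≠ 0 := by exact_mod_cast (hwpos l).ne'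
    have h2 : (w m : ℂ) ≠ 0 := by exact_mod_cast (hwpos m).ne'
    rw [hV]
    push_cast
    field_simp
    ring
  let c' : lp (fun _ : ι => ℂ) 2 := ⟨c, lp_memℓp_two_of_summable hc⟩
  have hc'0 : c' ≠ 0 := by
    rintro h
    obtain ⟨i, hi⟩ := hc0
    exact hi (congrArg (fun y : lp (fun _ : ι => ℂ) 2 => y i) h)
  have hDc' : D c' = 0 := tendsto_nhds_unique (hDsum c') hDc
  have hGc' : G c' = 0 := by
    change C (D c') = 0
    rw [hDc', map_zero]
  obtain ⟨v, hv0, hv⟩ := exists_ne_zero_of_intertwine hGsa hA hgap hEA hVG hc'0 hGc'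
  have hDv : D (V v) = 0 := by
    have h1 : ⟪D (V v), D (V v)⟫_ℂ = 0 := by
      rw [hD, ContinuousLinearMap.adjoint_inner_left]
      have h2 : C (D (V v)) = 0 := hv
      rw [← hD, h2, inner_zero_right]
    exact inner_self_eq_zero.1 h1
  refine ⟨fun i => V v i, ?_, B * ‖v‖ ^ 2, by positivity, fun s r hr => ?_⟩
  · by_contra! hcon
    refine hv0 ?_
    ext i
    have h1 := hcon i
    rw [hV] at h1
    have h2 : (((w i)⁻¹ : ℝ) : ℂ) ≠ 0 := by
      exact_mod_cast (inv_pos.2 (hwpos i)).ne'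
    exact (mul_eq_zero.1 h1).resolve_left h2
  · set y : lp (fun _ : ι => ℂ) 2 := ∑ i ∈ s, lp.single 2 i (V v i)
    have hDy : D y = ∑ i ∈ s, V v i • φ i := by
      simp only [y, map_sum, hDsingle]
    have hDy' : D (V v - y) = -D y := by rw [map_sub, hDv, zero_sub]
    have hycoe : ∀ i, (V v - y) i = if i ∈ s then 0 else V v i := by
      intro i
      simp only [y, lp.coeFn_sub, lp.coeFn_sum, Pi.sub_apply, Finset.sum_apply, lp.single_apply,
        Pi.single_apply]
      rw [Finset.sum_ite_eq s i]
      split_ifs <;> simp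
    have hnorm : ‖V v - y‖ ^ 2 ≤ r ^ 2 * ‖v‖ ^ 2 := by
      refine hasSum_le (fun i => ?_) (lp_hasSum_sq (V v - y)) ((lp_hasSum_sq v).mul_left (r ^ 2))
      rw [hycoe]
      split_ifs with hi
      · simp; positivity
      · rw [hV, norm_mul, mul_pow, Complex.norm_real,
          Real.norm_of_nonneg (inv_pos.2 (hwpos i)).le]
        have := hr i hi
        have h0 := (inv_pos.2 (hwpos i)).le
        gcongr
    rw [← hDy, ← norm_neg, ← hDy']
    have hDB : ‖D‖ ≤ √B := by
      rw [hD, LinearIsometryEquiv.norm_map]; exact hCB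
    calc ‖D (V v - y)‖ ^ 2 ≤ (√B * ‖V v - y‖) ^ 2 := by
          gcongr
          exact D.le_of_opNorm_le hDB _
      _ = B * ‖V v - y‖ ^ 2 := by rw [mul_pow, Real.sq_sqrt hB]
      _ ≤ B * (r ^ 2 * ‖v‖ ^ 2) := by gcongr
      _ = _ := by ring

end FrameKernel

section KernelDecay

open scoped ENNReal Topology

variable {V : Type*} [NormedAddCommGroup V] [InnerProductSpace ℝ V] [FiniteDimensional ℝ V]
  [MeasurableSpace V] [BorelSpace V]

/-- If `F(u) F(z) ≤ ∫ F(w) F(z - u - w) dw` and `h(z) ≤ K(w, z - u - w)` for `u ∈ U`, then sums of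
`F h` over a set having at most `N` points in each translate of `U` are controlled by a double
integral. -/
lemma lintegral_mul_tsum_le {F : V → ℝ≥0∞} (hF : Measurable F)
    (hFF : ∀ u z, F u * F z ≤ ∫⁻ w, F w * F (z - u - w))
    {U : Set V} (hU : MeasurableSet U) {h : V → ℝ≥0∞} {K : V × V → ℝ≥0∞} (hK : Measurable K)
    (hhK : ∀ u ∈ U, ∀ z w, h z ≤ K (w, z - u - w)) {Λ : Set V} (hΛ : Λ.Countable) {N : ℝ≥0∞}
    (hN : ∀ z, ∑' m : Λ, U.indicator 1 ((m : V) - z) ≤ N) (l : V) :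
    (∫⁻ u in U, F u) * ∑' m : Λ, F (m - l) * h (m - l) ≤
      N * ∫⁻ p : V × V, F p.1 * F p.2 * K p := by
  have hcount : Countable Λ := hΛ.to_subtype
  have hind : Measurable (U.indicator (1 : V → ℝ≥0∞)) := measurable_one.indicator hU
  have hpoint : ∀ z, (∫⁻ u in U, F u) * (F z * h z) ≤
      ∫⁻ p : V × V, U.indicator 1 (z - p.1 - p.2) * (F p.1 * F p.2 * K p) := by
    intro z
    have hmeas : Measurable fun p : V × V =>
        U.indicator 1 (z - p.1 - p.2) * (F p.1 * F p.2 * K p) := by fun_prop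
    calc (∫⁻ u in U, F u) * (F z * h z)
        = ∫⁻ u, U.indicator 1 u * (F u * F z * h z) := by
          rw [← lintegral_indicator hU, ← lintegral_mul_const _ (hF.indicator hU)]
          congr 1 with u
          by_cases hu : u ∈ U <;> simp [hu, mul_assoc]
      _ ≤ ∫⁻ u, ∫⁻ w, U.indicator 1 u * (F w * F (z - u - w) * K (w, z - u - w)) := by
          refine lintegral_mono fun u => ?_
          by_cases hu : u ∈ U
          · simp only [hu, Set.indicator_of_mem, Pi.one_apply, one_mul]
            calc F u * F z * h z ≤ (∫⁻ w, F w * F (z - u - w)) * h z := by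
                  gcongr; exact hFF u z
              _ = ∫⁻ w, F w * F (z - u - w) * h z := by
                  rw [lintegral_mul_const _ (by fun_prop)]
              _ ≤ _ := lintegral_mono fun w => by
                  gcongr; exact hhK u hu z w
          · simp [hu]
      _ = ∫⁻ w, ∫⁻ u, U.indicator 1 u * (F w * F (z - u - w) * K (w, z - u - w)) := by
          refine lintegral_lintegral_swap (Measurable.aemeasurable ?_)
          simp only [Function.uncurry_def]
          fun_prop
      _ = ∫⁻ w, ∫⁻ y, U.indicator 1 (z - w - y) * (F w * F y * K (w, y)) := by
          congr 1 with w
          rw [← lintegral_sub_left_eq_self _ (z - w)]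
          congr 1 with u
          have e : z - (z - w - u) - w = u := by abel
          rw [e]
      _ = _ := by
          rw [Measure.volume_eq_prod, lintegral_prod _ hmeas.aemeasurable]
  calc (∫⁻ u in U, F u) * ∑' m : Λ, F (m - l) * h (m - l)
      = ∑' m : Λ, (∫⁻ u in U, F u) * (F (m - l) * h (m - l)) := ENNReal.tsum_mul_left.symm
    _ ≤ ∑' m : Λ, ∫⁻ p : V × V,
          U.indicator 1 ((m : V) - l - p.1 - p.2) * (F p.1 * F p.2 * K p) :=
        ENNReal.tsum_le_tsum fun m => hpoint _
    _ = ∫⁻ p : V × V, (∑' m : Λ, U.indicator 1 ((m : V) - (l + p.1 + p.2))) *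
          (F p.1 * F p.2 * K p) := by
        rw [← lintegral_tsum fun m => Measurable.aemeasurable (by fun_prop)]
        simp only [ENNReal.tsum_mul_right, sub_sub, add_assoc]
    _ ≤ ∫⁻ p : V × V, N * (F p.1 * F p.2 * K p) := lintegral_mono fun p => by
        gcongr; exact hN _
    _ = _ := lintegral_const_mul _ (by fun_prop)

lemma rpow_one_add_mul_norm_le {X : Type*} [SeminormedAddCommGroup X] {s ε ρ : ℝ} (hs : 0 ≤ s)
    (hε : 0 ≤ ε) {u z : X} (hu : ‖u‖ ≤ ρ)
    (w : X) : (1 + ε * ‖z‖) ^ s ≤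
      (1 + ε * ‖w‖) ^ s * (1 + ε * ‖z - u - w‖) ^ s * (1 + ε * ρ) ^ s := by
  have hρ : 0 ≤ ρ := (norm_nonneg u).trans hu
  rw [← Real.mul_rpow (by positivity) (by positivity),
    ← Real.mul_rpow (by positivity) (by positivity)]
  refine Real.rpow_le_rpow (by positivity) ?_ hs
  have h1 : ‖z‖ ≤ ‖w‖ + ‖z - u - w‖ + ρ := by
    calc ‖z‖ = ‖w + (z - u - w) + u‖ := by congr 1; abel
      _ ≤ ‖w‖ + ‖z - u - w‖ + ‖u‖ := norm_add₃_le
      _ ≤ _ := by gcongr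
  have h2 : ε * ‖z‖ ≤ ε * ‖w‖ + ε * ‖z - u - w‖ + ε * ρ := by
    rw [← mul_add, ← mul_add]; gcongr
  have a := mul_nonneg hε (norm_nonneg w)
  have b := mul_nonneg hε (norm_nonneg (z - u - w))
  have c := mul_nonneg hε hρ
  have ab := mul_nonneg a b
  have abc := mul_nonneg (add_nonneg (add_nonneg a b) ab) c
  nlinarith

/-- The product weight vanishes in the limit of small `ε`. -/
lemma tendsto_lintegral_prod_weight {F : V → ℝ≥0∞} (hF : Measurable F) {s ρ : ℝ} (hs : 0 ≤ s)
    (hρ : 0 ≤ ρ) (hint : ∫⁻ z, F z * ENNReal.ofReal ((1 + ‖z‖) ^ s) ≠ ∞) :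
    Tendsto (fun k : ℕ => ∫⁻ p : V × V, F p.1 * F p.2 *
      ENNReal.ofReal ((1 + (1 / ((k : ℝ) + 1)) * ‖p.1‖) ^ s * (1 + (1 / ((k : ℝ) + 1)) * ‖p.2‖) ^ s *
        (1 + (1 / ((k : ℝ) + 1)) * ρ) ^ s - 1)) atTop (𝓝 0) := by
  have hle1 : ∀ k : ℕ, 1 / ((k : ℝ) + 1) ≤ 1 := fun k => by
    rw [div_le_one (by positivity)]; linarith [(Nat.cast_nonneg k : (0 : ℝ) ≤ k)]
  have hFw : Measurable fun z => F z * ENNReal.ofReal ((1 + ‖z‖) ^ s) := by fun_prop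
  have hbound : ∫⁻ p : V × V, (F p.1 * ENNReal.ofReal ((1 + ‖p.1‖) ^ s)) *
      (F p.2 * ENNReal.ofReal ((1 + ‖p.2‖) ^ s)) * ENNReal.ofReal ((1 + ρ) ^ s) ≠ ∞ := by
    rw [lintegral_mul_const _ (by fun_prop), Measure.volume_eq_prod,
      lintegral_prod_mul hFw.aemeasurable hFw.aemeasurable]
    finiteness
  have hone : ∀ x : ℝ, 0 ≤ x → 1 ≤ ENNReal.ofReal ((1 + x) ^ s) := fun x hx => by
    rw [← ENNReal.ofReal_one]
    exact ENNReal.ofReal_le_ofReal (Real.one_le_rpow (by linarith) hs)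
  have hae : ∀ᵐ p : V × V, F p.1 * F p.2 < ∞ := by
    filter_upwards [ae_lt_top (by fun_prop) hbound] with p hp
    refine lt_of_le_of_lt ?_ hp
    calc F p.1 * F p.2 = (F p.1 * 1) * (F p.2 * 1) * 1 := by simp
      _ ≤ _ := by
        gcongr
        exacts [hone _ (norm_nonneg _), hone _ (norm_nonneg _), hone _ hρ]
  have h := tendsto_lintegral_of_dominated_convergence (μ := (volume : Measure (V × V)))
    (F := fun k : ℕ => fun p : V × V => F p.1 * F p.2 *
      ENNReal.ofReal ((1 + (1 / ((k : ℝ) + 1)) * ‖p.1‖) ^ s * (1 + (1 / ((k : ℝ) + 1)) * ‖p.2‖) ^ s *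
        (1 + (1 / ((k : ℝ) + 1)) * ρ) ^ s - 1)) (f := 0) _ (fun k => by fun_prop)
    (fun k => ae_of_all _ fun p => ?_) hbound ?_
  · simpa using h
  · have e : F p.1 * ENNReal.ofReal ((1 + ‖p.1‖) ^ s) * (F p.2 * ENNReal.ofReal ((1 + ‖p.2‖) ^ s)) *
        ENNReal.ofReal ((1 + ρ) ^ s) = F p.1 * F p.2 *
        ENNReal.ofReal ((1 + ‖p.1‖) ^ s * (1 + ‖p.2‖) ^ s * (1 + ρ) ^ s) := by
      rw [ENNReal.ofReal_mul (by positivity), ENNReal.ofReal_mul (by positivity)]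
      ring
    rw [e]
    have hk := hle1 k
    have hk0 : 0 ≤ 1 / ((k : ℝ) + 1) := by positivity
    refine mul_le_mul_right (ENNReal.ofReal_le_ofReal ((sub_le_self _ zero_le_one).trans ?_)) _
    gcongr <;> exact mul_le_of_le_one_left (by positivity) hk
  · filter_upwards [hae] with p hp
    have h0 : Tendsto (fun k : ℕ => (1 / ((k : ℝ) + 1))) atTop (𝓝 0) :=
      tendsto_one_div_add_atTop_nhds_zero_nat
    have h1 : ∀ a : ℝ, Tendsto (fun k : ℕ => (1 + (1 / ((k : ℝ) + 1)) * a) ^ s) atTop (𝓝 1) := by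
      intro a
      have := ((h0.mul_const a).const_add 1).rpow_const (p := s) (Or.inr hs)
      simpa using this
    have h2 := (((h1 ‖p.1‖).mul (h1 ‖p.2‖)).mul (h1 ρ)).sub_const 1
    have h3 := ENNReal.Tendsto.const_mul (ENNReal.tendsto_ofReal h2) (Or.inr hp.ne)
    simpa using h3

/-- If `F` satisfies a self-convolution inequality and has integrable moments of order `s`, then the
sums of `F` against `(1 + ε ‖·‖)^s - 1` over translates of a relatively separated set are uniformly
small for small `ε`. -/
theorem exists_pos_tsum_weight_le {F : V → ℝ≥0∞} (hF : Measurable F)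
    (hFF : ∀ u z, F u * F z ≤ ∫⁻ w, F w * F (z - u - w)) {s : ℝ} (hs : 0 ≤ s)
    (hint : ∫⁻ z, F z * ENNReal.ofReal ((1 + ‖z‖) ^ s) ≠ ∞)
    {Λ : Set V} (hΛ : Λ.Countable) {N : ℕ}
    (hN : ∀ z, ({l ∈ Λ | dist l z ≤ 1}).encard ≤ (N : ℕ∞)) {δ : ℝ} (hδ : 0 < δ) :
    ∃ ε : ℝ, 0 < ε ∧ ∀ l : V, ∑' m : Λ, F (m - l) *
      ENNReal.ofReal ((1 + ε * ‖(m : V) - l‖) ^ s - 1) ≤ ENNReal.ofReal δ := by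
  by_cases h0 : ∫⁻ z, F z = 0
  · have hF0 : ∀ z, F z = 0 := by
      intro z
      have h1 := hFF z z
      have h2 : ∫⁻ w, F w * F (z - z - w) = 0 := by
        rw [lintegral_eq_zero_iff hF] at h0
        rw [lintegral_eq_zero_iff (by fun_prop)]
        filter_upwards [h0] with w hw
        simp [hw]
      rw [h2] at h1
      simpa using h1
    exact ⟨1, one_pos, fun l => by simp [hF0]⟩
  obtain ⟨u₀, hu₀⟩ : ∃ u₀ : V, ∫⁻ u in Metric.closedBall u₀ 1, F u ≠ 0 := by
    by_contra! hcon
    refine h0 (le_antisymm ?_ (zero_le))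
    have hcov : (⋃ i, Metric.closedBall (TopologicalSpace.denseSeq V i) 1) = Set.univ := by
      refine Set.eq_univ_of_forall fun x => ?_
      obtain ⟨i, hi⟩ := (TopologicalSpace.denseRange_denseSeq V).exists_dist_lt x one_pos
      exact Set.mem_iUnion.2 ⟨i, hi.le⟩
    calc ∫⁻ z, F z = ∫⁻ z in ⋃ i, Metric.closedBall (TopologicalSpace.denseSeq V i) 1, F z := by
          rw [hcov, Measure.restrict_univ]
      _ ≤ _ := lintegral_iUnion_le _ _
      _ = 0 := by simp [hcon]
  have hFle : ∫⁻ z, F z ≤ ∫⁻ z, F z * ENNReal.ofReal ((1 + ‖z‖) ^ s) := by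
    refine lintegral_mono fun z => le_mul_of_one_le_right' ?_
    rw [← ENNReal.ofReal_one]
    exact ENNReal.ofReal_le_ofReal (Real.one_le_rpow (by linarith [norm_nonneg z]) hs)
  set κ := ∫⁻ u in Metric.closedBall u₀ 1, F u
  have hκ : κ ≠ ∞ :=
    ne_top_of_le_ne_top hint ((setLIntegral_le_lintegral _ _).trans hFle)
  set ρ := ‖u₀‖ + 1
  have hρ : 0 ≤ ρ := by positivity
  have hUρ : ∀ u ∈ Metric.closedBall u₀ 1, ‖u‖ ≤ ρ := by
    intro u hu
    have h1 : ‖u - u₀‖ ≤ 1 := by rwa [← dist_eq_norm]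
    have h2 := norm_sub_norm_le u u₀
    simp only [ρ]; linarith
  have hlim := ENNReal.Tendsto.const_mul (a := (N : ℝ≥0∞))
    (tendsto_lintegral_prod_weight hF hs hρ hint)
    (Or.inr (by simp))
  rw [mul_zero] at hlim
  have hpos : 0 < κ * ENNReal.ofReal δ := by
    rw [pos_iff_ne_zero]
    exact mul_ne_zero hu₀ (by simpa using hδ)
  obtain ⟨k, hk⟩ := (hlim.eventually (ge_mem_nhds hpos)).exists
  set ε : ℝ := 1 / ((k : ℝ) + 1)
  have hε : 0 < ε := by positivity
  refine ⟨ε, hε, fun l => ?_⟩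
  have hcnt : ∀ z, ∑' m : Λ, (Metric.closedBall u₀ 1).indicator (1 : V → ℝ≥0∞) ((m : V) - z) ≤ N := by
    intro z
    refine le_trans (le_of_eq ?_) (ENat.toENNReal_le.2 (hN (u₀ + z)))
    rw [← ENNReal.tsum_set_one, tsum_subtype Λ
      (fun m => (Metric.closedBall u₀ 1).indicator (1 : V → ℝ≥0∞) (m - z)),
      tsum_subtype {l ∈ Λ | dist l (u₀ + z) ≤ 1} (fun _ => (1 : ℝ≥0∞))]
    congr 1 with m
    have e : dist (m - z) u₀ = dist m (u₀ + z) := by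
      rw [dist_eq_norm, dist_eq_norm, sub_sub, add_comm z]
    by_cases h1 : m ∈ Λ <;> by_cases h2 : dist m (u₀ + z) ≤ 1 <;>
      simp [Set.indicator, h1, h2, e]
  have hmain := lintegral_mul_tsum_le hF hFF (U := Metric.closedBall u₀ 1)
    Metric.isClosed_closedBall.measurableSet
    (h := fun z => ENNReal.ofReal ((1 + ε * ‖z‖) ^ s - 1))
    (K := fun p => ENNReal.ofReal ((1 + ε * ‖p.1‖) ^ s * (1 + ε * ‖p.2‖) ^ s *
        (1 + ε * ρ) ^ s - 1)) (by fun_prop)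
    (fun u hu z w => ENNReal.ofReal_le_ofReal
      (sub_le_sub_right (rpow_one_add_mul_norm_le hs hε.le (hUρ u hu) w) 1)) hΛ hcnt l
  exact (ENNReal.mul_le_mul_iff_right hu₀ hκ).1 (hmain.trans hk)

end KernelDecay

section FourierInversion

open scoped FourierTransform ContDiff ComplexConjugate

variable {V : Type*} [NormedAddCommGroup V] [InnerProductSpace ℝ V] [FiniteDimensional ℝ V]
  [MeasurableSpace V] [BorelSpace V]

lemma integral_fourierInv_mul_eq {f k : V → ℂ} (hf : Integrable f) (hk : Integrable k) :
    ∫ x, 𝓕⁻ f x * k x = ∫ x, f x * 𝓕⁻ k x := by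
  have h := VectorFourier.integral_fourierIntegral_smul_eq_flip (e := Real.fourierChar)
    (L := -innerₗ V) (μ := (volume : Measure V)) (ν := (volume : Measure V)) (f := f) (g := k)
    Real.continuous_fourierChar (by simp; fun_prop) hf hk
  have e : (-innerₗ V).flip = -innerₗ V := by
    ext x y; simp [real_inner_comm]
  rw [e] at h
  exact h

/-- Almost everywhere version of the Fourier inversion formula, without continuity assumption. -/
theorem ae_fourierInv_fourier_eq {h : V → ℂ} (hh : Integrable h) (hFh : Integrable (𝓕 h)) :
    𝓕⁻ (𝓕 h) =ᵐ[volume] h := by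
  have hcont : Continuous (𝓕⁻ (𝓕 h)) :=
    VectorFourier.fourierIntegral_continuous Real.continuous_fourierChar
      (by simp; fun_prop) hFh
  refine ae_eq_of_integral_contDiff_smul_eq hcont.locallyIntegrable hh.locallyIntegrable ?_
  intro ψ hψ hsupp
  let φ : SchwartzMap V ℂ := (hsupp.comp_left (g := Complex.ofRealCLM) (by simp)).toSchwartzMap
    (Complex.ofRealCLM.contDiff.comp hψ)
  have hφ : ∀ x, φ x = (ψ x : ℂ) := fun x => rfl
  have hφi : Integrable (fun x => φ x) := φ.integrable
  have hφF : Integrable (𝓕⁻ (fun x => φ x)) := by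
    have := (𝓕⁻ φ).integrable (μ := (volume : Measure V))
    rwa [SchwartzMap.fourierInv_coe] at this
  have hinv : 𝓕 (𝓕⁻ (fun x => φ x)) = fun x => φ x := by
    have h2 : Integrable (𝓕 (fun x => φ x)) := (𝓕 φ).integrable (μ := (volume : Measure V))
    exact φ.continuous.fourier_fourierInv_eq hφi h2
  have h1 := VectorFourier.integral_fourierIntegral_smul_eq_flip (e := Real.fourierChar)
    (L := innerₗ V) (μ := (volume : Measure V)) (ν := (volume : Measure V)) (f := h)
    (g := 𝓕⁻ (fun x => φ x)) Real.continuous_fourierChar (by simp; fun_prop) hh hφF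
  have e : (innerₗ V).flip = innerₗ V := by
    ext x y; simp
  rw [e] at h1
  have h1' : ∫ x, 𝓕 h x * 𝓕⁻ (fun x => φ x) x = ∫ x, h x * 𝓕 (𝓕⁻ (fun x => φ x)) x := h1
  rw [hinv] at h1'
  have h2 := integral_fourierInv_mul_eq hFh hφi
  rw [h1'] at h2
  simp only [hφ] at h2
  simpa only [Complex.real_smul, mul_comm] using h2

lemma fourierInv_conj (k : V → ℂ) (x : V) : 𝓕⁻ (fun y => conj (k y)) x = conj (𝓕 k x) := by
  rw [Real.fourierInv_eq', Real.fourier_eq', ← integral_conj]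
  congr 1 with y
  simp [← Complex.exp_conj, map_ofNat]

/-- Half of Parseval's formula, as an inequality. -/
theorem enorm_integral_mul_conj_le {h k : V → ℂ} (hh : Integrable h) (hk : Integrable k)
    (hFh : Integrable (𝓕 h)) :
    ‖∫ x, h x * conj (k x)‖ₑ ≤ ∫⁻ x, ‖𝓕 h x‖ₑ * ‖𝓕 k x‖ₑ := by
  have hk' : Integrable (fun y => conj (k y)) := by
    simpa using (Complex.conjCLE.toContinuousLinearMap.integrable_comp hk)
  have h1 : ∫ x, h x * conj (k x) = ∫ x, 𝓕 h x * conj (𝓕 k x) := by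
    calc ∫ x, h x * conj (k x) = ∫ x, 𝓕⁻ (𝓕 h) x * conj (k x) := by
          refine integral_congr_ae ?_
          filter_upwards [ae_fourierInv_fourier_eq hh hFh] with x hx
          rw [hx]
      _ = _ := by
          rw [integral_fourierInv_mul_eq hFh hk']
          simp only [fourierInv_conj]
  rw [h1]
  refine (enorm_integral_le_lintegral_enorm _).trans (le_of_eq ?_)
  simp [enorm_mul]

end FourierInversion

section ShortTimeFourier

open scoped FourierTransform ComplexConjugate Convolution

variable {V : Type*} [NormedAddCommGroup V] [InnerProductSpace ℝ V] [FiniteDimensional ℝ V]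
  [MeasurableSpace V] [BorelSpace V]

lemma memLp_conj {f : V → ℂ} (hf : MemLp f 2) : MemLp (fun t => conj (f t)) 2 :=
  hf.star

lemma memLp_sub_right {f : V → ℂ} (hf : MemLp f 2) (x : V) : MemLp (fun t => f (t - x)) 2 :=
  hf.comp_measurePreserving (measurePreserving_sub_right volume x)

lemma integrable_mul_conj {f h : V → ℂ} (hf : MemLp f 2) (hh : MemLp h 2) :
    Integrable (fun t => f t * conj (h t)) :=
  hf.integrable_mul (memLp_conj hh)

lemma stronglyMeasurable_fourier_mul_conj {f h : V → ℂ} (hf : StronglyMeasurable f)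
    (hh : StronglyMeasurable h) :
    StronglyMeasurable (fun p : V × V => 𝓕 (fun t => f t * conj (h (t - p.1))) p.2) := by
  simp_rw [Real.fourier_eq']
  have h1 : StronglyMeasurable (fun q : (V × V) × V =>
      Complex.exp (↑(-2 * Real.pi * inner ℝ q.2 q.1.2) * Complex.I)) :=
    Continuous.stronglyMeasurable (by fun_prop)
  have h2 : StronglyMeasurable (fun q : (V × V) × V => f q.2 * conj (h (q.2 - q.1.1))) :=
    (hf.comp_measurable measurable_snd).mul (Complex.continuous_conj.comp_stronglyMeasurable
      (hh.comp_measurable (measurable_snd.sub (measurable_fst.comp measurable_fst))))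
  exact (h1.smul h2).integral_prod_right'

lemma integral_integral_sub_eq {φ ψ : V → ℂ} (hφ : Integrable φ) (hψ : Integrable ψ) :
    ∫ x, ∫ t, φ t * ψ (t - x) = (∫ t, φ t) * ∫ t, ψ t := by
  have h := integral_convolution (ContinuousLinearMap.mul ℂ ℂ) hφ hψ.comp_neg
  simp only [ContinuousLinearMap.mul_apply', integral_neg_eq_self] at h
  rw [← h]
  simp [convolution]

/-- Moyal's identity, as an inequality: `|⟨g, m⟩ ⟨g, k⟩|` is at most the integral of
`|V_g g| |V_k m|`. -/
theorem enorm_mul_enorm_le_lintegral_fourier {g m k : V → ℂ}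
    (hgm : StronglyMeasurable g) (hg : MemLp g 2)
    (hm : MemLp m 2) (hk : MemLp k 2)
    (hint : ∫⁻ x, ∫⁻ ξ, ‖𝓕 (fun t => g t * conj (g (t - x))) ξ‖ₑ < ⊤) :
    ‖∫ t, g t * conj (m t)‖ₑ * ‖∫ t, g t * conj (k t)‖ₑ ≤
      ∫⁻ x, ∫⁻ ξ, ‖𝓕 (fun t => g t * conj (g (t - x))) ξ‖ₑ *
        ‖𝓕 (fun t => m t * conj (k (t - x))) ξ‖ₑ := by
  have hmeas := stronglyMeasurable_fourier_mul_conj hgm hgm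
  have hφ : Integrable fun t => g t * conj (m t) := integrable_mul_conj hg hm
  have hψ : Integrable fun t => k t * conj (g t) := integrable_mul_conj hk hg
  have hQ := integral_integral_sub_eq hφ hψ
  have e1 : ‖∫ t, k t * conj (g t)‖ₑ = ‖∫ t, g t * conj (k t)‖ₑ := by
    rw [← RCLike.enorm_conj, ← integral_conj]
    simp [mul_comm]
  rw [← e1, ← enorm_mul, ← hQ]
  refine (enorm_integral_le_lintegral_enorm _).trans (lintegral_mono_ae ?_)
  have hfin : ∀ᵐ x, ∫⁻ ξ, ‖𝓕 (fun t => g t * conj (g (t - x))) ξ‖ₑ < ⊤ :=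
    ae_lt_top (hmeas.enorm.lintegral_prod_right') hint.ne
  filter_upwards [hfin] with x hx
  have h1 : Integrable (𝓕 (fun t => g t * conj (g (t - x)))) :=
    ⟨(hmeas.comp_measurable measurable_prodMk_left).aestronglyMeasurable, hx⟩
  have h2 := enorm_integral_mul_conj_le (integrable_mul_conj hg (memLp_sub_right hg x))
    (integrable_mul_conj hm (memLp_sub_right hk x)) h1
  refine le_trans (le_of_eq ?_) h2
  congr 2 with t
  simp
  ring

end ShortTimeFourier

section TimeFrequencyShift

open scoped FourierTransform ComplexConjugate

variable {d : ℕ}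

lemma sum_freqPart_mul (z : E2 d) (t : Ed d) :
    ∑ i : Fin d, (freqPart z i : ℂ) * (t i : ℂ) = ((inner ℝ t (freqPart z) : ℝ) : ℂ) := by
  simp [PiLp.inner_apply]

lemma tfShift_apply (z : E2 d) (g : Ed d → ℂ) (t : Ed d) :
    tfShift z g t = Complex.exp (((2 * Real.pi * inner ℝ t (freqPart z) : ℝ) : ℂ) * Complex.I) *
      g (t - timePart z) := by
  rw [tfShift, sum_freqPart_mul]
  congr 2
  push_cast
  ring

lemma norm_tfShift_apply (z : E2 d) (g : Ed d → ℂ) (t : Ed d) :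
    ‖tfShift z g t‖ = ‖g (t - timePart z)‖ := by
  rw [tfShift_apply, norm_mul, Complex.norm_exp_ofReal_mul_I, one_mul]

lemma memLp_tfShift {g : Ed d → ℂ} (hg : MemLp g 2) (z : E2 d) : MemLp (tfShift z g) 2 := by
  have h := memLp_sub_right hg (timePart z)
  refine h.of_le ?_ (ae_of_all _ fun t => (norm_tfShift_apply z g t).le)
  unfold tfShift
  exact (Continuous.aestronglyMeasurable (by fun_prop)).mul h.aestronglyMeasurable

@[simp] lemma timePart_add (z w : E2 d) : timePart (z + w) = timePart z + timePart w := rfl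

@[simp] lemma freqPart_add (z w : E2 d) : freqPart (z + w) = freqPart z + freqPart w := rfl

@[simp] lemma timePart_zero : timePart (0 : E2 d) = 0 := rfl

@[simp] lemma freqPart_zero : freqPart (0 : E2 d) = 0 := rfl

lemma tfShift_zero (g : Ed d → ℂ) : tfShift 0 g = g := by
  ext t; simp [tfShift_apply]

lemma exists_tfShift_tfShift (z w : E2 d) (g : Ed d → ℂ) :
    ∃ θ : ℝ, ∀ t, tfShift z (tfShift w g) t =
      Complex.exp (θ * Complex.I) * tfShift (z + w) g t := by
  refine ⟨-(2 * Real.pi * inner ℝ (timePart z) (freqPart w)), fun t => ?_⟩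
  simp only [tfShift_apply, timePart_add, freqPart_add, sub_sub, ← mul_assoc, ← Complex.exp_add]
  congr 2
  simp only [inner_sub_left, inner_add_right]
  push_cast
  ring

lemma norm_L2inner_const_mul_right (f h : Ed d → ℂ) (c : ℂ) :
    ‖L2inner f (fun t => c * h t)‖ = ‖c‖ * ‖L2inner f h‖ := by
  unfold L2inner
  rw [← RCLike.norm_conj c, ← norm_mul, ← integral_const_mul]
  congr 2 with t
  simp only [map_mul]
  ring

lemma norm_L2inner_tfShift_tfShift (f g : Ed d → ℂ) (z w : E2 d) :
    ‖L2inner f (tfShift z (tfShift w g))‖ = ‖L2inner f (tfShift (z + w) g)‖ := by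
  obtain ⟨θ, hθ⟩ := exists_tfShift_tfShift z w g
  rw [show tfShift z (tfShift w g) = _ from funext hθ, norm_L2inner_const_mul_right,
    Complex.norm_exp_ofReal_mul_I, one_mul]

lemma L2inner_tfShift_both (f h : Ed d → ℂ) (z : E2 d) :
    L2inner (tfShift z f) (tfShift z h) = L2inner f h := by
  unfold L2inner
  rw [← integral_sub_right_eq_self (fun t => f t * conj (h t)) (timePart z)]
  congr 1 with t
  rw [tfShift_apply, tfShift_apply, map_mul, mul_mul_mul_comm, RCLike.mul_conj,
    Complex.norm_exp_ofReal_mul_I]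
  simp

lemma norm_L2inner_tfShift_left (f h : Ed d → ℂ) (z w : E2 d) :
    ‖L2inner (tfShift z f) (tfShift w h)‖ = ‖L2inner f (tfShift (w - z) h)‖ := by
  rw [← L2inner_tfShift_both f _ z, norm_L2inner_tfShift_tfShift, add_sub_cancel]

lemma norm_L2inner_comm (f h : Ed d → ℂ) : ‖L2inner f h‖ = ‖L2inner h f‖ := by
  unfold L2inner
  rw [← RCLike.norm_conj, ← integral_conj]
  simp [mul_comm]

lemma norm_L2inner_tfShift_neg (g : Ed d → ℂ) (z : E2 d) :
    ‖L2inner g (tfShift (-z) g)‖ = ‖L2inner g (tfShift z g)‖ := by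
  rw [norm_L2inner_comm g (tfShift z g), ← zero_sub, ← norm_L2inner_tfShift_left, tfShift_zero]

lemma L2inner_tfShift_eq_fourier (f h : Ed d → ℂ) (z : E2 d) :
    L2inner f (tfShift z h) = 𝓕 (fun t => f t * conj (h (t - timePart z))) (freqPart z) := by
  rw [L2inner, Real.fourier_eq']
  congr 1 with t
  simp only [tfShift_apply, map_mul, ← Complex.exp_conj, Complex.conj_ofReal, Complex.conj_I,
    smul_eq_mul]
  rw [mul_left_comm]
  congr 2
  push_cast
  ring

lemma measurePreserving_timePart_freqPart :
    MeasurePreserving (fun z : E2 d => (timePart z, freqPart z)) volume volume := by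
  have h1 := PiLp.volume_preserving_ofLp (Fin d ⊕ Fin d)
  have h2 := volume_measurePreserving_sumPiEquivProdPi (fun _ : Fin d ⊕ Fin d => ℝ)
  have h3 := PiLp.volume_preserving_toLp (Fin d)
  exact ((h3.prod h3).comp h2).comp h1

lemma lintegral_timePart_freqPart {Φ : Ed d × Ed d → ENNReal} (hΦ : Measurable Φ) :
    ∫⁻ z : E2 d, Φ (timePart z, freqPart z) = ∫⁻ x, ∫⁻ ξ, Φ (x, ξ) := by
  rw [measurePreserving_timePart_freqPart.lintegral_comp hΦ, Measure.volume_eq_prod,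
    lintegral_prod _ hΦ.aemeasurable]

lemma measurable_enorm_L2inner_tfShift {f h : Ed d → ℂ} (hf : StronglyMeasurable f)
    (hh : StronglyMeasurable h) : Measurable fun z : E2 d => ‖L2inner f (tfShift z h)‖ₑ := by
  simp_rw [L2inner_tfShift_eq_fourier]
  exact Measurable.comp
    (g := fun p : Ed d × Ed d => ‖𝓕 (fun t => f t * conj (h (t - p.1))) p.2‖ₑ)
    (f := fun z : E2 d => (timePart z, freqPart z))
    (stronglyMeasurable_fourier_mul_conj hf hh).enorm
    measurePreserving_timePart_freqPart.measurable

/-- Moyal's identity for the short-time Fourier transform, as an inequality. -/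
theorem enorm_L2inner_mul_le_lintegral {g m k : Ed d → ℂ}
    (hgm : StronglyMeasurable g) (hmm : StronglyMeasurable m) (hkm : StronglyMeasurable k)
    (hg : MemLp g 2) (hm : MemLp m 2) (hk : MemLp k 2)
    (hint : ∫⁻ z : E2 d, ‖L2inner g (tfShift z g)‖ₑ < ⊤) :
    ‖L2inner g m‖ₑ * ‖L2inner g k‖ₑ ≤
      ∫⁻ w : E2 d, ‖L2inner g (tfShift w g)‖ₑ * ‖L2inner m (tfShift w k)‖ₑ := by
  have h1 := (stronglyMeasurable_fourier_mul_conj hgm hgm).enorm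
  have h2 := (stronglyMeasurable_fourier_mul_conj hmm hkm).enorm
  simp_rw [L2inner_tfShift_eq_fourier] at hint ⊢
  rw [lintegral_timePart_freqPart h1] at hint
  have h3 := lintegral_timePart_freqPart (h1.mul h2)
  simp only [Pi.mul_apply] at h3
  rw [h3]
  exact enorm_mul_enorm_le_lintegral_fourier hgm hg hm hk hint

lemma stronglyMeasurable_tfShift {g : Ed d → ℂ} (hg : StronglyMeasurable g) (z : E2 d) :
    StronglyMeasurable (tfShift z g) := by
  unfold tfShift
  exact (Continuous.stronglyMeasurable (by fun_prop)).mul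
    (hg.comp_measurable (measurable_id.sub_const _))

/-- The modulus `F` of the ambiguity function satisfies `F(u) F(z) ≤ ∫ F(w) F(z - u - w) dw`. -/
theorem enorm_ambiguity_mul_le_lintegral {g : Ed d → ℂ} (hgm : StronglyMeasurable g)
    (hg : MemLp g 2) (hint : ∫⁻ z : E2 d, ‖L2inner g (tfShift z g)‖ₑ < ⊤) (u z : E2 d) :
    ‖L2inner g (tfShift u g)‖ₑ * ‖L2inner g (tfShift z g)‖ₑ ≤
      ∫⁻ w : E2 d, ‖L2inner g (tfShift w g)‖ₑ * ‖L2inner g (tfShift (z - u - w) g)‖ₑ := by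
  rw [mul_comm]
  refine (enorm_L2inner_mul_le_lintegral hgm (stronglyMeasurable_tfShift hgm z)
    (stronglyMeasurable_tfShift hgm u) hg (memLp_tfShift hg z) (memLp_tfShift hg u)
    hint).trans (le_of_eq ?_)
  congr 1 with w
  congr 1
  rw [← ofReal_norm, ← ofReal_norm, norm_L2inner_tfShift_tfShift, norm_L2inner_tfShift_left,
    ← norm_L2inner_tfShift_neg]
  congr 4
  abel

end TimeFrequencyShift

section GaborSection

open scoped ENNReal InnerProductSpace ComplexConjugate

variable {d : ℕ}

/-- The time-frequency shift `π(z) g` as an element of `L²`. -/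
def tfShiftLp {g : Ed d → ℂ} (hg : MemLp g 2 (volume : Measure (Ed d))) (z : E2 d) :
    Lp ℂ 2 (volume : Measure (Ed d)) := (memLp_tfShift hg z).toLp

lemma inner_toLp {f h : Ed d → ℂ} (hf : MemLp f 2) (hh : MemLp h 2) :
    ⟪hf.toLp, hh.toLp⟫_ℂ = L2inner h f := by
  rw [L2.inner_def, L2inner]
  refine integral_congr_ae ?_
  filter_upwards [hf.coeFn_toLp, hh.coeFn_toLp] with t h1 h2
  rw [h1, h2]
  rfl

lemma L2normSq_eq_norm_toLp {f : Ed d → ℂ} (hf : MemLp f 2) :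
    L2normSq f = ‖hf.toLp‖ ^ 2 := by
  have h : ((‖hf.toLp‖ ^ 2 : ℝ) : ℂ) = ((L2normSq f : ℝ) : ℂ) := by
    have h1 := inner_self_eq_norm_sq_to_K (𝕜 := ℂ) hf.toLp
    rw [inner_toLp] at h1
    rw [L2normSq, ← integral_complex_ofReal, Complex.ofReal_pow]
    refine h1.symm.trans ?_
    rw [L2inner]
    congr 1 with t
    rw [RCLike.mul_conj]
    simp
  exact (Complex.ofReal_injective h).symm

lemma integral_norm_sq_sum_tfShift {g : Ed d → ℂ} (hg : MemLp g 2) {Λ : Set (E2 d)}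
    (s : Finset Λ) (c : Λ → ℂ) :
    ∫ t : Ed d, ‖∑ l ∈ s, c l * tfShift (l : E2 d) g t‖ ^ 2 =
      ‖∑ l ∈ s, c l • tfShiftLp hg (l : E2 d)‖ ^ 2 := by
  have hmem : MemLp (fun t => ∑ l ∈ s, c l * tfShift (l : E2 d) g t) 2 :=
    memLp_finsetSum s fun l _ => (memLp_tfShift hg l).const_mul (c l)
  have h := L2normSq_eq_norm_toLp hmem
  rw [L2normSq] at h
  rw [h]
  congr 2
  refine Lp.ext (hmem.coeFn_toLp.trans ?_)
  refine EventuallyEq.trans ?_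
    (Lp.coeFn_fun_finsetSum s fun l => c l • tfShiftLp hg (l : E2 d)).symm
  have h1 : ∀ᵐ t, ∀ l ∈ s, (c l • tfShiftLp hg (l : E2 d) : Lp ℂ 2 (volume : Measure (Ed d))) t =
      c l * tfShift (l : E2 d) g t := by
    refine (Filter.eventually_all_finset s).2 fun l _ => ?_
    filter_upwards [Lp.coeFn_smul (c l) (tfShiftLp hg (l : E2 d)),
      (memLp_tfShift hg (l : E2 d)).coeFn_toLp] with t ht1 ht2
    rw [ht1, Pi.smul_apply, smul_eq_mul, tfShiftLp, ht2]
  filter_upwards [h1] with t ht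
  exact Finset.sum_congr rfl fun l hl => (ht l hl).symm

lemma norm_inner_tfShiftLp {g : Ed d → ℂ} (hg : MemLp g 2) (z w : E2 d) :
    ‖⟪tfShiftLp hg z, tfShiftLp hg w⟫_ℂ‖ = ‖L2inner g (tfShift (w - z) g)‖ := by
  rw [tfShiftLp, tfShiftLp, inner_toLp, norm_L2inner_tfShift_left, ← norm_L2inner_tfShift_neg,
    neg_sub]

lemma finite_setOf_norm_le {Λ : Set (E2 d)} (hΛ : RelativelySeparated Λ) (R : ℝ) :
    {l : Λ | ‖(l : E2 d)‖ ≤ R}.Finite := by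
  obtain ⟨N, hN⟩ := hΛ
  obtain ⟨t, -, htf, ht⟩ := (isCompact_closedBall (0 : E2 d) R).finite_cover_balls one_pos
  have h1 : {l ∈ Λ | ‖l‖ ≤ R}.Finite := by
    refine (htf.biUnion fun z _ => Set.finite_of_encard_le_coe (hN z)).subset ?_
    rintro l ⟨hl, hlR⟩
    obtain ⟨z, hz, hlz⟩ := Set.mem_iUnion₂.1 (ht (by simpa using hlR))
    exact Set.mem_iUnion₂.2 ⟨z, hz, hl, (Metric.mem_ball.1 hlz).le⟩
  refine (h1.preimage Subtype.val_injective.injOn).subset fun l hl => ⟨l.2, hl⟩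

lemma L2inner_congr_ae {f f' h h' : Ed d → ℂ} (hf : f =ᵐ[volume] f') (hh : h =ᵐ[volume] h') :
    L2inner f h = L2inner f' h' := by
  refine integral_congr_ae ?_
  filter_upwards [hf, hh] with t h1 h2
  rw [h1, h2]

lemma tfShift_congr_ae {g g' : Ed d → ℂ} (h : g =ᵐ[volume] g') (z : E2 d) :
    tfShift z g =ᵐ[volume] tfShift z g' := by
  have h1 := (measurePreserving_sub_right (volume : Measure (Ed d))
    (timePart z)).quasiMeasurePreserving.ae_eq h
  filter_upwards [h1] with t ht
  rw [tfShift_apply, tfShift_apply]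
  congr 1

/-- Under the weighted integrability of the ambiguity function, the Gram matrix of the Gabor system
has small Schur norm against the commutator weight `(1 + ε |m - l|)^s - 1` for small `ε`. -/
theorem exists_pos_tsum_ambiguity_le {s : ℝ} (hs : 0 ≤ s) {g : Ed d → ℂ}
    (hg : MemLp g 2 (volume : Measure (Ed d)))
    (hint : ∫⁻ z : E2 d,
      ENNReal.ofReal (‖L2inner g (tfShift z g)‖ * (1 + ‖z‖) ^ s) < ⊤)
    {Λ : Set (E2 d)} (hΛc : Λ.Countable) (hΛs : RelativelySeparated Λ) {δ : ℝ} (hδ : 0 < δ) :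
    ∃ ε : ℝ, 0 < ε ∧ ∀ l : E2 d, ∑' m : Λ, ‖L2inner g (tfShift (m - l) g)‖ₑ *
      ENNReal.ofReal ((1 + ε * ‖(m : E2 d) - l‖) ^ s - 1) ≤ ENNReal.ofReal δ := by
  obtain ⟨N, hN⟩ := hΛs
  obtain ⟨g', hgm', hgg'⟩ := hg.aestronglyMeasurable
  have hg' : MemLp g' 2 := (memLp_congr_ae hgg').1 hg
  have hcongr : ∀ z, L2inner g (tfShift z g) = L2inner g' (tfShift z g') := fun z =>
    L2inner_congr_ae hgg' (tfShift_congr_ae hgg' z)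
  simp_rw [hcongr] at hint ⊢
  simp_rw [ENNReal.ofReal_mul (norm_nonneg _), ofReal_norm] at hint
  have hint' : ∫⁻ z : E2 d, ‖L2inner g' (tfShift z g')‖ₑ < ⊤ := by
    refine lt_of_le_of_lt (lintegral_mono fun z => le_mul_of_one_le_right' ?_) hint
    rw [← ENNReal.ofReal_one]
    exact ENNReal.ofReal_le_ofReal (Real.one_le_rpow (by linarith [norm_nonneg z]) hs)
  exact exists_pos_tsum_weight_le (measurable_enorm_L2inner_tfShift hgm' hgm')
    (enorm_ambiguity_mul_le_lintegral hgm' hg' hint') hs hint.ne hΛc hN hδ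

lemma abs_weight_div_sub_one_le {X : Type*} [SeminormedAddCommGroup X] {s ε : ℝ} (hs : 0 ≤ s)
    (hε : 0 ≤ ε) (x y : X) :
    |(1 + ε * ‖x‖) ^ s / (1 + ε * ‖y‖) ^ s - 1| ≤ (1 + ε * ‖x - y‖) ^ s - 1 := by
  have key : ∀ x y : X, (1 + ε * ‖x‖) ^ s ≤ (1 + ε * ‖y‖) ^ s * (1 + ε * ‖x - y‖) ^ s := by
    intro x y
    have h := rpow_one_add_mul_norm_le (ρ := 0) hs hε (norm_zero (E := X)).le (z := x) y
    simpa using h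
  have hpos : ∀ x : X, 0 < (1 + ε * ‖x‖) ^ s := fun x => by positivity
  have hq : 1 ≤ (1 + ε * ‖x - y‖) ^ s :=
    Real.one_le_rpow (by linarith [mul_nonneg hε (norm_nonneg (x - y))]) hs
  have h1 := key x y
  have h2 := key y x
  rw [norm_sub_rev] at h2
  have hx := hpos x
  have hy := hpos y
  set a := (1 + ε * ‖x‖) ^ s
  set b := (1 + ε * ‖y‖) ^ s
  set q := (1 + ε * ‖x - y‖) ^ s
  rw [abs_le]
  constructor
  · have : 2 - q ≤ a / b := by
      rw [le_div_iff₀ hy]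
      by_cases h : 2 - q ≤ 0
      · nlinarith
      · have h3 : (2 - q) * b ≤ (2 - q) * (a * q) := by
          gcongr
          linarith
        nlinarith [sq_nonneg (q - 1)]
    linarith
  · have : a / b ≤ q := by rw [div_le_iff₀ hy]; linarith
    linarith

lemma lowerRiesz_le {g : Ed d → ℂ} (hg : MemLp g 2) {Λ : Set (E2 d)} {n : ℕ} (s : Finset Λ)
    (c : Λ → ℂ) (hs : ∀ l ∈ s, ‖(l : E2 d)‖ ≤ n) (hc : 0 < ∑ l ∈ s, ‖c l‖ ^ 2) :
    lowerRiesz g Λ n ≤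
      ‖∑ l ∈ s, c l • tfShiftLp hg (l : E2 d)‖ ^ 2 / ∑ l ∈ s, ‖c l‖ ^ 2 := by
  refine csInf_le ⟨0, ?_⟩ ⟨s, c, hs, hc, by rw [integral_norm_sq_sum_tfShift hg]⟩
  rintro r ⟨s, c, -, hc, rfl⟩
  exact div_nonneg (integral_nonneg fun t => by positivity) hc.le

lemma lowerRiesz_le_L2normSq {g : Ed d → ℂ} (hg : MemLp g 2) (Λ : Set (E2 d)) (n : ℕ) :
    lowerRiesz g Λ n ≤ L2normSq g := by
  have h0 : 0 ≤ L2normSq g := integral_nonneg fun t => by positivity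
  by_cases h : ∃ l : Λ, ‖(l : E2 d)‖ ≤ n
  · obtain ⟨l, hl⟩ := h
    refine (lowerRiesz_le hg {l} (fun _ => 1) (by simpa using hl) (by simp)).trans (le_of_eq ?_)
    have e : L2normSq (tfShift (l : E2 d) g) = L2normSq g := by
      simp_rw [L2normSq, norm_tfShift_apply]
      exact integral_sub_right_eq_self (fun t => ‖g t‖ ^ 2) _
    rw [← e, L2normSq_eq_norm_toLp (memLp_tfShift hg l)]
    simp [tfShiftLp]
  · push Not at h
    refine (le_of_eq ?_).trans h0
    rw [lowerRiesz]
    convert Real.sInf_empty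
    refine Set.eq_empty_of_forall_notMem ?_
    rintro r ⟨s, c, hs, hc, -⟩
    have : s = ∅ := Finset.eq_empty_of_forall_notMem fun l hl => (h l).not_ge (hs l hl)
    simp [this] at hc

lemma summable_norm_inner_tfShiftLp_sq {g : Ed d → ℂ} (hg : MemLp g 2) {Λ : Set (E2 d)} {A B : ℝ}
    (h : GaborFrame g Λ A B) (f : Lp ℂ 2 (volume : Measure (Ed d))) :
    Summable (fun l : Λ => ‖⟪tfShiftLp hg (l : E2 d), f⟫_ℂ‖ ^ 2) ∧
      A * ‖f‖ ^ 2 ≤ ∑' l : Λ, ‖⟪tfShiftLp hg (l : E2 d), f⟫_ℂ‖ ^ 2 ∧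
      ∑' l : Λ, ‖⟪tfShiftLp hg (l : E2 d), f⟫_ℂ‖ ^ 2 ≤ B * ‖f‖ ^ 2 := by
  obtain ⟨hA, -, hfr⟩ := h
  have h1 := hfr f (Lp.memLp f)
  have e : ∀ l : Λ, L2inner f (tfShift (l : E2 d) g) = ⟪tfShiftLp hg (l : E2 d), f⟫_ℂ := by
    intro l
    rw [tfShiftLp]
    conv_rhs => rw [← Lp.toLp_coeFn f (Lp.memLp f)]
    rw [inner_toLp]
  simp_rw [e, L2normSq_eq_norm_toLp (Lp.memLp f), Lp.toLp_coeFn] at h1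
  refine ⟨?_, h1⟩
  by_cases hf : f = 0
  · simp [hf, summable_zero]
  · by_contra hns
    rw [tsum_eq_zero_of_not_summable hns] at h1
    have : 0 < A * ‖f‖ ^ 2 := by positivity
    linarith [h1.1]

end GaborSection

/-- **Polynomial decay of the lower Riesz bound.** For the weight `v(z) = (1+|z|)^s`, the
lower Riesz bounds of the finite sections satisfy `A_n = O(n^{-2s})`. -/
theorem lower_riesz_polynomial_decay {d : ℕ} (s : ℝ) (hs : 0 < s)
    (g : Ed d → ℂ) (hg : MemLp g 2 (volume : Measure (Ed d)))
    (hint : ∫⁻ z : E2 d,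
      ENNReal.ofReal (‖L2inner g (tfShift z g)‖ * (1 + ‖z‖) ^ s) < ⊤)
    (Λ : Set (E2 d)) (hΛc : Λ.Countable) (hΛs : RelativelySeparated Λ)
    (hframe : ∃ A B : ℝ, GaborFrame g Λ A B)
    (hnotRiesz : ¬ GaborRieszBasis g Λ) :
    ∃ C : ℝ, 0 < C ∧ ∀ n : ℕ, 1 ≤ n →
      lowerRiesz g Λ n ≤ C * (n : ℝ) ^ (-(2 * s)) := by
  obtain ⟨A, B, hAB⟩ := id hframe
  have hA := hAB.1
  have hB := hAB.2.1
  obtain ⟨c, hc, hck, l₁, hl₁⟩ : ∃ c : Λ → ℂ, Summable (fun l : Λ => ‖c l‖ ^ 2) ∧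
      InSynthKernel g Λ c ∧ ∃ l, c l ≠ 0 := by
    by_contra! hcon
    exact hnotRiesz ⟨hframe, hcon⟩
  have hDc : Tendsto (fun t : Finset Λ => ∑ l ∈ t, c l • tfShiftLp hg (l : E2 d)) atTop
      (nhds 0) := by
    rw [tendsto_zero_iff_norm_tendsto_zero]
    have h1 : Tendsto (fun t : Finset Λ => ‖∑ l ∈ t, c l • tfShiftLp hg (l : E2 d)‖ ^ 2) atTop
        (nhds 0) := by
      simpa only [InSynthKernel, integral_norm_sq_sum_tfShift hg] using hck
    simpa using h1.sqrt
  obtain ⟨ε, hε, hεδ⟩ := exists_pos_tsum_ambiguity_le hs.le hg hint hΛc hΛs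
    (show 0 < A / 8 by positivity)
  have hterm : ∀ l m : Λ, ‖inner ℂ (tfShiftLp hg (l : E2 d)) (tfShiftLp hg (m : E2 d)) *
      (((1 + ε * ‖(l : E2 d)‖) ^ s / (1 + ε * ‖(m : E2 d)‖) ^ s - 1 : ℝ) : ℂ)‖ₑ ≤
      ‖L2inner g (tfShift ((m : E2 d) - l) g)‖ₑ *
        ENNReal.ofReal ((1 + ε * ‖(m : E2 d) - l‖) ^ s - 1) := by
    intro l m
    rw [enorm_mul, ← ofReal_norm, norm_inner_tfShiftLp, ofReal_norm]
    gcongr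
    rw [← ofReal_norm, Complex.norm_real, Real.norm_eq_abs, norm_sub_rev]
    exact ENNReal.ofReal_le_ofReal (abs_weight_div_sub_one_le hs.le hε.le _ _)
  obtain ⟨u, ⟨l₀, hl₀⟩, K, hK, hu⟩ := exists_truncation_bound_of_frame
    (φ := fun l : Λ => tfShiftLp hg (l : E2 d)) hA hB.le
    (fun f => (summable_norm_inner_tfShiftLp_sq hg hAB f).1)
    (fun f => (summable_norm_inner_tfShiftLp_sq hg hAB f).2.1)
    (fun f => (summable_norm_inner_tfShiftLp_sq hg hAB f).2.2)
    (w := fun l : Λ => (1 + ε * ‖(l : E2 d)‖) ^ s)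
    (fun l => Real.one_le_rpow (by linarith [mul_nonneg hε.le (norm_nonneg (l : E2 d))]) hs.le)
    (fun l => (ENNReal.tsum_le_tsum fun m => hterm l m).trans (hεδ l))
    (fun m => (ENNReal.tsum_le_tsum fun l => (hterm l m).trans (le_of_eq (by
      rw [← neg_sub (l : E2 d) m, norm_neg, ← ofReal_norm, norm_L2inner_tfShift_neg,
        ofReal_norm]))).trans (hεδ m))
    hc ⟨l₁, hl₁⟩ hDc
  have hl₀' : 0 < ‖u l₀‖ ^ 2 := by positivity
  have hg0 : 0 ≤ L2normSq g := integral_nonneg fun t => by positivity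
  set R : ℝ := ‖(l₀ : E2 d)‖ + 1
  have hR : 0 < R := by positivity
  refine ⟨K * ε ^ (-(2 * s)) / ‖u l₀‖ ^ 2 + L2normSq g * R ^ (2 * s) + 1, by positivity,
    fun n hn => ?_⟩
  have hn0 : (0 : ℝ) < n := by exact_mod_cast hn
  have hp1 : 0 ≤ K * ε ^ (-(2 * s)) / ‖u l₀‖ ^ 2 := by positivity
  have hp2 : 0 ≤ L2normSq g * R ^ (2 * s) := by positivity
  have hp3 : 0 < (n : ℝ) ^ (-(2 * s)) := by positivity
  rcases le_or_gt R n with hRn | hRn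
  · set t : Finset Λ := (finite_setOf_norm_le hΛs n).toFinset
    have ht : ∀ l : Λ, l ∈ t ↔ ‖(l : E2 d)‖ ≤ n := fun l => by simp [t]
    have hsum : ‖u l₀‖ ^ 2 ≤ ∑ l ∈ t, ‖u l‖ ^ 2 :=
      Finset.single_le_sum (f := fun l => ‖u l‖ ^ 2) (fun l _ => by positivity)
        ((ht l₀).2 (by linarith))
    have hbd := hu t ((ε * n) ^ (-s)) (fun l hl => by
      rw [ht, not_le] at hl
      rw [← Real.rpow_neg (by positivity)]
      refine Real.rpow_le_rpow_of_nonpos (by positivity) ?_ (by linarith)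
      nlinarith)
    calc lowerRiesz g Λ n
        ≤ ‖∑ l ∈ t, u l • tfShiftLp hg (l : E2 d)‖ ^ 2 / ∑ l ∈ t, ‖u l‖ ^ 2 :=
          lowerRiesz_le hg t u (fun l hl => (ht l).1 hl) (hl₀'.trans_le hsum)
      _ ≤ K * ((ε * n) ^ (-s)) ^ 2 / ‖u l₀‖ ^ 2 := by gcongr
      _ = K * ε ^ (-(2 * s)) / ‖u l₀‖ ^ 2 * (n : ℝ) ^ (-(2 * s)) := by
          rw [← Real.rpow_natCast, ← Real.rpow_mul (by positivity),
            show -s * ((2 : ℕ) : ℝ) = -(2 * s) by push_cast; ring,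
            Real.mul_rpow hε.le hn0.le]
          ring
      _ ≤ _ := by gcongr; linarith
  · calc lowerRiesz g Λ n ≤ L2normSq g := lowerRiesz_le_L2normSq hg Λ n
      _ = L2normSq g * (n : ℝ) ^ (2 * s) * (n : ℝ) ^ (-(2 * s)) := by
          rw [mul_assoc, ← Real.rpow_add hn0]; simp
      _ ≤ L2normSq g * R ^ (2 * s) * (n : ℝ) ^ (-(2 * s)) := by gcongr
      _ ≤ _ := by gcongr; linarith
end
end
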